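/- Let n ≥ 1, s, m ∈ ℝ and 1 ≤ q ≤ ∞. Let a ∈ S^m(ℝ^n) and let φ(x,ξ) = x·ξ + |ξ|. Then there exists a constant C such that for every Schwartz function f on ℝ^n one has ‖T_a^φ f‖_{F^{s−m−(n−1)/2}_{1,q}} ≤ C ‖f‖_{F^s_{1,q}}. -/

import Mathlib

noncomputable section

open MeasureTheory Complex
open scoped ENNReal NNReal InnerProductSpace

/-- Euclidean space `ℝ^n`. -/
abbrev Rn (n : ℕ) := EuclideanSpace ℝ (Fin n)

/-- The Fourier transform `f̂(ξ) = ∫ e^{-i x·ξ} f(x) dx`. -/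
def ftransform (n : ℕ) (f : Rn n → ℂ) (ξ : Rn n) : ℂ :=
  ∫ x : Rn n, Complex.exp (-(Complex.I * ((⟪x, ξ⟫_ℝ : ℝ) : ℂ))) * f x

/-- The Fourier integral operator `T_a^φ f(x) = (2π)^{-n} ∫ a(x,ξ) e^{iφ(x,ξ)} f̂(ξ) dξ`. -/
def fio (n : ℕ) (a : Rn n → Rn n → ℂ) (φ : Rn n → Rn n → ℝ) (f : Rn n → ℂ) (x : Rn n) : ℂ :=
  ((((2 * Real.pi) ^ n)⁻¹ : ℝ) : ℂ) *
    ∫ ξ : Rn n, a x ξ * Complex.exp (Complex.I * ((φ x ξ : ℝ) : ℂ)) * ftransform n f ξ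

/-- The Littlewood–Paley pieces `ψ_j` built from `ψ_0`. -/
def lpPiece (n : ℕ) (ψ0 : Rn n → ℝ) (j : ℕ) (ξ : Rn n) : ℝ :=
  if j = 0 then ψ0 ξ
  else ψ0 ((2 : ℝ) ^ (-(j : ℤ)) • ξ) - ψ0 ((2 : ℝ) ^ (-(j : ℤ) + 1) • ξ)

/-- Hypotheses on the base function `ψ_0` of a Littlewood–Paley partition of unity. -/
def IsLPBase (n : ℕ) (ψ0 : Rn n → ℝ) : Prop :=
  ContDiff ℝ (⊤ : ℕ∞) ψ0 ∧ (∀ ξ : Rn n, ‖ξ‖ ≤ 1 → ψ0 ξ = 1) ∧ (∀ ξ : Rn n, 2 < ‖ξ‖ → ψ0 ξ = 0)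

/-- Inverse Fourier transform of a real-valued function. -/
def invFT (n : ℕ) (h : Rn n → ℝ) (x : Rn n) : ℂ :=
  ((((2 * Real.pi) ^ n)⁻¹ : ℝ) : ℂ) *
    ∫ ξ : Rn n, Complex.exp (Complex.I * ((⟪x, ξ⟫_ℝ : ℝ) : ℂ)) * ((h ξ : ℝ) : ℂ)

/-- The operator `h(D) g`: convolution of `g` with the inverse Fourier transform of `h`. -/
def smoothOp (n : ℕ) (h : Rn n → ℝ) (g : Rn n → ℂ) (x : Rn n) : ℂ :=
  ∫ y : Rn n, invFT n h (x - y) * g y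

/-- `ℓ^q`-norm of a sequence in `ℝ≥0∞`, for `0 < q ≤ ∞`. -/
def lqSum (q : ℝ≥0∞) (u : ℕ → ℝ≥0∞) : ℝ≥0∞ :=
  if q = ∞ then ⨆ j, u j else (∑' j, u j ^ q.toReal) ^ (1 / q.toReal)

/-- Besov–Lipschitz quasi-norm `‖g‖_{B^s_{p,q}}`. -/
def besovNorm (n : ℕ) (ψ0 : Rn n → ℝ) (s : ℝ) (p q : ℝ≥0∞) (g : Rn n → ℂ) : ℝ≥0∞ :=
  lqSum q fun j =>
    ENNReal.ofReal ((2 : ℝ) ^ ((j : ℝ) * s)) * eLpNorm (smoothOp n (lpPiece n ψ0 j) g) p volume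

/-- Triebel–Lizorkin quasi-norm `‖g‖_{F^s_{p,q}}`. -/
def tlNorm (n : ℕ) (ψ0 : Rn n → ℝ) (s : ℝ) (p q : ℝ≥0∞) (g : Rn n → ℂ) : ℝ≥0∞ :=
  if p = ∞ then
    essSup (fun x : Rn n => lqSum q fun j =>
      ENNReal.ofReal ((2 : ℝ) ^ ((j : ℝ) * s)) *
        (‖smoothOp n (lpPiece n ψ0 j) g x‖₊ : ℝ≥0∞)) volume
  else
    (∫⁻ x : Rn n, (lqSum q fun j =>
      ENNReal.ofReal ((2 : ℝ) ^ ((j : ℝ) * s)) *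
        (‖smoothOp n (lpPiece n ψ0 j) g x‖₊ : ℝ≥0∞)) ^ p.toReal ∂volume) ^ (1 / p.toReal)

/-- Critical order `m_c(p) = -(n-1)|1/p - 1/2|`. -/
def criticalOrder (n : ℕ) (p : ℝ≥0∞) : ℝ := -((n : ℝ) - 1) * |p⁻¹.toReal - 1 / 2|

/-- The symbol class `S^m(ℝ^n)`. -/
def SymbolClass (n : ℕ) (m : ℝ) (a : Rn n → Rn n → ℂ) : Prop :=
  ContDiff ℝ (⊤ : ℕ∞) (fun p : Rn n × Rn n => a p.1 p.2) ∧
  ∀ k l : ℕ, ∃ C : ℝ, ∀ x ξ : Rn n,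
    ‖iteratedFDeriv ℝ k (fun ξ' => iteratedFDeriv ℝ l (fun x' => a x' ξ') x) ξ‖ ≤
      C * (1 + ‖ξ‖ ^ 2) ^ ((m - (k : ℝ)) / 2)

/-- Smoothness away from `ξ = 0` and positive homogeneity of degree 1 in `ξ` of a phase. -/
def PhaseSmoothHomog (n : ℕ) (φ : Rn n → Rn n → ℝ) : Prop :=
  ContDiffOn ℝ (⊤ : ℕ∞) (fun p : Rn n × Rn n => φ p.1 p.2) {p : Rn n × Rn n | p.2 ≠ 0} ∧
  ∀ (x ξ : Rn n) (t : ℝ), 0 < t → φ x (t • ξ) = t * φ x ξ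

/-- The phase class `Φ^k`. -/
def PhaseClass (n : ℕ) (k : ℕ) (φ : Rn n → Rn n → ℝ) : Prop :=
  PhaseSmoothHomog n φ ∧
  ∀ a b : ℕ, k ≤ a + b → ∃ C : ℝ, ∀ x ξ : Rn n, ξ ≠ 0 →
    ‖ξ‖ ^ ((a : ℝ) - 1) *
      ‖iteratedFDerivWithin ℝ a
        (fun ξ' => iteratedFDeriv ℝ b (fun x' => φ x' ξ') x) {ξ' : Rn n | ξ' ≠ 0} ξ‖ ≤ C

/-- Determinant of the mixed Hessian `(∂²φ/∂x_i∂ξ_k)`. -/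
def mixedHessianDet (n : ℕ) (φ : Rn n → Rn n → ℝ) (x ξ : Rn n) : ℝ :=
  Matrix.det (Matrix.of fun i k : Fin n =>
    fderiv ℝ (fun x' => fderiv ℝ (fun ξ' => φ x' ξ') ξ (EuclideanSpace.single k 1)) x
      (EuclideanSpace.single i 1))

/-- The strong non-degeneracy (SND) condition. -/
def SNDCondition (n : ℕ) (φ : Rn n → Rn n → ℝ) : Prop :=
  ∃ δ : ℝ, 0 < δ ∧ ∀ x ξ : Rn n, ξ ≠ 0 → δ ≤ |mixedHessianDet n φ x ξ|

/-- Non-degeneracy of the phase on a compact set `K`. -/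
def NonDegenerateOn (n : ℕ) (φ : Rn n → Rn n → ℝ) (K : Set (Rn n)) : Prop :=
  ∀ x ∈ K, ∀ ξ : Rn n, ξ ≠ 0 → mixedHessianDet n φ x ξ ≠ 0

/-- The inverse Fourier integral `(2π)^{-n} ∫ e^{ix·ξ} m(ξ) dξ`. -/
def kern (n : ℕ) (m : Rn n → ℂ) (x : Rn n) : ℂ :=
  ((((2 * Real.pi) ^ n)⁻¹ : ℝ) : ℂ) *
    ∫ ξ : Rn n, Complex.exp (Complex.I * ((⟪x, ξ⟫_ℝ : ℝ) : ℂ)) * m ξ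

lemma norm_exp_I_mul_ofReal' (t : ℝ) : ‖Complex.exp (Complex.I * (t : ℂ))‖ = 1 := by
  rw [mul_comm]; exact Complex.norm_exp_ofReal_mul_I t

lemma norm_exp_neg_I_mul_ofReal (t : ℝ) : ‖Complex.exp (-(Complex.I * (t : ℂ)))‖ = 1 := by
  have := norm_exp_I_mul_ofReal' (-t)
  simpa using this

lemma invFT_eq_kern (n : ℕ) (h : Rn n → ℝ) : invFT n h = kern n (fun ξ => (h ξ : ℂ)) := rfl

lemma two_pi_pow_inv_pos (n : ℕ) : 0 < ((2 * Real.pi) ^ n)⁻¹ := by positivity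

lemma two_pi_pow_inv_le_one (n : ℕ) : ((2 * Real.pi) ^ n)⁻¹ ≤ 1 := by
  apply inv_le_one_of_one_le₀
  apply one_le_pow₀
  linarith [Real.pi_gt_three]

lemma norm_kern_le {n : ℕ} (m : Rn n → ℂ) (x : Rn n) : ‖kern n m x‖ ≤ ∫ ξ, ‖m ξ‖ := by
  unfold kern
  rw [norm_mul, Complex.norm_real, Real.norm_of_nonneg (two_pi_pow_inv_pos n).le]
  have h1 : ‖∫ ξ : Rn n, Complex.exp (Complex.I * ((⟪x, ξ⟫_ℝ : ℝ) : ℂ)) * m ξ‖ ≤ ∫ ξ, ‖m ξ‖ := by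
    refine (norm_integral_le_integral_norm _).trans (le_of_eq ?_)
    congr 1 with ξ
    rw [norm_mul, norm_exp_I_mul_ofReal', one_mul]
  calc _ ≤ 1 * ∫ ξ, ‖m ξ‖ :=
        mul_le_mul (two_pi_pow_inv_le_one n) h1 (norm_nonneg _) zero_le_one
    _ = _ := one_mul _

lemma integrable_exp_mul {n : ℕ} {m : Rn n → ℂ} (hm : Integrable m) (x : Rn n) :
    Integrable (fun ξ => Complex.exp (Complex.I * ((⟪x, ξ⟫_ℝ : ℝ) : ℂ)) * m ξ) := by
  refine hm.bdd_mul (c := 1) (by fun_prop) ?_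
  filter_upwards with ξ
  rw [norm_exp_I_mul_ofReal']

lemma kern_add {n : ℕ} {u v : Rn n → ℂ} (hu : Integrable u) (hv : Integrable v) (x : Rn n) :
    kern n (fun ξ => u ξ + v ξ) x = kern n u x + kern n v x := by
  unfold kern
  rw [← mul_add, ← integral_add (integrable_exp_mul hu x) (integrable_exp_mul hv x)]
  simp only [mul_add]

lemma kern_const_mul {n : ℕ} (c : ℂ) (u : Rn n → ℂ) (x : Rn n) :
    kern n (fun ξ => c * u ξ) x = c * kern n u x := by
  unfold kern
  simp only [mul_left_comm _ c]
  rw [integral_const_mul, mul_left_comm]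

lemma kern_neg {n : ℕ} (u : Rn n → ℂ) (x : Rn n) :
    kern n (fun ξ => - u ξ) x = - kern n u x := by
  have := kern_const_mul (-1) u x
  simpa using this

lemma kern_sub {n : ℕ} {u v : Rn n → ℂ} (hu : Integrable u) (hv : Integrable v) (x : Rn n) :
    kern n (fun ξ => u ξ - v ξ) x = kern n u x - kern n v x := by
  rw [sub_eq_add_neg, ← kern_neg, ← kern_add hu hv.fun_neg x]
  simp only [sub_eq_add_neg]

lemma kern_sum {n : ℕ} {ι : Type*} (s : Finset ι) {u : ι → Rn n → ℂ}
    (hu : ∀ i ∈ s, Integrable (u i)) (x : Rn n) :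
    kern n (fun ξ => ∑ i ∈ s, u i ξ) x = ∑ i ∈ s, kern n (u i) x := by
  unfold kern
  rw [← Finset.mul_sum, ← integral_finsetSum s (fun i hi => integrable_exp_mul (hu i hi) x)]
  simp only [Finset.mul_sum]

lemma continuous_kern {n : ℕ} {u : Rn n → ℂ} (hu : Integrable u) : Continuous (kern n u) := by
  unfold kern
  refine continuous_const.mul ?_
  refine continuous_of_dominated (bound := fun ξ => ‖u ξ‖) ?_ ?_ hu.norm ?_
  · intro x; exact (integrable_exp_mul hu x).aestronglyMeasurable
  · intro x; filter_upwards with ξ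
    rw [norm_mul, norm_exp_I_mul_ofReal', one_mul]
  · filter_upwards with ξ
    fun_prop

open scoped FourierTransform in
lemma kern_eq_fourierInv (n : ℕ) (u : Rn n → ℂ) (x : Rn n) :
    kern n u x = ((((2 * Real.pi) ^ n)⁻¹ : ℝ) : ℂ) * 𝓕⁻ u ((2 * Real.pi)⁻¹ • x) := by
  unfold kern
  rw [Real.fourierInv_eq']
  congr 2 with ξ
  rw [smul_eq_mul, inner_smul_right]
  congr 2
  rw [real_inner_comm]
  push_cast
  have : (Real.pi : ℂ) ≠ 0 := by exact_mod_cast Real.pi_ne_zero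
  field_simp

open scoped FourierTransform in
lemma ftransform_kern {n : ℕ} {u : Rn n → ℂ} (hc : Continuous u) (hu : Integrable u)
    (hk : Integrable (kern n u)) : ftransform n (kern n u) = u := by
  have h2 : (0 : ℝ) < 2 * Real.pi := by positivity
  have hpow : ((2 * Real.pi : ℝ) ^ n) ≠ 0 := by positivity
  have hI : 𝓕⁻ u = fun y => (((2 * Real.pi) ^ n : ℝ) : ℂ) * kern n u ((2 * Real.pi) • y) := by
    ext y
    rw [kern_eq_fourierInv, smul_smul, inv_mul_cancel₀ h2.ne', one_smul, ← mul_assoc,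
      ← Complex.ofReal_mul, mul_inv_cancel₀ hpow]
    simp
  have h_int : Integrable (𝓕⁻ u) := by
    rw [hI]
    exact (hk.comp_smul h2.ne').const_mul _
  have h_int' : Integrable (𝓕 u) := by
    have h3 : 𝓕 u = fun y => 𝓕⁻ u (-y) := by
      ext y
      rw [Real.fourierInv_eq_fourier_neg, neg_neg]
    rw [h3]
    exact h_int.comp_neg
  have hF := hc.fourier_fourierInv_eq hu h_int'
  ext ξ
  have h4 := congrFun hF ξ
  rw [← h4, Real.fourier_eq']
  have h5 := Measure.integral_comp_smul (volume : Measure (Rn n))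
    (fun x => Complex.exp (-(Complex.I * ((⟪x, ξ⟫_ℝ : ℝ) : ℂ))) * kern n u x) (2 * Real.pi)
  unfold ftransform
  have h6 : ∫ x : Rn n, Complex.exp (-(Complex.I * ((⟪x, ξ⟫_ℝ : ℝ) : ℂ))) * kern n u x =
      (((2 * Real.pi) ^ n : ℝ) : ℂ) * ∫ v : Rn n, Complex.exp (-(Complex.I *
        ((⟪(2 * Real.pi) • v, ξ⟫_ℝ : ℝ) : ℂ))) * kern n u ((2 * Real.pi) • v) := by
    rw [h5, finrank_euclideanSpace_fin, abs_of_pos (by positivity), Complex.real_smul,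
      ← mul_assoc, ← Complex.ofReal_mul, mul_inv_cancel₀ hpow]
    simp
  rw [h6, ← integral_const_mul]
  congr 1 with v
  rw [hI, smul_eq_mul, inner_smul_left]
  simp only [map_mul, conj_trivial]
  rw [mul_left_comm]
  congr 2
  push_cast
  ring_nf

lemma kern_mul_ftransform {n : ℕ} {ψ f : Rn n → ℂ} (hψ : Integrable ψ) (hf : Integrable f)
    (x : Rn n) :
    kern n (fun ξ => ψ ξ * ftransform n f ξ) x = ∫ y, kern n ψ (x - y) * f y := by
  have hprod : Integrable (fun p : Rn n × Rn n => ψ p.1 * f p.2) (volume.prod volume) :=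
    hψ.mul_prod hf
  have h_int : Integrable (Function.uncurry fun ξ y : Rn n =>
      Complex.exp (Complex.I * ((⟪x - y, ξ⟫_ℝ : ℝ) : ℂ)) * (ψ ξ * f y))
      (volume.prod volume) := by
    refine hprod.bdd_mul (c := 1) (by fun_prop) ?_
    filter_upwards with p
    rw [norm_exp_I_mul_ofReal']
  unfold kern ftransform
  calc _ = ((((2 * Real.pi) ^ n)⁻¹ : ℝ) : ℂ) * ∫ ξ : Rn n, ∫ y : Rn n,
        Complex.exp (Complex.I * ((⟪x - y, ξ⟫_ℝ : ℝ) : ℂ)) * (ψ ξ * f y) := by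
        congr 1
        congr 1 with ξ
        rw [← mul_assoc, ← integral_const_mul]
        congr 1 with y
        rw [inner_sub_left]
        push_cast
        rw [mul_sub, sub_eq_add_neg, Complex.exp_add]
        ring
    _ = ((((2 * Real.pi) ^ n)⁻¹ : ℝ) : ℂ) * ∫ y : Rn n, ∫ ξ : Rn n,
        Complex.exp (Complex.I * ((⟪x - y, ξ⟫_ℝ : ℝ) : ℂ)) * (ψ ξ * f y) := by
        rw [integral_integral_swap h_int]
    _ = _ := by
        rw [← integral_const_mul]
        congr 1 with y
        rw [mul_assoc, ← integral_mul_const]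
        congr 2 with ξ
        ring

lemma integrable_conv_mul {n : ℕ} {κ : Rn n → ℂ} (hκ : Integrable κ) (x : Rn n) {g : Rn n → ℂ}
    (hg : AEStronglyMeasurable g volume) {C : ℝ} (hb : ∀ y, ‖g y‖ ≤ C) :
    Integrable (fun y => κ (x - y) * g y) :=
  (hκ.comp_sub_left x).mul_bdd (c := C) hg (Filter.Eventually.of_forall hb)

/-- The Fourier multiplier with symbol `χ` acts as convolution with `kern χ`. -/
lemma kern_mul {n : ℕ} {χ u : Rn n → ℂ} (hc : Continuous χ) (hχ : Integrable χ)
    (hk : Integrable (kern n χ)) (hu : Integrable u) (x : Rn n) :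
    kern n (fun ξ => χ ξ * u ξ) x = ∫ y, kern n χ (x - y) * kern n u y := by
  have hk' : Integrable (fun y => kern n χ (x - y)) := hk.comp_sub_left x
  have h_int : Integrable (Function.uncurry fun y ξ : Rn n =>
      Complex.exp (Complex.I * ((⟪y, ξ⟫_ℝ : ℝ) : ℂ)) * (kern n χ (x - y) * u ξ))
      (volume.prod volume) := by
    refine (hk'.mul_prod hu).bdd_mul (c := 1) (by fun_prop) ?_
    filter_upwards with p
    rw [norm_exp_I_mul_ofReal']
  symm
  calc _ = ∫ y, ((((2 * Real.pi) ^ n)⁻¹ : ℝ) : ℂ) * ∫ ξ : Rn n,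
        Complex.exp (Complex.I * ((⟪y, ξ⟫_ℝ : ℝ) : ℂ)) * (kern n χ (x - y) * u ξ) := by
        congr 1 with y
        conv_lhs => rw [kern.eq_def n u y]
        rw [mul_left_comm, ← integral_const_mul]
        congr 2 with ξ
        ring
    _ = ((((2 * Real.pi) ^ n)⁻¹ : ℝ) : ℂ) * ∫ ξ : Rn n, ∫ y,
        Complex.exp (Complex.I * ((⟪y, ξ⟫_ℝ : ℝ) : ℂ)) * (kern n χ (x - y) * u ξ) := by
        rw [integral_const_mul, integral_integral_swap h_int]
    _ = _ := by
        rw [kern.eq_def]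
        congr 2 with ξ
        rw [← integral_sub_left_eq_self _ volume x]
        simp only [sub_sub_cancel]
        conv_rhs => rw [← ftransform_kern hc hχ hk]
        unfold ftransform
        rw [← mul_assoc, ← integral_const_mul, ← integral_mul_const]
        congr 1 with y
        rw [inner_sub_left]
        push_cast
        rw [mul_sub, sub_eq_add_neg, Complex.exp_add]
        ring

/-- The autocorrelation of `kern u` is `kern |u|²`. -/
lemma integral_kern_mul_conj {n : ℕ} {u : Rn n → ℂ} (hc : Continuous u) (hu : Integrable u)
    (hk : Integrable (kern n u)) (w : Rn n) :
    ∫ x, kern n u (x + w) * (starRingEnd ℂ) (kern n u x) =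
      kern n (fun ξ => u ξ * (starRingEnd ℂ) (u ξ)) w := by
  have hk' : Integrable (fun y => kern n u (y + w)) := hk.comp_add_right w
  have hu' : Integrable (fun ξ => (starRingEnd ℂ) (u ξ)) :=
    (LinearIsometryEquiv.integrable_comp_iff Complex.conjLIE).2 hu
  have h_int : Integrable (Function.uncurry fun x ξ : Rn n =>
      Complex.exp (-(Complex.I * ((⟪x, ξ⟫_ℝ : ℝ) : ℂ))) * (kern n u (x + w) *
        (starRingEnd ℂ) (u ξ))) (volume.prod volume) := by
    refine (hk'.mul_prod hu').bdd_mul (c := 1) (by fun_prop) ?_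
    filter_upwards with p
    rw [norm_exp_neg_I_mul_ofReal]
  calc _ = ∫ x, ((((2 * Real.pi) ^ n)⁻¹ : ℝ) : ℂ) * ∫ ξ : Rn n,
        Complex.exp (-(Complex.I * ((⟪x, ξ⟫_ℝ : ℝ) : ℂ))) * (kern n u (x + w) *
        (starRingEnd ℂ) (u ξ)) := by
        congr 1 with x
        conv_lhs => rw [kern.eq_def n u x]
        rw [map_mul, Complex.conj_ofReal, mul_left_comm, ← integral_conj, ← integral_const_mul]
        congr 2 with ξ
        rw [map_mul, ← Complex.exp_conj]
        simp only [map_mul, Complex.conj_I, Complex.conj_ofReal, neg_mul]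
        ring
    _ = ((((2 * Real.pi) ^ n)⁻¹ : ℝ) : ℂ) * ∫ ξ : Rn n, ∫ x,
        Complex.exp (-(Complex.I * ((⟪x, ξ⟫_ℝ : ℝ) : ℂ))) * (kern n u (x + w) *
        (starRingEnd ℂ) (u ξ)) := by
        rw [integral_const_mul, integral_integral_swap h_int]
    _ = _ := by
        rw [kern.eq_def]
        congr 2 with ξ
        rw [← integral_sub_right_eq_self _ w]
        simp only [sub_add_cancel]
        conv_rhs => enter [2, 1]; rw [← congrFun (ftransform_kern hc hu hk) ξ]
        unfold ftransform
        rw [← mul_assoc, ← integral_const_mul, ← integral_mul_const]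
        congr 1 with y
        rw [inner_sub_left]
        push_cast
        rw [mul_sub, neg_sub, sub_eq_add_neg, Complex.exp_add]
        ring

/-- The partial derivative of `u` in the `i`-th coordinate direction. -/
def pd {n : ℕ} (i : Fin n) (u : Rn n → ℂ) (ξ : Rn n) : ℂ :=
  fderiv ℝ u ξ (EuclideanSpace.single i (1 : ℝ))

/-- Smooth compactly supported functions. -/
def Tst {n : ℕ} (χ : Rn n → ℂ) : Prop := ContDiff ℝ (⊤ : ℕ∞) χ ∧ HasCompactSupport χ

/-- Dilation by `2^k` on the Fourier side. -/
def dil {n : ℕ} (k : ℕ) (χ : Rn n → ℂ) (ξ : Rn n) : ℂ := χ (((2 : ℝ) ^ k)⁻¹ • ξ)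

lemma ContDiff.pd {n : ℕ} {u : Rn n → ℂ} (hu : ContDiff ℝ (⊤ : ℕ∞) u) (i : Fin n) :
    ContDiff ℝ (⊤ : ℕ∞) (pd i u) := by
  have h : ContDiff ℝ (⊤ : ℕ∞) (fderiv ℝ u) := hu.fderiv_right (by exact_mod_cast le_top)
  exact h.clm_apply contDiff_const

lemma tsupport_pd_subset {n : ℕ} (u : Rn n → ℂ) (i : Fin n) :
    tsupport (pd i u) ⊆ tsupport u := by
  refine (closure_mono ?_).trans (tsupport_fderiv_subset ℝ (f := u))
  intro ξ hξ
  simp only [Function.mem_support, pd] at hξ ⊢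
  intro h
  rw [h] at hξ
  simp at hξ

lemma Tst.of_subset {n : ℕ} {u v : Rn n → ℂ} (hv : Tst v) (hu : ContDiff ℝ (⊤ : ℕ∞) u)
    (h : tsupport u ⊆ tsupport v) : Tst u :=
  ⟨hu, hv.2.of_isClosed_subset (isClosed_tsupport _) h⟩

lemma Tst.pd {n : ℕ} {u : Rn n → ℂ} (hu : Tst u) (i : Fin n) : Tst (pd i u) :=
  hu.of_subset (ContDiff.pd hu.1 i) (tsupport_pd_subset u i)

lemma Tst.continuous {n : ℕ} {u : Rn n → ℂ} (hu : Tst u) : Continuous u := hu.1.continuous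

lemma Tst.integrable {n : ℕ} {u : Rn n → ℂ} (hu : Tst u) : Integrable u :=
  hu.continuous.integrable_of_hasCompactSupport hu.2

lemma tsupport_mul_right_subset {n : ℕ} (g u : Rn n → ℂ) :
    tsupport (fun ξ => g ξ * u ξ) ⊆ tsupport u :=
  closure_mono (Function.support_mul_subset_right g u)

lemma contDiff_mul_of_tsupport {n : ℕ} {g u : Rn n → ℂ} (hu : ContDiff ℝ (⊤ : ℕ∞) u)
    (hg : ∀ ξ ∈ tsupport u, ContDiffAt ℝ (⊤ : ℕ∞) g ξ) :
    ContDiff ℝ (⊤ : ℕ∞) (fun ξ => g ξ * u ξ) := by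
  refine contDiff_iff_contDiffAt.2 fun ξ => ?_
  by_cases hξ : ξ ∈ tsupport u
  · exact (hg ξ hξ).mul hu.contDiffAt
  · refine (contDiffAt_const (c := (0 : ℂ))).congr_of_eventuallyEq ?_
    filter_upwards [notMem_tsupport_iff_eventuallyEq.1 hξ] with η hη
    rw [hη]
    simp

lemma Tst.mul_left {n : ℕ} {g u : Rn n → ℂ} (hu : Tst u)
    (hg : ∀ ξ ∈ tsupport u, ContDiffAt ℝ (⊤ : ℕ∞) g ξ) : Tst (fun ξ => g ξ * u ξ) :=
  hu.of_subset (contDiff_mul_of_tsupport hu.1 hg) (tsupport_mul_right_subset g u)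

lemma Tst.const_mul {n : ℕ} {u : Rn n → ℂ} (hu : Tst u) (c : ℂ) : Tst (fun ξ => c * u ξ) :=
  hu.mul_left fun _ _ => contDiffAt_const

lemma Tst.add {n : ℕ} {u v : Rn n → ℂ} (hu : Tst u) (hv : Tst v) : Tst (fun ξ => u ξ + v ξ) :=
  ⟨hu.1.add hv.1, hu.2.add hv.2⟩

lemma Tst.mul_contDiff {n : ℕ} {g u : Rn n → ℂ} (hu : Tst u) (hg : ContDiff ℝ (⊤ : ℕ∞) g) :
    Tst (fun ξ => g ξ * u ξ) := hu.mul_left fun _ _ => hg.contDiffAt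

lemma inner_single_one {n : ℕ} (w : Rn n) (i : Fin n) :
    ⟪w, EuclideanSpace.single i (1 : ℝ)⟫_ℝ = w i := by
  simp [EuclideanSpace.inner_single_right]

lemma hasFDerivAt_exp_inner {n : ℕ} (w ξ : Rn n) :
    HasFDerivAt (fun ξ : Rn n => Complex.exp (Complex.I * ((⟪w, ξ⟫_ℝ : ℝ) : ℂ)))
      (Complex.exp (Complex.I * ((⟪w, ξ⟫_ℝ : ℝ) : ℂ)) •
        (Complex.I • (Complex.ofRealCLM.comp (innerSL ℝ w)))) ξ := by
  have h1 : HasFDerivAt (fun ξ : Rn n => ((⟪w, ξ⟫_ℝ : ℝ) : ℂ))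
      (Complex.ofRealCLM.comp (innerSL ℝ w)) ξ :=
    (Complex.ofRealCLM.comp (innerSL ℝ w)).hasFDerivAt
  exact (h1.const_mul Complex.I).cexp

lemma pd_exp_inner {n : ℕ} (w ξ : Rn n) (i : Fin n) :
    pd i (fun ξ : Rn n => Complex.exp (Complex.I * ((⟪w, ξ⟫_ℝ : ℝ) : ℂ))) ξ =
      Complex.I * (w i : ℂ) * Complex.exp (Complex.I * ((⟪w, ξ⟫_ℝ : ℝ) : ℂ)) := by
  unfold pd
  rw [(hasFDerivAt_exp_inner w ξ).fderiv]
  simp only [smul_apply, ContinuousLinearMap.comp_apply, innerSL_apply_apply,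
    inner_single_one, Complex.ofRealCLM_apply, smul_eq_mul]
  ring

lemma contDiff_exp_inner {n : ℕ} (w : Rn n) : ContDiff ℝ (⊤ : ℕ∞)
    (fun ξ : Rn n => Complex.exp (Complex.I * ((⟪w, ξ⟫_ℝ : ℝ) : ℂ))) := by
  have h1 : ContDiff ℝ (⊤ : ℕ∞) (fun ξ : Rn n => ((⟪w, ξ⟫_ℝ : ℝ) : ℂ)) :=
    (Complex.ofRealCLM.comp (innerSL ℝ w)).contDiff
  exact (contDiff_const.mul h1).cexp

lemma kern_pd {n : ℕ} {u : Rn n → ℂ} (hu : Tst u) (i : Fin n) (w : Rn n) :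
    kern n (pd i u) w = -(Complex.I * (w i : ℂ)) * kern n u w := by
  unfold kern
  have h := integral_mul_fderiv_eq_neg_fderiv_mul_of_integrable (μ := (volume : Measure (Rn n)))
    (f := fun ξ : Rn n => Complex.exp (Complex.I * ((⟪w, ξ⟫_ℝ : ℝ) : ℂ))) (g := u)
    (v := EuclideanSpace.single i (1 : ℝ)) ?_ ?_ ?_ ?_ ?_
  · have h2 : ∀ ξ : Rn n, fderiv ℝ u ξ (EuclideanSpace.single i (1 : ℝ)) = pd i u ξ :=
      fun ξ => rfl
    have h3 : ∀ ξ : Rn n, fderiv ℝ (fun ξ : Rn n =>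
        Complex.exp (Complex.I * ((⟪w, ξ⟫_ℝ : ℝ) : ℂ))) ξ (EuclideanSpace.single i (1 : ℝ)) =
        Complex.I * (w i : ℂ) * Complex.exp (Complex.I * ((⟪w, ξ⟫_ℝ : ℝ) : ℂ)) :=
      fun ξ => pd_exp_inner w ξ i
    simp only [h2, h3] at h
    rw [h]
    simp only [mul_assoc]
    rw [integral_const_mul, integral_const_mul]
    ring
  · have h3 : ∀ ξ : Rn n, fderiv ℝ (fun ξ : Rn n =>
        Complex.exp (Complex.I * ((⟪w, ξ⟫_ℝ : ℝ) : ℂ))) ξ (EuclideanSpace.single i (1 : ℝ)) =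
        Complex.I * (w i : ℂ) * Complex.exp (Complex.I * ((⟪w, ξ⟫_ℝ : ℝ) : ℂ)) :=
      fun ξ => pd_exp_inner w ξ i
    simp only [h3, mul_assoc]
    exact ((integrable_exp_mul hu.integrable w).const_mul _).const_mul _
  · exact integrable_exp_mul (hu.pd i).integrable w
  · exact integrable_exp_mul hu.integrable w
  · exact fun x _ => ((contDiff_exp_inner w).differentiable (by simp)) x
  · exact fun x _ => (hu.1.differentiable (by simp)) x

lemma kern_dil {n : ℕ} (k : ℕ) (χ : Rn n → ℂ) (x : Rn n) :
    kern n (dil k χ) x = (((2 : ℝ) ^ k) ^ n : ℝ) * kern n χ ((2 : ℝ) ^ k • x) := by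
  have hk : (0 : ℝ) < 2 ^ k := by positivity
  have h := Measure.integral_comp_inv_smul (volume : Measure (Rn n))
    (fun ξ => Complex.exp (Complex.I * ((⟪(2 : ℝ) ^ k • x, ξ⟫_ℝ : ℝ) : ℂ)) * χ ξ) ((2 : ℝ) ^ k)
  rw [finrank_euclideanSpace_fin, abs_of_pos (by positivity), Complex.real_smul] at h
  unfold kern dil
  rw [mul_left_comm, ← h]
  congr 2 with ξ
  rw [inner_smul_left, inner_smul_right]
  simp only [conj_trivial]
  rw [← mul_assoc, mul_inv_cancel₀ hk.ne', one_mul]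

lemma Tst.dil {n : ℕ} {u : Rn n → ℂ} (hu : Tst u) (k : ℕ) : Tst (dil k u) := by
  refine ⟨hu.1.comp (contDiff_const_smul _), ?_⟩
  exact hu.2.comp_homeomorph (Homeomorph.smulOfNeZero (((2 : ℝ) ^ k)⁻¹) (by positivity))

lemma pd_mul {n : ℕ} {u v : Rn n → ℂ} {ξ : Rn n} (hu : DifferentiableAt ℝ u ξ)
    (hv : DifferentiableAt ℝ v ξ) (i : Fin n) :
    pd i (fun ξ => u ξ * v ξ) ξ = pd i u ξ * v ξ + u ξ * pd i v ξ := by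
  unfold pd
  rw [fderiv_fun_mul hu hv]
  simp only [add_apply, smul_apply, smul_eq_mul]
  ring

lemma norm_le_sum_abs {n : ℕ} (x : Rn n) : ‖x‖ ≤ ∑ i, |x i| := by
  have h : x = ∑ i, EuclideanSpace.single i (x i) := by
    ext j
    simp
  calc ‖x‖ = ‖∑ i, EuclideanSpace.single i (x i)‖ := by rw [← h]
    _ ≤ ∑ i, ‖EuclideanSpace.single i (x i)‖ := norm_sum_le _ _
    _ = ∑ i, |x i| := by simp

lemma one_add_norm_pow_le {n : ℕ} (N : ℕ) : ∃ C : ℝ, 0 ≤ C ∧ ∀ x : Rn n,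
    (1 + ‖x‖) ^ N ≤ C * (1 + ∑ i, |x i| ^ N) := by
  rcases N with _ | N
  · refine ⟨1, zero_le_one, fun x => ?_⟩
    simp
  refine ⟨(2 : ℝ) ^ N * (1 + (n : ℝ) ^ N), by positivity, fun x => ?_⟩
  have hs : 0 ≤ ∑ i : Fin n, |x i| ^ (N + 1) := Finset.sum_nonneg fun i _ => by positivity
  have h1 : (1 + ‖x‖) ^ (N + 1) ≤ 2 ^ N * (1 ^ (N + 1) + ‖x‖ ^ (N + 1)) :=
    add_pow_le zero_le_one (norm_nonneg _) _
  have h2 : ‖x‖ ^ (N + 1) ≤ (n : ℝ) ^ N * ∑ i, |x i| ^ (N + 1) := by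
    have h4 := pow_sum_le_card_mul_sum_pow (s := Finset.univ) (f := fun i => |x i|)
      (fun i _ => abs_nonneg _) N
    refine (pow_le_pow_left₀ (norm_nonneg _) (norm_le_sum_abs x) _).trans (h4.trans ?_)
    simp
  rw [one_pow] at h1
  calc _ ≤ 2 ^ N * (1 + ‖x‖ ^ (N + 1)) := h1
    _ ≤ 2 ^ N * ((1 + (n : ℝ) ^ N) * (1 + ∑ i, |x i| ^ (N + 1))) := by
        gcongr
        nlinarith [show (0 : ℝ) ≤ (n : ℝ) ^ N by positivity]
    _ = _ := by ring

lemma Tst.abs_pow_mul_norm_kern_le {n : ℕ} (N : ℕ) (i : Fin n) : ∀ {u : Rn n → ℂ}, Tst u →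
    ∃ C : ℝ, ∀ x : Rn n, |x i| ^ N * ‖kern n u x‖ ≤ C := by
  induction N with
  | zero =>
    intro u hu
    exact ⟨_, fun x => by simpa using norm_kern_le u x⟩
  | succ N ih =>
    intro u hu
    obtain ⟨C, hC⟩ := ih (hu.pd i)
    refine ⟨C, fun x => ?_⟩
    have := hC x
    rw [kern_pd hu, norm_mul, norm_neg, norm_mul, Complex.norm_I, one_mul, Complex.norm_real,
      Real.norm_eq_abs] at this
    rwa [pow_succ, mul_assoc]

lemma exists_decay_of_coord {n : ℕ} {ι : Type*} {F : ι → Rn n → ℂ} (N : ℕ)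
    (h0 : ∃ C : ℝ, ∀ t x, ‖F t x‖ ≤ C)
    (h : ∀ i : Fin n, ∃ C : ℝ, ∀ t x, |x i| ^ N * ‖F t x‖ ≤ C) :
    ∃ C : ℝ, 0 ≤ C ∧ ∀ t x, (1 + ‖x‖) ^ N * ‖F t x‖ ≤ C := by
  obtain ⟨C1, hC1, h1⟩ := one_add_norm_pow_le (n := n) N
  obtain ⟨C0, h0⟩ := h0
  choose D hD using h
  refine ⟨|C1 * (C0 + ∑ i, D i)|, abs_nonneg _, fun t x => le_trans ?_ (le_abs_self _)⟩
  calc _ ≤ C1 * (1 + ∑ i, |x i| ^ N) * ‖F t x‖ := by gcongr; exact h1 x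
    _ = C1 * (‖F t x‖ + ∑ i, |x i| ^ N * ‖F t x‖) := by rw [← Finset.sum_mul]; ring
    _ ≤ _ := by
      gcongr with i
      · exact h0 t x
      · exact hD i t x

lemma Tst.decay {n : ℕ} {u : Rn n → ℂ} (hu : Tst u) (N : ℕ) :
    ∃ C : ℝ, 0 ≤ C ∧ ∀ x, (1 + ‖x‖) ^ N * ‖kern n u x‖ ≤ C := by
  obtain ⟨C, hC, h⟩ := exists_decay_of_coord (ι := Unit) (F := fun _ => kern n u) N
    ⟨_, fun _ x => norm_kern_le u x⟩ (fun i => by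
      obtain ⟨C, hC⟩ := hu.abs_pow_mul_norm_kern_le N i
      exact ⟨C, fun _ => hC⟩)
  exact ⟨C, hC, h ()⟩

/-- Smooth compactly supported functions vanishing near the origin. -/
def Tst0 {n : ℕ} (χ : Rn n → ℂ) : Prop := Tst χ ∧ (0 : Rn n) ∉ tsupport χ

lemma contDiff_iteratedFDeriv_left {n : ℕ} {b : Rn n → Rn n → ℂ}
    (hb : ContDiff ℝ (⊤ : ℕ∞) (fun p : Rn n × Rn n => b p.1 p.2)) (l : ℕ) :
    ContDiff ℝ (⊤ : ℕ∞)
      (fun p : Rn n × Rn n => iteratedFDeriv ℝ l (fun x' => b x' p.2) p.1) := by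
  induction l with
  | zero =>
    simp only [iteratedFDeriv_zero_eq_comp]
    exact (continuousMultilinearCurryFin0 ℝ (Rn n) ℂ).symm.contDiff.comp hb
  | succ l ih =>
    simp only [iteratedFDeriv_succ_eq_comp_left]
    have h : ContDiff ℝ (⊤ : ℕ∞)
        (continuousMultilinearCurryLeftEquiv ℝ (fun _ : Fin (l + 1) => Rn n) ℂ).symm := by
      apply LinearIsometryEquiv.contDiff
    refine h.comp ?_
    refine ContDiff.fderiv (m := (⊤ : ℕ∞))
      (f := fun p : Rn n × Rn n => iteratedFDeriv ℝ l (fun x' => b x' p.2)) ?_ contDiff_fst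
      (by exact_mod_cast le_top)
    exact ih.comp (contDiff_snd.prodMk (contDiff_snd.comp contDiff_fst))

lemma SymbolClass.contDiff_left {n : ℕ} {m : ℝ} {b : Rn n → Rn n → ℂ} (hb : SymbolClass n m b)
    (ξ : Rn n) : ContDiff ℝ (⊤ : ℕ∞) (fun x => b x ξ) :=
  hb.1.comp (contDiff_id.prodMk contDiff_const)

lemma SymbolClass.contDiff_right {n : ℕ} {m : ℝ} {b : Rn n → Rn n → ℂ} (hb : SymbolClass n m b)
    (x : Rn n) : ContDiff ℝ (⊤ : ℕ∞) (b x) :=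
  hb.1.comp (contDiff_const.prodMk contDiff_id)

/-- The symbol classes are stable under differentiation in `x`. -/
lemma SymbolClass.pd_left {n : ℕ} {m : ℝ} {b : Rn n → Rn n → ℂ} (hb : SymbolClass n m b)
    (i : Fin n) : SymbolClass n m (fun x ξ => pd i (fun x' => b x' ξ) x) := by
  refine ⟨?_, fun k l => ?_⟩
  · unfold pd
    refine ContDiff.clm_apply ?_ contDiff_const
    refine ContDiff.fderiv (m := (⊤ : ℕ∞))
      (f := fun (p : Rn n × Rn n) x' => b x' p.2) ?_ contDiff_fst (by exact_mod_cast le_top)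
    exact hb.1.comp (contDiff_snd.prodMk (contDiff_snd.comp contDiff_fst))
  · obtain ⟨C, hC⟩ := hb.2 k (l + 1)
    set L0 : (Rn n →L[ℝ] ℂ) →L[ℝ] ℂ :=
      ContinuousLinearMap.apply ℝ ℂ (EuclideanSpace.single i (1 : ℝ)) with hL0
    set L := (ContinuousLinearMap.compContinuousMultilinearMapL ℝ (fun _ : Fin l => Rn n)
        (Rn n →L[ℝ] ℂ) ℂ L0).comp
      ((continuousMultilinearCurryRightEquiv' ℝ l (Rn n) ℂ).toContinuousLinearEquiv :
        ContinuousMultilinearMap ℝ (fun _ : Fin (l + 1) => Rn n) ℂ →L[ℝ]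
          ContinuousMultilinearMap ℝ (fun _ : Fin l => Rn n) (Rn n →L[ℝ] ℂ)) with hL
    have key : ∀ x ξ : Rn n, iteratedFDeriv ℝ l (fun x => pd i (fun x' => b x' ξ) x) x =
        L (iteratedFDeriv ℝ (l + 1) (fun x' => b x' ξ) x) := by
      intro x ξ
      have h1 : (fun x => pd i (fun x' => b x' ξ) x) = L0 ∘ fderiv ℝ (fun x' => b x' ξ) := rfl
      have h2 : ContDiff ℝ (⊤ : ℕ∞) (fderiv ℝ (fun x' => b x' ξ)) :=
        (hb.contDiff_left ξ).fderiv_right (by exact_mod_cast le_top)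
      rw [h1, ContinuousLinearMap.iteratedFDeriv_comp_left L0 h2.contDiffAt
        (by exact_mod_cast le_top), iteratedFDeriv_succ_eq_comp_right]
      simp [hL]
    refine ⟨‖L‖ * C, fun x ξ => ?_⟩
    simp only [key]
    have h3 : ContDiff ℝ (⊤ : ℕ∞)
        (fun ξ' => iteratedFDeriv ℝ (l + 1) (fun x' => b x' ξ') x) :=
      (contDiff_iteratedFDeriv_left hb.1 (l + 1)).comp (contDiff_const.prodMk contDiff_id)
    refine (ContinuousLinearMap.norm_iteratedFDeriv_comp_left L
      (f := fun ξ' => iteratedFDeriv ℝ (l + 1) (fun x' => b x' ξ') x) (n := k)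
      h3.contDiffAt (by exact_mod_cast le_top)).trans ?_
    rw [mul_assoc]
    exact mul_le_mul_of_nonneg_left (hC x ξ) (norm_nonneg _)

lemma SymbolClass.bound_right {n : ℕ} {m : ℝ} {b : Rn n → Rn n → ℂ} (hb : SymbolClass n m b)
    (k : ℕ) : ∃ C : ℝ, ∀ x ξ : Rn n,
      ‖iteratedFDeriv ℝ k (b x) ξ‖ ≤ C * (1 + ‖ξ‖ ^ 2) ^ ((m - (k : ℝ)) / 2) := by
  obtain ⟨C, hC⟩ := hb.2 k 0
  refine ⟨C, fun x ξ => le_trans (le_of_eq ?_) (hC x ξ)⟩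
  simp only [iteratedFDeriv_zero_eq_comp]
  exact (LinearIsometryEquiv.norm_iteratedFDeriv_comp_left
    (continuousMultilinearCurryFin0 ℝ (Rn n) ℂ).symm (b x) ξ k).symm

lemma norm_iteratedFDeriv_pd_le {n : ℕ} (i : Fin n) (l : ℕ) : ∃ K : ℝ, 0 ≤ K ∧ ∀ u : Rn n → ℂ, ContDiff ℝ (⊤ : ℕ∞) u → ∀ ξ,
      ‖iteratedFDeriv ℝ l (pd i u) ξ‖ ≤ K * ‖iteratedFDeriv ℝ (l + 1) u ξ‖ := by
  set L0 : (Rn n →L[ℝ] ℂ) →L[ℝ] ℂ :=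
    ContinuousLinearMap.apply ℝ ℂ (EuclideanSpace.single i (1 : ℝ)) with hL0
  refine ⟨‖L0‖, L0.opNorm_nonneg, fun u hu ξ => ?_⟩
  have h2 : ContDiff ℝ (⊤ : ℕ∞) (fderiv ℝ u) := hu.fderiv_right (by exact_mod_cast le_top)
  rw [← norm_iteratedFDeriv_fderiv]
  exact ContinuousLinearMap.norm_iteratedFDeriv_comp_left L0 (n := l)
      h2.contDiffAt (by exact_mod_cast le_top)

/-- A uniformly smooth family with uniformly compact supports. -/
structure UnifTst {n : ℕ} {ι : Type*} (u : ι → Rn n → ℂ) : Prop where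
  smooth : ∀ t, ContDiff ℝ (⊤ : ℕ∞) (u t)
  supp : ∃ R : ℝ, ∀ t, tsupport (u t) ⊆ Metric.closedBall 0 R
  bound : ∀ l : ℕ, ∃ C : ℝ, ∀ t ξ, ‖iteratedFDeriv ℝ l (u t) ξ‖ ≤ C

lemma UnifTst.tst {n : ℕ} {ι : Type*} {u : ι → Rn n → ℂ} (hu : UnifTst u) (t : ι) :
    Tst (u t) := by
  obtain ⟨R, hR⟩ := hu.supp
  exact ⟨hu.smooth t, (isCompact_closedBall _ _).of_isClosed_subset (isClosed_tsupport _) (hR t)⟩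

lemma UnifTst.pd {n : ℕ} {ι : Type*} {u : ι → Rn n → ℂ} (hu : UnifTst u) (i : Fin n) :
    UnifTst (fun t => pd i (u t)) where
  smooth t := (hu.smooth t).pd i
  supp := by
    obtain ⟨R, hR⟩ := hu.supp
    exact ⟨R, fun t => (tsupport_pd_subset _ i).trans (hR t)⟩
  bound l := by
    obtain ⟨K, hK, h⟩ := norm_iteratedFDeriv_pd_le i l
    obtain ⟨C, hC⟩ := hu.bound (l + 1)
    exact ⟨K * C, fun t ξ => (h _ (hu.smooth t) ξ).trans (by gcongr; exact hC t ξ)⟩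

lemma UnifTst.exists_norm_kern_le {n : ℕ} {ι : Type*} {u : ι → Rn n → ℂ} (hu : UnifTst u) :
    ∃ C : ℝ, ∀ t x, ‖kern n (u t) x‖ ≤ C := by
  obtain ⟨R, hR⟩ := hu.supp
  obtain ⟨C, hC⟩ := hu.bound 0
  refine ⟨∫ ξ : Rn n, (Metric.closedBall (0 : Rn n) R).indicator (fun _ => C) ξ, fun t x => ?_⟩
  refine (norm_kern_le _ x).trans ?_
  refine integral_mono (hu.tst t).integrable.norm ?_ fun ξ => ?_
  · refine IntegrableOn.integrable_indicator ?_ measurableSet_closedBall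
    exact integrableOn_const (isCompact_closedBall _ _).measure_lt_top.ne
  · by_cases h : ξ ∈ Metric.closedBall (0 : Rn n) R
    · simpa [Set.indicator_of_mem h] using hC t ξ
    · have : u t ξ = 0 := image_eq_zero_of_notMem_tsupport fun h' => h (hR t h')
      simp [Set.indicator_of_notMem h, this]

lemma UnifTst.abs_pow_mul_norm_kern_le {n : ℕ} {ι : Type*} (N : ℕ) (i : Fin n) :
    ∀ {u : ι → Rn n → ℂ}, UnifTst u →
    ∃ C : ℝ, ∀ t (x : Rn n), |x i| ^ N * ‖kern n (u t) x‖ ≤ C := by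
  induction N with
  | zero =>
    intro u hu
    simpa using hu.exists_norm_kern_le
  | succ N ih =>
    intro u hu
    obtain ⟨C, hC⟩ := ih (hu.pd i)
    refine ⟨C, fun t x => ?_⟩
    have := hC t x
    rw [kern_pd (hu.tst t), norm_mul, norm_neg, norm_mul, Complex.norm_I, one_mul,
      Complex.norm_real, Real.norm_eq_abs] at this
    rwa [pow_succ, mul_assoc]

lemma UnifTst.decay {n : ℕ} {ι : Type*} {u : ι → Rn n → ℂ} (hu : UnifTst u) (N : ℕ) :
    ∃ C : ℝ, 0 ≤ C ∧ ∀ t x, (1 + ‖x‖) ^ N * ‖kern n (u t) x‖ ≤ C :=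
  exists_decay_of_coord N hu.exists_norm_kern_le fun i => hu.abs_pow_mul_norm_kern_le N i

lemma Tst.bound_iteratedFDeriv {n : ℕ} {χ : Rn n → ℂ} (h : Tst χ) (l : ℕ) :
    ∃ C : ℝ, 0 ≤ C ∧ ∀ ξ, ‖iteratedFDeriv ℝ l χ ξ‖ ≤ C := by
  obtain ⟨C, hC⟩ := (h.2.iteratedFDeriv (𝕜 := ℝ) l).exists_bound_of_continuous
    (h.1.continuous_iteratedFDeriv (by exact_mod_cast le_top))
  exact ⟨C, (norm_nonneg _).trans (hC 0), hC⟩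

lemma Tst.exists_radius {n : ℕ} {χ : Rn n → ℂ} (h : Tst χ) :
    ∃ R : ℝ, 0 < R ∧ ∀ ξ ∈ tsupport χ, ‖ξ‖ ≤ R := by
  obtain ⟨R, hR⟩ := h.2.isCompact.isBounded.subset_closedBall (0 : Rn n)
  exact ⟨max R 1, by positivity, fun ξ hξ => le_max_of_le_left (by simpa using hR hξ)⟩

lemma Tst0.exists_inner_radius {n : ℕ} {χ : Rn n → ℂ} (h : Tst0 χ) :
    ∃ r : ℝ, 0 < r ∧ ∀ ξ ∈ tsupport χ, r ≤ ‖ξ‖ := by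
  obtain ⟨r, hr, hb⟩ := Metric.isOpen_iff.1 (isClosed_tsupport χ).isOpen_compl 0 h.2
  refine ⟨r, hr, fun ξ hξ => ?_⟩
  by_contra! hlt
  exact hb (show ξ ∈ Metric.ball 0 r by simpa using hlt) hξ

lemma rpow_le_max_of_mem {c0 C0 A e : ℝ} (h0 : 0 < c0) (h1 : c0 ≤ A) (h2 : A ≤ C0) :
    A ^ e ≤ c0 ^ e + C0 ^ e := by
  have hA : 0 < A := h0.trans_le h1
  have hC : 0 < C0 := hA.trans_le h2
  rcases le_total 0 e with he | he
  · have := Real.rpow_le_rpow hA.le h2 he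
    have := Real.rpow_nonneg h0.le e
    linarith
  · have := Real.rpow_le_rpow_of_nonpos h0 h1 he
    have := Real.rpow_nonneg hC.le e
    linarith

lemma bracket_rpow_le {r R e : ℝ} (hr : 0 < r) :
    ∃ C : ℝ, 0 ≤ C ∧ ∀ (k : ℕ) (y : ℝ), 0 ≤ y → y ≤ R → (k = 0 ∨ r ≤ y) →
      (1 + ((2 : ℝ) ^ k * y) ^ 2) ^ (e / 2) ≤ C * ((2 : ℝ) ^ k) ^ e := by
  refine ⟨(min 1 (r ^ 2)) ^ (e / 2) + (1 + R ^ 2) ^ (e / 2), by positivity,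
    fun k y hy hyR hk => ?_⟩
  have ht : (1 : ℝ) ≤ 2 ^ k := one_le_pow₀ (by norm_num)
  set t : ℝ := 2 ^ k with htdef
  have ht0 : 0 < t := by linarith
  have h1 : 1 + (t * y) ^ 2 = t ^ 2 * ((t ^ 2)⁻¹ + y ^ 2) := by
    field_simp
  have h2 : (t ^ 2) ^ (e / 2) = t ^ e := by
    rw [← Real.rpow_natCast t 2, ← Real.rpow_mul ht0.le]
    congr 1
    push_cast
    ring
  rw [h1, Real.mul_rpow (by positivity) (by positivity), h2, mul_comm]
  gcongr
  refine rpow_le_max_of_mem (by positivity) ?_ ?_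
  · rcases hk with hk | hk
    · have : t = 1 := by simp [htdef, hk]
      rw [this]
      refine (min_le_left _ _).trans ?_
      norm_num
      positivity
    · refine (min_le_right _ _).trans ?_
      have : r ^ 2 ≤ y ^ 2 := by gcongr
      have : 0 ≤ (t ^ 2)⁻¹ := by positivity
      linarith
  · have h3 : (t ^ 2)⁻¹ ≤ 1 := inv_le_one_of_one_le₀ (one_le_pow₀ ht)
    have h4 : y ^ 2 ≤ R ^ 2 := by gcongr
    linarith

/-- Kernel bounds for the Littlewood–Paley pieces of a symbol. -/
lemma SymbolClass.kern_decay {n : ℕ} {m : ℝ} {b : Rn n → Rn n → ℂ} (hb : SymbolClass n m b)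
    {χ : Rn n → ℂ} (hχ : Tst χ) (N : ℕ) :
    ∃ C : ℝ, 0 ≤ C ∧ ∀ (k : ℕ), (k = 0 ∨ Tst0 χ) → ∀ x w : Rn n,
      (1 + ‖(2 : ℝ) ^ k • w‖) ^ N * ‖kern n (fun ξ => b x ξ * dil k χ ξ) w‖ ≤
        C * (((2 : ℝ) ^ k) ^ m * ((2 : ℝ) ^ k) ^ n) := by
  obtain ⟨R, hR0, hR⟩ := hχ.exists_radius
  obtain ⟨r, hr0, hr⟩ : ∃ r : ℝ, 0 < r ∧ (Tst0 χ → ∀ ξ ∈ tsupport χ, r ≤ ‖ξ‖) := by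
    by_cases h : Tst0 χ
    · obtain ⟨r, hr, h'⟩ := h.exists_inner_radius
      exact ⟨r, hr, fun _ => h'⟩
    · exact ⟨1, one_pos, fun h' => absurd h' h⟩
  let ι := {p : ℕ × Rn n // p.1 = 0 ∨ Tst0 χ}
  let v : ι → Rn n → ℂ := fun t ξ => b t.1.2 ((2 : ℝ) ^ t.1.1 • ξ)
  let u : ι → Rn n → ℂ := fun t ξ =>
    (((((2 : ℝ) ^ t.1.1) ^ (-m) : ℝ)) : ℂ) * (v t ξ * χ ξ)
  have hv : ∀ t, ContDiff ℝ (⊤ : ℕ∞) (v t) := fun t =>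
    (hb.contDiff_right _).comp (contDiff_const_smul _)
  have hvb : ∀ l : ℕ, ∃ C : ℝ, 0 ≤ C ∧ ∀ t, ∀ ξ ∈ tsupport χ,
      ‖iteratedFDeriv ℝ l (v t) ξ‖ ≤ C * ((2 : ℝ) ^ t.1.1) ^ m := by
    intro l
    obtain ⟨C, hC⟩ := hb.bound_right l
    obtain ⟨D, hD0, hD⟩ := bracket_rpow_le (r := r) (R := R) (e := m - l) hr0
    refine ⟨|C| * D, by positivity, fun t ξ hξ => ?_⟩
    have h1 := iteratedFDeriv_comp_const_smul (f := b t.1.2) (i := l) ((2 : ℝ) ^ t.1.1)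
      ((hb.contDiff_right _).of_le (by exact_mod_cast le_top))
    have h2 : iteratedFDeriv ℝ l (v t) ξ = _ := congrFun h1 ξ
    have h3 := hD t.1.1 ‖ξ‖ (norm_nonneg _) (hR ξ hξ) (t.2.imp id fun h => hr h ξ hξ)
    have h4 := hC t.1.2 ((2 : ℝ) ^ t.1.1 • ξ)
    have ht : (0 : ℝ) < 2 ^ t.1.1 := by positivity
    rw [norm_smul, Real.norm_of_nonneg ht.le] at h4
    rw [h2, norm_smul, norm_pow, Real.norm_of_nonneg ht.le]
    calc _ ≤ ((2 : ℝ) ^ t.1.1) ^ l * (|C| * (D * ((2 : ℝ) ^ t.1.1) ^ (m - l))) := by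
          gcongr
          refine h4.trans ?_
          gcongr
          exact le_abs_self C
      _ = |C| * D * ((2 : ℝ) ^ t.1.1) ^ m := by
          rw [Real.rpow_sub ht, Real.rpow_natCast]
          field_simp
  have hu : UnifTst u := by
    refine ⟨fun t => contDiff_const.mul ((hv t).mul hχ.1), ⟨R, fun t ξ hξ => ?_⟩, fun l => ?_⟩
    · have : tsupport (u t) ⊆ tsupport χ :=
        (tsupport_mul_right_subset _ _).trans (tsupport_mul_right_subset _ _)
      simpa using hR ξ (this hξ)
    · choose C hC0 hC using hvb
      choose D hD0 hD using fun l => hχ.bound_iteratedFDeriv l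
      refine ⟨∑ i ∈ Finset.range (l + 1), (l.choose i : ℝ) * C i * D (l - i), fun t ξ => ?_⟩
      have ht : (0 : ℝ) < 2 ^ t.1.1 := by positivity
      have h1 : u t = (((2 : ℝ) ^ t.1.1) ^ (-m)) • fun ξ => v t ξ * χ ξ := by
        ext ξ; simp [u]
      rw [h1, iteratedFDeriv_const_smul_apply
        (((hv t).mul hχ.1).of_le (by exact_mod_cast le_top)).contDiffAt, norm_smul,
        Real.norm_of_nonneg (by positivity)]
      have h2 := norm_iteratedFDeriv_mul_le (hv t) hχ.1 ξ (n := l) (by exact_mod_cast le_top)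
      calc _ ≤ (((2 : ℝ) ^ t.1.1) ^ (-m)) * ∑ i ∈ Finset.range (l + 1),
            (l.choose i : ℝ) * (C i * ((2 : ℝ) ^ t.1.1) ^ m) * D (l - i) := by
            gcongr
            refine h2.trans (Finset.sum_le_sum fun i _ => ?_)
            by_cases hξ : ξ ∈ tsupport χ
            · have := hC0 i
              gcongr
              · exact hC i t ξ hξ
              · exact hD _ ξ
            · have : iteratedFDeriv ℝ (l - i) χ ξ = 0 := by
                by_contra h
                exact hξ (support_iteratedFDeriv_subset (𝕜 := ℝ) (l - i) h)
              rw [this, norm_zero, mul_zero]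
              have := hC0 i
              have := hD0 (l - i)
              positivity
        _ = _ := by
            rw [Finset.mul_sum]
            refine Finset.sum_congr rfl fun i _ => ?_
            rw [Real.rpow_neg ht.le]
            field_simp
  obtain ⟨C, hC0, hC⟩ := hu.decay N
  refine ⟨C, hC0, fun k hk x w => ?_⟩
  have ht : (0 : ℝ) < 2 ^ k := by positivity
  have h1 : (fun ξ => b x ξ * dil k χ ξ) =
      fun ξ => (((((2 : ℝ) ^ k) ^ m : ℝ)) : ℂ) * dil k (u ⟨(k, x), hk⟩) ξ := by
    ext ξ
    simp only [dil, u, v, smul_smul]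
    rw [mul_inv_cancel₀ ht.ne', one_smul, ← mul_assoc, ← Complex.ofReal_mul,
      ← Real.rpow_add ht]
    simp
  rw [h1, kern_const_mul, kern_dil, norm_mul, norm_mul, Complex.norm_real, Complex.norm_real,
    Real.norm_of_nonneg (by positivity), Real.norm_of_nonneg (by positivity)]
  have h2 := hC ⟨(k, x), hk⟩ ((2 : ℝ) ^ k • w)
  calc _ = ((1 + ‖(2 : ℝ) ^ k • w‖) ^ N * ‖kern n (u ⟨(k, x), hk⟩) ((2 : ℝ) ^ k • w)‖) *
        (((2 : ℝ) ^ k) ^ m * ((2 : ℝ) ^ k) ^ n) := by ring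
    _ ≤ _ := by gcongr

lemma hasDerivAt_kern_path {n : ℕ} {u u' : ℝ → Rn n → ℂ} {bd : Rn n → ℝ} (w v : Rn n) (t₀ : ℝ)
    (hu : ∀ t, Continuous (u t)) (hu' : ∀ t, Continuous (u' t))
    (h1 : ∀ t ξ, ‖u t ξ‖ ≤ bd ξ) (h2 : ∀ t ξ, ‖u' t ξ‖ ≤ bd ξ)
    (h_int : Integrable bd) (h_int' : Integrable (fun ξ => ‖ξ‖ * bd ξ))
    (hd : ∀ t ξ, HasDerivAt (fun t => u t ξ) (u' t ξ) t) :
    HasDerivAt (fun t => kern n (u t) (w + t • v))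
      (kern n (fun ξ => Complex.I * ((⟪v, ξ⟫_ℝ : ℝ) : ℂ) * u t₀ ξ + u' t₀ ξ) (w + t₀ • v)) t₀ := by
  unfold kern
  refine HasDerivAt.const_mul _ ?_
  have key := hasDerivAt_integral_of_dominated_loc_of_deriv_le (μ := (volume : Measure (Rn n)))
    (F := fun (t : ℝ) ξ => Complex.exp (Complex.I * ((⟪w + t • v, ξ⟫_ℝ : ℝ) : ℂ)) * u t ξ)
    (F' := fun (t : ℝ) ξ => Complex.exp (Complex.I * ((⟪w + t • v, ξ⟫_ℝ : ℝ) : ℂ)) *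
      (Complex.I * ((⟪v, ξ⟫_ℝ : ℝ) : ℂ) * u t ξ + u' t ξ))
    (bound := fun ξ => ‖v‖ * (‖ξ‖ * bd ξ) + bd ξ) (x₀ := t₀) (s := Set.univ) Filter.univ_mem
    ?_ ?_ ?_ ?_ ?_ ?_
  · exact key.2
  · refine Filter.Eventually.of_forall fun t => Continuous.aestronglyMeasurable ?_
    have := hu t
    fun_prop
  · refine Integrable.mono' h_int ?_ (Filter.Eventually.of_forall fun ξ => ?_)
    · have := hu t₀
      exact Continuous.aestronglyMeasurable (by fun_prop)
    · rw [norm_mul, norm_exp_I_mul_ofReal', one_mul]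
      exact h1 t₀ ξ
  · have := hu t₀
    have := hu' t₀
    exact Continuous.aestronglyMeasurable (by fun_prop)
  · refine Filter.Eventually.of_forall fun ξ t _ => ?_
    rw [norm_mul, norm_exp_I_mul_ofReal', one_mul]
    refine (norm_add_le _ _).trans (add_le_add ?_ (h2 t ξ))
    rw [norm_mul, norm_mul, Complex.norm_I, one_mul, Complex.norm_real, ← mul_assoc]
    exact mul_le_mul (norm_inner_le_norm v ξ) (h1 t ξ) (norm_nonneg _) (by positivity)
  · exact (h_int'.const_mul _).add h_int
  · refine Filter.Eventually.of_forall fun ξ t _ => ?_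
    have e1 : HasDerivAt (fun t : ℝ => ⟪w + t • v, ξ⟫_ℝ) ⟪v, ξ⟫_ℝ t := by
      have : (fun t : ℝ => ⟪w + t • v, ξ⟫_ℝ) = fun t => ⟪w, ξ⟫_ℝ + t * ⟪v, ξ⟫_ℝ := by
        ext t
        rw [inner_add_left, inner_smul_left]
        rfl
      rw [this]
      simpa using ((hasDerivAt_id t).mul_const ⟪v, ξ⟫_ℝ).const_add ⟪w, ξ⟫_ℝ
    have e2 := ((e1.ofReal_comp).const_mul Complex.I).cexp
    have e3 := e2.mul (hd t ξ)
    refine e3.congr_deriv ?_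
    ring

lemma HasCompactSupport.integrable_norm_mul {n : ℕ} {g : Rn n → ℝ} {χ : Rn n → ℂ}
    (hg : Continuous g) (hχ : Tst χ) : Integrable (fun ξ => g ξ * ‖χ ξ‖) := by
  refine Continuous.integrable_of_hasCompactSupport (hg.mul hχ.continuous.norm) ?_
  exact hχ.2.norm.mul_left

lemma continuous_bracket {n : ℕ} (e : ℝ) : Continuous (fun ξ : Rn n => (1 + ‖ξ‖ ^ 2) ^ e) := by
  refine Continuous.rpow_const (by fun_prop) fun ξ => Or.inl ?_
  positivity

lemma SymbolClass.norm_le {n : ℕ} {m : ℝ} {b : Rn n → Rn n → ℂ} (hb : SymbolClass n m b) :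
    ∃ C : ℝ, 0 ≤ C ∧ ∀ x ξ : Rn n, ‖b x ξ‖ ≤ C * (1 + ‖ξ‖ ^ 2) ^ (m / 2) := by
  obtain ⟨C, hC⟩ := hb.bound_right 0
  have h : ∀ x ξ : Rn n, ‖b x ξ‖ ≤ C * (1 + ‖ξ‖ ^ 2) ^ (m / 2) := fun x ξ => by
    simpa using hC x ξ
  refine ⟨|C|, abs_nonneg _, fun x ξ => (h x ξ).trans ?_⟩
  gcongr
  exact le_abs_self C

lemma Tst.mul_symbol {n : ℕ} {m : ℝ} {b : Rn n → Rn n → ℂ} {χ : Rn n → ℂ} (hχ : Tst χ)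
    (hb : SymbolClass n m b) (x : Rn n) : Tst (fun ξ => b x ξ * χ ξ) :=
  hχ.mul_contDiff (hb.contDiff_right x)

/-- Multiplication by the `i`-th coordinate. -/
def cmul {n : ℕ} (i : Fin n) (χ : Rn n → ℂ) (ξ : Rn n) : ℂ := ((ξ i : ℝ) : ℂ) * χ ξ

lemma contDiff_coord {n : ℕ} (i : Fin n) :
    ContDiff ℝ (⊤ : ℕ∞) (fun ξ : Rn n => ((ξ i : ℝ) : ℂ)) :=
  (Complex.ofRealCLM.comp (EuclideanSpace.proj i : Rn n →L[ℝ] ℝ)).contDiff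

lemma Tst.cmul {n : ℕ} {χ : Rn n → ℂ} (h : Tst χ) (i : Fin n) : Tst (cmul i χ) :=
  h.mul_contDiff (contDiff_coord i)

lemma Tst0.of_tsupport {n : ℕ} {χ θ : Rn n → ℂ} (h : Tst0 χ) (hθ : Tst θ)
    (hs : tsupport θ ⊆ tsupport χ) : Tst0 θ := ⟨hθ, fun h0 => h.2 (hs h0)⟩

lemma Tst0.cmul {n : ℕ} {χ : Rn n → ℂ} (h : Tst0 χ) (i : Fin n) : Tst0 (cmul i χ) :=
  h.of_tsupport (h.1.cmul i) (tsupport_mul_right_subset _ _)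

lemma dil_cmul {n : ℕ} (k : ℕ) (i : Fin n) (χ : Rn n → ℂ) (ξ : Rn n) :
    ((ξ i : ℝ) : ℂ) * dil k χ ξ = ((2 : ℝ) ^ k : ℝ) * dil k (cmul i χ) ξ := by
  simp only [dil, cmul, PiLp.smul_apply, smul_eq_mul]
  push_cast
  field_simp

lemma hasLineDerivAt_kern {n : ℕ} {u : Rn n → ℂ} (hu : Tst u) (i : Fin n) (z : Rn n) :
    HasLineDerivAt ℝ (kern n u) (Complex.I * kern n (cmul i u) z) z
      (EuclideanSpace.single i (1 : ℝ)) := by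
  have h := hasDerivAt_kern_path (u := fun _ => u) (u' := fun _ _ => 0) (bd := fun ξ => ‖u ξ‖) z
    (EuclideanSpace.single i (1 : ℝ)) 0 (fun _ => hu.continuous) (fun _ => continuous_const)
    (fun _ _ => le_rfl) (fun _ _ => by simp) hu.integrable.norm
    (HasCompactSupport.integrable_norm_mul continuous_norm hu) (fun t ξ => hasDerivAt_const _ _)
  refine h.congr_deriv ?_
  rw [zero_smul, add_zero, ← kern_const_mul]
  congr 1
  ext ξ
  rw [real_inner_comm, inner_single_one, add_zero, mul_assoc]
  rfl

lemma SymbolClass.hasLineDerivAt_kern {n : ℕ} {m : ℝ} {b : Rn n → Rn n → ℂ}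
    (hb : SymbolClass n m b) {χ : Rn n → ℂ} (hχ : Tst χ) (k : ℕ) (i : Fin n) (x w z : Rn n) :
    HasLineDerivAt ℝ (fun z => kern n (fun ξ => b (x - z) ξ * dil k χ ξ) (w - z))
      (-(kern n (fun ξ => pd i (fun x' => b x' ξ) (x - z) * dil k χ ξ) (w - z)) -
        Complex.I * ((2 : ℝ) ^ k : ℝ) *
          kern n (fun ξ => b (x - z) ξ * dil k (cmul i χ) ξ) (w - z)) z
      (EuclideanSpace.single i (1 : ℝ)) := by
  obtain ⟨C1, hC1, h1⟩ := hb.norm_le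
  obtain ⟨C2, hC2, h2⟩ := (hb.pd_left i).norm_le
  set e : Rn n := EuclideanSpace.single i (1 : ℝ) with he
  have hdil := hχ.dil k
  set g : Rn n → ℝ := fun ξ => (C1 + C2) * (1 + ‖ξ‖ ^ 2) ^ (m / 2) with hg
  have hgc : Continuous g := continuous_const.mul (continuous_bracket _)
  have hpos : ∀ ξ : Rn n, 0 ≤ (1 + ‖ξ‖ ^ 2) ^ (m / 2) := fun ξ => by positivity
  have h := hasDerivAt_kern_path (n := n)
    (u := fun t ξ => b (x - z - t • e) ξ * dil k χ ξ)
    (u' := fun t ξ => -(pd i (fun x' => b x' ξ) (x - z - t • e)) * dil k χ ξ)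
    (bd := fun ξ => g ξ * ‖dil k χ ξ‖) (w - z) (-e) 0
    (fun t => (hdil.mul_symbol hb _).continuous)
    (fun t => by
      have := (hdil.mul_symbol (hb.pd_left i) (x - z - t • e)).continuous
      simpa only [neg_mul] using this.fun_neg)
    (fun t ξ => by
      rw [norm_mul]
      gcongr
      refine (h1 _ ξ).trans ?_
      simp only [hg, add_mul]
      have := hpos ξ
      exact le_add_of_nonneg_right (by positivity))
    (fun t ξ => by
      rw [norm_mul, norm_neg]
      gcongr
      refine (h2 _ ξ).trans ?_
      simp only [hg, add_mul]
      have := hpos ξ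
      exact le_add_of_nonneg_left (by positivity))
    (HasCompactSupport.integrable_norm_mul hgc hdil)
    (by
      simp only [← mul_assoc]
      exact HasCompactSupport.integrable_norm_mul (continuous_norm.mul hgc) hdil)
    (fun t ξ => by
      refine HasDerivAt.mul_const ?_ _
      have d1 : HasDerivAt (fun t : ℝ => x - z - t • e) (-e) t := by
        simpa using ((hasDerivAt_id t).smul_const e).const_sub (x - z)
      have d2 := (((hb.contDiff_left ξ).differentiable (by simp))
        (x - z - t • e)).hasFDerivAt.comp_hasDerivAt t d1
      refine d2.congr_deriv ?_
      simp [pd, he])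
  have h' := h.congr_of_eventuallyEq (f₁ := fun t : ℝ =>
      kern n (fun ξ => b (x - (z + t • e)) ξ * dil k χ ξ) (w - (z + t • e)))
    (Filter.Eventually.of_forall fun t => by
      simp only [sub_add_eq_sub_sub, smul_neg, ← sub_eq_add_neg])
  refine h'.congr_deriv ?_
  rw [zero_smul, zero_smul, add_zero, sub_zero, ← kern_const_mul, ← kern_neg,
    ← kern_sub (((hdil.mul_symbol (hb.pd_left i) _).integrable).fun_neg)
      (((hχ.cmul i).dil k).mul_symbol hb _ |>.integrable.const_mul _)]
  congr 1
  ext ξ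
  rw [inner_neg_left, real_inner_comm, inner_single_one]
  have := dil_cmul k i χ ξ
  push_cast at this ⊢
  linear_combination (-Complex.I * b (x - z) ξ) * this

lemma SymbolClass.continuous_kern {n : ℕ} {m : ℝ} {b : Rn n → Rn n → ℂ}
    (hb : SymbolClass n m b) {χ : Rn n → ℂ} (hχ : Tst χ) :
    Continuous (fun p : Rn n × Rn n => kern n (fun ξ => b p.1 ξ * χ ξ) p.2) := by
  obtain ⟨C1, hC1, h1⟩ := hb.norm_le
  unfold kern
  refine continuous_const.mul ?_
  refine continuous_of_dominated (bound := fun ξ => (C1 * (1 + ‖ξ‖ ^ 2) ^ (m / 2)) * ‖χ ξ‖)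
    (fun p => ?_) (fun p => ?_) ?_ ?_
  · exact (integrable_exp_mul (hχ.mul_symbol hb _).integrable _).aestronglyMeasurable
  · refine Filter.Eventually.of_forall fun ξ => ?_
    rw [norm_mul, norm_exp_I_mul_ofReal', one_mul, norm_mul]
    gcongr
    exact h1 _ ξ
  · exact HasCompactSupport.integrable_norm_mul
      (continuous_const.mul (continuous_bracket _)) hχ
  · refine Filter.Eventually.of_forall fun ξ => ?_
    have : Continuous (fun p : Rn n × Rn n => b p.1 ξ) :=
      (hb.contDiff_left ξ).continuous.comp continuous_fst
    exact Continuous.mul (by fun_prop) (this.mul continuous_const)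

lemma integrable_of_decay {n : ℕ} {g : Rn n → ℂ} (hg : Continuous g) {C : ℝ}
    (h : ∀ x, (1 + ‖x‖) ^ (n + 1) * ‖g x‖ ≤ C) : Integrable g := by
  have h1 : Integrable (fun x : Rn n => C * (1 + ‖x‖) ^ (-((n : ℝ) + 1))) := by
    refine (integrable_one_add_norm ?_).const_mul C
    simp
  refine h1.mono' hg.aestronglyMeasurable (Filter.Eventually.of_forall fun x => ?_)
  have hp : (0 : ℝ) < (1 + ‖x‖) ^ (n + 1) := by positivity
  rw [Real.rpow_neg (by positivity), ← div_eq_mul_inv]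
  rw [le_div_iff₀ (by positivity)]
  have h2 : (1 + ‖x‖) ^ ((n : ℝ) + 1) = (1 + ‖x‖) ^ (n + 1) := by
    exact_mod_cast Real.rpow_natCast (1 + ‖x‖) (n + 1)
  rw [h2, mul_comm]
  exact h x

lemma Tst.integrable_pow_mul_kern {n : ℕ} {u : Rn n → ℂ} (hu : Tst u) (N : ℕ) :
    Integrable (fun x => (((1 + ‖x‖) ^ N : ℝ) : ℂ) * kern n u x) := by
  obtain ⟨C, -, hC⟩ := hu.decay (n + 1 + N)
  have hc := continuous_kern hu.integrable
  refine integrable_of_decay (C := C) (by fun_prop) fun x => ?_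
  rw [norm_mul, Complex.norm_real, Real.norm_of_nonneg (by positivity), ← mul_assoc, ← pow_add]
  exact hC x

lemma Tst.integrable_kern {n : ℕ} {u : Rn n → ℂ} (hu : Tst u) : Integrable (kern n u) := by
  simpa using hu.integrable_pow_mul_kern 0

/-- The kernel of `θ(2^{-j}D)` composed with the `k`-th piece of the pseudodifferential operator
with symbol `b`. -/
def pieceKer {n : ℕ} (θ χ : Rn n → ℂ) (b : Rn n → Rn n → ℂ) (j k : ℕ) (x w : Rn n) : ℂ :=
  ∫ z, kern n (dil j θ) z * kern n (fun ξ => b (x - z) ξ * dil k χ ξ) (w - z)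

lemma SymbolClass.exists_norm_kern_le {n : ℕ} {m : ℝ} {b : Rn n → Rn n → ℂ}
    (hb : SymbolClass n m b) {χ : Rn n → ℂ} (hχ : Tst χ) :
    ∃ C : ℝ, ∀ x w, ‖kern n (fun ξ => b x ξ * χ ξ) w‖ ≤ C := by
  obtain ⟨C, -, hC⟩ := hb.kern_decay hχ 0
  refine ⟨C, fun x w => ?_⟩
  have := hC 0 (Or.inl rfl) x w
  simpa [dil] using this

lemma SymbolClass.integrable_pieceKer {n : ℕ} {m : ℝ} {b : Rn n → Rn n → ℂ}
    (hb : SymbolClass n m b) {χ : Rn n → ℂ} (hχ : Tst χ) {θ : Rn n → ℂ} (hθ : Tst θ)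
    (x w : Rn n) :
    Integrable (fun z => kern n θ z * kern n (fun ξ => b (x - z) ξ * χ ξ) (w - z)) := by
  obtain ⟨C, hC⟩ := hb.exists_norm_kern_le hχ
  refine hθ.integrable_kern.mul_bdd (c := C) ?_ (Filter.Eventually.of_forall fun z => hC _ _)
  exact ((hb.continuous_kern hχ).comp
    ((continuous_const.sub continuous_id).prodMk
      (continuous_const.sub continuous_id))).aestronglyMeasurable

/-- Integration by parts identity for `pieceKer`. -/
lemma SymbolClass.pieceKer_cmul {n : ℕ} {m : ℝ} {b : Rn n → Rn n → ℂ}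
    (hb : SymbolClass n m b) {χ : Rn n → ℂ} (hχ : Tst χ) {θ : Rn n → ℂ} (hθ : Tst θ) (j k : ℕ)
    (i : Fin n) (x w : Rn n) :
    ((2 : ℝ) ^ j : ℝ) * pieceKer (cmul i θ) χ b j k x w =
      -Complex.I * pieceKer θ χ (fun x ξ => pd i (fun x' => b x' ξ) x) j k x w +
        ((2 : ℝ) ^ k : ℝ) * pieceKer θ (cmul i χ) b j k x w := by
  have hθj := hθ.dil j
  have hχk := hχ.dil k
  have i1 := hb.integrable_pieceKer hχk (hθj.cmul i) x w
  have i2 := (hb.pd_left i).integrable_pieceKer hχk hθj x w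
  have i3 := hb.integrable_pieceKer ((hχ.cmul i).dil k) hθj x w
  have hd : cmul i (dil j θ) = fun ξ => (((2 : ℝ) ^ j : ℝ) : ℂ) * dil j (cmul i θ) ξ :=
    funext fun ξ => dil_cmul j i θ ξ
  have ibp := integral_bilinear_hasLineDerivAt_right_eq_neg_left_of_integrable
    (μ := (volume : Measure (Rn n))) (B := ContinuousLinearMap.mul ℝ ℂ)
    (f := kern n (dil j θ)) (f' := fun z => Complex.I * kern n (cmul i (dil j θ)) z)
    (g := fun z => kern n (fun ξ => b (x - z) ξ * dil k χ ξ) (w - z))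
    (g' := fun z => -(kern n (fun ξ => pd i (fun x' => b x' ξ) (x - z) * dil k χ ξ) (w - z)) -
        Complex.I * ((2 : ℝ) ^ k : ℝ) *
          kern n (fun ξ => b (x - z) ξ * dil k (cmul i χ) ξ) (w - z))
    (v := EuclideanSpace.single i (1 : ℝ))
    ?_ ?_ ?_ (fun z _ => _root_.hasLineDerivAt_kern hθj i z)
    (fun z _ => hb.hasLineDerivAt_kern hχ k i x w z)
  · simp only [ContinuousLinearMap.mul_apply'] at ibp
    have e1 : ∀ z, Complex.I * kern n (cmul i (dil j θ)) z *
        kern n (fun ξ => b (x - z) ξ * dil k χ ξ) (w - z) =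
        Complex.I * (((2 : ℝ) ^ j : ℝ) : ℂ) * (kern n (dil j (cmul i θ)) z *
          kern n (fun ξ => b (x - z) ξ * dil k χ ξ) (w - z)) := by
      intro z
      rw [hd, kern_const_mul]
      ring
    have e2 : ∀ z, kern n (dil j θ) z *
        (-(kern n (fun ξ => pd i (fun x' => b x' ξ) (x - z) * dil k χ ξ) (w - z)) -
        Complex.I * ((2 : ℝ) ^ k : ℝ) *
          kern n (fun ξ => b (x - z) ξ * dil k (cmul i χ) ξ) (w - z)) =
        -(kern n (dil j θ) z *
          kern n (fun ξ => pd i (fun x' => b x' ξ) (x - z) * dil k χ ξ) (w - z)) -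
        Complex.I * ((2 : ℝ) ^ k : ℝ) * (kern n (dil j θ) z *
          kern n (fun ξ => b (x - z) ξ * dil k (cmul i χ) ξ) (w - z)) := fun z => by ring
    simp only [e1, e2] at ibp
    rw [integral_const_mul, integral_sub i2.fun_neg (i3.const_mul _), integral_neg,
      integral_const_mul] at ibp
    unfold pieceKer
    linear_combination (-Complex.I) * ibp -
      (((2 : ℝ) ^ k : ℝ) * (∫ z, kern n (dil j θ) z *
          kern n (fun ξ => b (x - z) ξ * dil k (cmul i χ) ξ) (w - z)) -
        (((2 : ℝ) ^ j : ℝ)) * ∫ z, kern n (dil j (cmul i θ)) z *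
          kern n (fun ξ => b (x - z) ξ * dil k χ ξ) (w - z)) * Complex.I_sq
  · refine (i1.const_mul Complex.I).congr (Filter.Eventually.of_forall fun z => ?_)
    simp only [ContinuousLinearMap.mul_apply']
    ring
  · refine (i2.fun_neg.sub (i3.const_mul (Complex.I * ((2 : ℝ) ^ k : ℝ)))).congr
      (Filter.Eventually.of_forall fun z => ?_)
    simp only [ContinuousLinearMap.mul_apply', Pi.sub_apply]
    ring
  · exact hb.integrable_pieceKer hχk hθj x w

lemma one_add_norm_add_le {n : ℕ} (u v : Rn n) : 1 + ‖u + v‖ ≤ (1 + ‖u‖) * (1 + ‖v‖) := by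
  have := norm_add_le u v
  have := mul_nonneg (norm_nonneg u) (norm_nonneg v)
  linarith

lemma one_add_norm_scale_le {n : ℕ} (j k : ℕ) (z : Rn n) :
    1 + ‖(2 : ℝ) ^ k • z‖ ≤ 2 ^ (k - j) * (1 + ‖(2 : ℝ) ^ j • z‖) := by
  have h1 : (1 : ℝ) ≤ 2 ^ (k - j) := one_le_pow₀ (by norm_num)
  have h2 : (2 : ℝ) ^ k ≤ 2 ^ (k - j) * 2 ^ j := by
    rw [← pow_add]
    exact pow_le_pow_right₀ (by norm_num) (by omega)
  rw [norm_smul, norm_smul, Real.norm_of_nonneg (by positivity),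
    Real.norm_of_nonneg (by positivity), mul_add, mul_one, ← mul_assoc]
  gcongr

lemma SymbolClass.pieceKer_base {n : ℕ} {m : ℝ} {b : Rn n → Rn n → ℂ}
    (hb : SymbolClass n m b) {χ : Rn n → ℂ} (hχ : Tst χ) {θ : Rn n → ℂ} (hθ : Tst θ) (N : ℕ) :
    ∃ C : ℝ, 0 ≤ C ∧ ∀ (j k : ℕ), (k = 0 ∨ Tst0 χ) → ∀ x w : Rn n,
      (1 + ‖(2 : ℝ) ^ k • w‖) ^ N * ‖pieceKer θ χ b j k x w‖ ≤
        C * (((2 : ℝ) ^ (k - j)) ^ N * ((2 : ℝ) ^ k) ^ m * ((2 : ℝ) ^ k) ^ n) := by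
  obtain ⟨C, hC0, hC⟩ := hb.kern_decay hχ N
  set A := ∫ y, (1 + ‖y‖) ^ N * ‖kern n θ y‖ with hA
  have hA0 : 0 ≤ A := integral_nonneg fun y => by positivity
  have hAint : Integrable (fun y => (1 + ‖y‖) ^ N * ‖kern n θ y‖) := by
    refine (hθ.integrable_pow_mul_kern N).norm.congr (Filter.Eventually.of_forall fun y => ?_)
    simp only
    rw [norm_mul, Complex.norm_real, Real.norm_of_nonneg (by positivity)]
  refine ⟨C * A, by positivity, fun j k hk x w => ?_⟩
  have hj : (0 : ℝ) < 2 ^ j := by positivity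
  set D : ℝ := ((2 : ℝ) ^ (k - j)) ^ N * (C * (((2 : ℝ) ^ k) ^ m * ((2 : ℝ) ^ k) ^ n)) with hD
  have hD0 : 0 ≤ D := by positivity
  have hbound : ∀ z, (1 + ‖(2 : ℝ) ^ k • w‖) ^ N *
      ‖kern n (dil j θ) z * kern n (fun ξ => b (x - z) ξ * dil k χ ξ) (w - z)‖ ≤
      D * (((2 : ℝ) ^ j) ^ n * ((1 + ‖(2 : ℝ) ^ j • z‖) ^ N * ‖kern n θ ((2 : ℝ) ^ j • z)‖)) := by
    intro z
    have h1 := hC k hk (x - z) (w - z)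
    have h2 : 1 + ‖(2 : ℝ) ^ k • w‖ ≤
        (2 ^ (k - j) * (1 + ‖(2 : ℝ) ^ j • z‖)) * (1 + ‖(2 : ℝ) ^ k • (w - z)‖) := by
      have h3 := one_add_norm_add_le ((2 : ℝ) ^ k • z) ((2 : ℝ) ^ k • (w - z))
      rw [← smul_add, add_sub_cancel] at h3
      refine h3.trans ?_
      gcongr
      exact one_add_norm_scale_le j k z
    rw [norm_mul, kern_dil, norm_mul, Complex.norm_real, Real.norm_of_nonneg (by positivity)]
    calc _ ≤ ((2 ^ (k - j) * (1 + ‖(2 : ℝ) ^ j • z‖)) * (1 + ‖(2 : ℝ) ^ k • (w - z)‖)) ^ N *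
          (((2 : ℝ) ^ j) ^ n * ‖kern n θ ((2 : ℝ) ^ j • z)‖ *
            ‖kern n (fun ξ => b (x - z) ξ * dil k χ ξ) (w - z)‖) := by gcongr
      _ = ((2 : ℝ) ^ (k - j)) ^ N * (((2 : ℝ) ^ j) ^ n * ((1 + ‖(2 : ℝ) ^ j • z‖) ^ N *
          ‖kern n θ ((2 : ℝ) ^ j • z)‖)) * ((1 + ‖(2 : ℝ) ^ k • (w - z)‖) ^ N *
            ‖kern n (fun ξ => b (x - z) ξ * dil k χ ξ) (w - z)‖) := by
          rw [mul_pow, mul_pow]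
          ring
      _ ≤ ((2 : ℝ) ^ (k - j)) ^ N * (((2 : ℝ) ^ j) ^ n * ((1 + ‖(2 : ℝ) ^ j • z‖) ^ N *
          ‖kern n θ ((2 : ℝ) ^ j • z)‖)) * (C * (((2 : ℝ) ^ k) ^ m * ((2 : ℝ) ^ k) ^ n)) := by
          gcongr
      _ = _ := by rw [hD]; ring
  have h_int : Integrable (fun z => D * (((2 : ℝ) ^ j) ^ n *
      ((1 + ‖(2 : ℝ) ^ j • z‖) ^ N * ‖kern n θ ((2 : ℝ) ^ j • z)‖))) :=
    ((hAint.comp_smul hj.ne').const_mul _).const_mul _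
  have h4 : (1 + ‖(2 : ℝ) ^ k • w‖) ^ N * ‖pieceKer θ χ b j k x w‖ ≤ ∫ z, D * (((2 : ℝ) ^ j) ^ n *
      ((1 + ‖(2 : ℝ) ^ j • z‖) ^ N * ‖kern n θ ((2 : ℝ) ^ j • z)‖)) := by
    unfold pieceKer
    calc _ ≤ (1 + ‖(2 : ℝ) ^ k • w‖) ^ N * ∫ z, ‖kern n (dil j θ) z *
          kern n (fun ξ => b (x - z) ξ * dil k χ ξ) (w - z)‖ := by
          gcongr
          exact norm_integral_le_integral_norm _
      _ = ∫ z, (1 + ‖(2 : ℝ) ^ k • w‖) ^ N * ‖kern n (dil j θ) z *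
          kern n (fun ξ => b (x - z) ξ * dil k χ ξ) (w - z)‖ := by
          rw [integral_const_mul]
      _ ≤ _ := by
          refine integral_mono ?_ h_int hbound
          exact (hb.integrable_pieceKer (hχ.dil k) (hθ.dil j) x w).norm.const_mul _
  rw [integral_const_mul, integral_const_mul,
    Measure.integral_comp_smul volume (fun y => (1 + ‖y‖) ^ N * ‖kern n θ y‖),
    finrank_euclideanSpace_fin, abs_of_pos (by positivity), smul_eq_mul, ← hA,
    mul_inv_cancel_left₀ (by positivity)] at h4
  refine h4.trans (le_of_eq ?_)
  rw [hD]
  ring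

/-- Multiplication by `ξ_i / |ξ|²`. -/
def cdiv {n : ℕ} (i : Fin n) (χ : Rn n → ℂ) (ξ : Rn n) : ℂ := ((ξ i / ‖ξ‖ ^ 2 : ℝ) : ℂ) * χ ξ

lemma Tst0.mul_left {n : ℕ} {g u : Rn n → ℂ} (hu : Tst0 u)
    (hg : ∀ ξ : Rn n, ξ ≠ 0 → ContDiffAt ℝ (⊤ : ℕ∞) g ξ) : Tst0 (fun ξ => g ξ * u ξ) :=
  hu.of_tsupport (hu.1.mul_left fun ξ hξ => hg ξ fun h => hu.2 (h ▸ hξ))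
    (tsupport_mul_right_subset _ _)

lemma Tst0.cdiv {n : ℕ} {χ : Rn n → ℂ} (h : Tst0 χ) (i : Fin n) : Tst0 (cdiv i χ) := by
  refine h.mul_left fun ξ hξ => ?_
  have h1 : ContDiffAt ℝ (⊤ : ℕ∞) (fun ξ : Rn n => ξ i / ‖ξ‖ ^ 2) ξ := by
    refine ContDiffAt.div ?_ ?_ ?_
    · exact (EuclideanSpace.proj i : Rn n →L[ℝ] ℝ).contDiff.contDiffAt
    · exact (contDiff_norm_sq ℝ).contDiffAt
    · exact pow_ne_zero 2 (norm_ne_zero_iff.2 hξ)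
  exact Complex.ofRealCLM.contDiff.contDiffAt.comp ξ h1

lemma Tst0.sum_cmul_cdiv {n : ℕ} {χ : Rn n → ℂ} (h : Tst0 χ) (ξ : Rn n) :
    ∑ i, _root_.cmul i (_root_.cdiv i χ) ξ = χ ξ := by
  by_cases h0 : ξ = 0
  · have : χ ξ = 0 := by
      rw [h0]
      exact image_eq_zero_of_notMem_tsupport h.2
    simp [_root_.cmul, _root_.cdiv, this]
  · have h1 : ‖ξ‖ ^ 2 ≠ 0 := pow_ne_zero 2 (norm_ne_zero_iff.2 h0)
    simp only [_root_.cmul, _root_.cdiv, ← mul_assoc, ← Finset.sum_mul]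
    have h2 : ∑ i, ((ξ i : ℝ) : ℂ) * ((ξ i / ‖ξ‖ ^ 2 : ℝ) : ℂ) =
        ((∑ i, ξ i ^ 2) / ‖ξ‖ ^ 2 : ℝ) := by
      rw [Finset.sum_div]
      push_cast
      refine Finset.sum_congr rfl fun i _ => by ring
    rw [h2, ← EuclideanSpace.real_norm_sq_eq, div_self h1]
    simp

lemma SymbolClass.pieceKer_sum_left {n : ℕ} {m : ℝ} {b : Rn n → Rn n → ℂ}
    (hb : SymbolClass n m b) {χ : Rn n → ℂ} (hχ : Tst χ) {θ : Rn n → ℂ} (hθ : Tst0 θ) (j k : ℕ)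
    (x w : Rn n) :
    pieceKer θ χ b j k x w = ∑ i, pieceKer (cmul i (cdiv i θ)) χ b j k x w := by
  unfold pieceKer
  have hT : ∀ i, Tst (dil j (cmul i (cdiv i θ))) := fun i => ((hθ.cdiv i).1.cmul i).dil j
  rw [← integral_finsetSum _ fun i _ => hb.integrable_pieceKer (hχ.dil k) (hT i) x w]
  congr 1 with z
  rw [← Finset.sum_mul, ← kern_sum _ fun i _ => (hT i).integrable]
  congr 2
  ext ξ
  exact (hθ.sum_cmul_cdiv _).symm

lemma SymbolClass.pieceKer_sum_right {n : ℕ} {m : ℝ} {b : Rn n → Rn n → ℂ}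
    (hb : SymbolClass n m b) {χ : Rn n → ℂ} (hχ : Tst0 χ) {θ : Rn n → ℂ} (hθ : Tst θ) (j k : ℕ)
    (x w : Rn n) :
    pieceKer θ χ b j k x w = ∑ i, pieceKer θ (cmul i (cdiv i χ)) b j k x w := by
  unfold pieceKer
  have hT : ∀ i, Tst (dil k (cmul i (cdiv i χ))) := fun i => ((hχ.cdiv i).1.cmul i).dil k
  rw [← integral_finsetSum _ fun i _ => hb.integrable_pieceKer (hT i) (hθ.dil j) x w]
  congr 1 with z
  rw [← Finset.mul_sum, ← kern_sum _ fun i _ => ((hT i).mul_symbol hb _).integrable]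
  congr 2
  ext ξ
  rw [← Finset.mul_sum]
  congr 1
  exact (hχ.sum_cmul_cdiv _).symm

/-- The almost-orthogonality estimate for `pieceKer`. -/
lemma SymbolClass.pieceKer_gain {n : ℕ} {m : ℝ} (M N : ℕ) : ∀ {b : Rn n → Rn n → ℂ}
    (_ : SymbolClass n m b) {χ : Rn n → ℂ} (_ : Tst χ) {θ : Rn n → ℂ} (_ : Tst θ),
    ∃ C : ℝ, 0 ≤ C ∧ ∀ (j k : ℕ), (k = 0 ∨ Tst0 χ) → (j ≤ k ∨ Tst0 θ) → ∀ x w : Rn n,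
      (1 + ‖(2 : ℝ) ^ k • w‖) ^ N * ‖pieceKer θ χ b j k x w‖ *
        ((2 : ℝ) ^ (j - k) * 2 ^ (k - j)) ^ M ≤
        C * (((2 : ℝ) ^ (k - j)) ^ N * ((2 : ℝ) ^ k) ^ m * ((2 : ℝ) ^ k) ^ n) := by
  induction M with
  | zero =>
    intro b hb χ hχ θ hθ
    obtain ⟨C, hC0, hC⟩ := hb.pieceKer_base hχ hθ N
    exact ⟨C, hC0, fun j k hk _ x w => by simpa using hC j k hk x w⟩
  | succ M ih =>
    intro b hb χ hχ θ hθ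
    have hleft : ∃ C : ℝ, 0 ≤ C ∧ ∀ (j k : ℕ), k < j → (k = 0 ∨ Tst0 χ) → (j ≤ k ∨ Tst0 θ) →
        ∀ x w : Rn n, (1 + ‖(2 : ℝ) ^ k • w‖) ^ N * ‖pieceKer θ χ b j k x w‖ *
        ((2 : ℝ) ^ (j - k) * 2 ^ (k - j)) ^ (M + 1) ≤
        C * (((2 : ℝ) ^ (k - j)) ^ N * ((2 : ℝ) ^ k) ^ m * ((2 : ℝ) ^ k) ^ n) := by
      by_cases hθ0 : Tst0 θ
      swap
      · exact ⟨0, le_rfl, fun j k hjk _ h => (hθ0 (h.resolve_left (by omega))).elim⟩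
      choose C1 hC10 hC1 using fun i : Fin n => ih (hb.pd_left i) hχ (hθ0.cdiv i).1
      choose C2 hC20 hC2 using fun i : Fin n => ih hb (hχ.cmul i) (hθ0.cdiv i).1
      refine ⟨∑ i, (C1 i + C2 i),
        Finset.sum_nonneg fun i _ => add_nonneg (hC10 i) (hC20 i), fun j k hjk hk _ x w => ?_⟩
      have key : ‖pieceKer θ χ b j k x w‖ * 2 ^ (j - k) ≤
          ∑ i, (‖pieceKer (cdiv i θ) χ (fun x ξ => pd i (fun x' => b x' ξ) x) j k x w‖ +
            ‖pieceKer (cdiv i θ) (cmul i χ) b j k x w‖) := by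
        rw [hb.pieceKer_sum_left hχ hθ0]
        refine (mul_le_mul_of_nonneg_right (norm_sum_le _ _) (by positivity)).trans ?_
        rw [Finset.sum_mul]
        refine Finset.sum_le_sum fun i _ => ?_
        have h1 := congrArg norm (hb.pieceKer_cmul hχ (hθ0.cdiv i).1 j k i x w)
        rw [norm_mul, Complex.norm_real, Real.norm_of_nonneg (by positivity)] at h1
        have h2 := h1.le.trans (norm_add_le _ _)
        rw [norm_mul, norm_mul, norm_neg, Complex.norm_I, Complex.norm_real,
          Real.norm_of_nonneg (by positivity), one_mul] at h2
        have h3 : (2 : ℝ) ^ j = 2 ^ (j - k) * 2 ^ k := by rw [← pow_add]; congr 1; omega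
        rw [h3] at h2
        have h4 : (1 : ℝ) ≤ 2 ^ k := one_le_pow₀ (by norm_num)
        have h5 := norm_nonneg
          (pieceKer (cdiv i θ) χ (fun x ξ => pd i (fun x' => b x' ξ) x) j k x w)
        have h6 : (0 : ℝ) < 2 ^ k := by positivity
        refine le_of_mul_le_mul_right ?_ h6
        nlinarith
      have hkj : k - j = 0 := by omega
      calc _ = (1 + ‖(2 : ℝ) ^ k • w‖) ^ N * ((2 : ℝ) ^ (j - k) * 2 ^ (k - j)) ^ M *
            (‖pieceKer θ χ b j k x w‖ * 2 ^ (j - k)) := by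
            rw [pow_succ, hkj]; ring
        _ ≤ _ := mul_le_mul_of_nonneg_left key (by positivity)
        _ ≤ _ := ?_
      rw [Finset.mul_sum, Finset.sum_mul]
      refine Finset.sum_le_sum fun i _ => ?_
      have h1 := hC1 i j k hk (Or.inr (hθ0.cdiv i)) x w
      have h2 := hC2 i j k (hk.imp_right fun h => h.cmul i) (Or.inr (hθ0.cdiv i)) x w
      linarith
    have hright : ∃ C : ℝ, 0 ≤ C ∧ ∀ (j k : ℕ), j < k → (k = 0 ∨ Tst0 χ) → (j ≤ k ∨ Tst0 θ) →
        ∀ x w : Rn n, (1 + ‖(2 : ℝ) ^ k • w‖) ^ N * ‖pieceKer θ χ b j k x w‖ *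
        ((2 : ℝ) ^ (j - k) * 2 ^ (k - j)) ^ (M + 1) ≤
        C * (((2 : ℝ) ^ (k - j)) ^ N * ((2 : ℝ) ^ k) ^ m * ((2 : ℝ) ^ k) ^ n) := by
      by_cases hχ0 : Tst0 χ
      swap
      · exact ⟨0, le_rfl, fun j k hjk h => (hχ0 (h.resolve_left (by omega))).elim⟩
      choose C1 hC10 hC1 using fun i : Fin n => ih (hb.pd_left i) (hχ0.cdiv i).1 hθ
      choose C2 hC20 hC2 using fun i : Fin n => ih hb (hχ0.cdiv i).1 (hθ.cmul i)
      refine ⟨∑ i, (C1 i + C2 i),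
        Finset.sum_nonneg fun i _ => add_nonneg (hC10 i) (hC20 i), fun j k hjk _ hj x w => ?_⟩
      have key : ‖pieceKer θ χ b j k x w‖ * 2 ^ (k - j) ≤
          ∑ i, (‖pieceKer θ (cdiv i χ) (fun x ξ => pd i (fun x' => b x' ξ) x) j k x w‖ +
            ‖pieceKer (cmul i θ) (cdiv i χ) b j k x w‖) := by
        rw [hb.pieceKer_sum_right hχ0 hθ]
        refine (mul_le_mul_of_nonneg_right (norm_sum_le _ _) (by positivity)).trans ?_
        rw [Finset.sum_mul]
        refine Finset.sum_le_sum fun i _ => ?_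
        have h0 := hb.pieceKer_cmul (hχ0.cdiv i).1 hθ j k i x w
        have h0' : ((2 : ℝ) ^ k : ℝ) * pieceKer θ (cmul i (cdiv i χ)) b j k x w =
          ((2 : ℝ) ^ j : ℝ) * pieceKer (cmul i θ) (cdiv i χ) b j k x w + Complex.I *
            pieceKer θ (cdiv i χ) (fun x ξ => pd i (fun x' => b x' ξ) x) j k x w := by
          linear_combination -h0
        have h1 := congrArg norm h0'
        rw [norm_mul, Complex.norm_real, Real.norm_of_nonneg (by positivity)] at h1
        have h2 := h1.le.trans (norm_add_le _ _)
        rw [norm_mul, norm_mul, Complex.norm_I, Complex.norm_real,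
          Real.norm_of_nonneg (by positivity), one_mul] at h2
        have h3 : (2 : ℝ) ^ k = 2 ^ (k - j) * 2 ^ j := by rw [← pow_add]; congr 1; omega
        rw [h3] at h2
        have h4 : (1 : ℝ) ≤ 2 ^ j := one_le_pow₀ (by norm_num)
        have h5 := norm_nonneg
          (pieceKer θ (cdiv i χ) (fun x ξ => pd i (fun x' => b x' ξ) x) j k x w)
        have h6 : (0 : ℝ) < 2 ^ j := by positivity
        refine le_of_mul_le_mul_right ?_ h6
        nlinarith
      have hkj : j - k = 0 := by omega
      calc _ = (1 + ‖(2 : ℝ) ^ k • w‖) ^ N * ((2 : ℝ) ^ (j - k) * 2 ^ (k - j)) ^ M *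
            (‖pieceKer θ χ b j k x w‖ * 2 ^ (k - j)) := by
            rw [pow_succ, hkj]; ring
        _ ≤ _ := mul_le_mul_of_nonneg_left key (by positivity)
        _ ≤ _ := ?_
      rw [Finset.mul_sum, Finset.sum_mul]
      refine Finset.sum_le_sum fun i _ => ?_
      have h1 := hC1 i j k (Or.inr (hχ0.cdiv i)) hj x w
      have h2 := hC2 i j k (Or.inr (hχ0.cdiv i)) (Or.inl hjk.le) x w
      linarith
    obtain ⟨C1, hC10, hC1⟩ := hleft
    obtain ⟨C2, hC20, hC2⟩ := hright
    obtain ⟨C3, hC30, hC3⟩ := ih hb hχ hθ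
    refine ⟨C1 + C2 + C3, by positivity, fun j k hk hj x w => ?_⟩
    rcases lt_trichotomy j k with h | h | h
    · refine (hC2 j k h hk hj x w).trans ?_
      gcongr
      linarith
    · have h1 := hC3 j k hk hj x w
      subst h
      simp only [Nat.sub_self, pow_zero, mul_one, one_pow] at h1 ⊢
      refine h1.trans ?_
      gcongr
      linarith
    · refine (hC1 j k h hk hj x w).trans ?_
      gcongr
      linarith

/-- The mother functions of the Littlewood–Paley decomposition: the `k`-th piece is
`dil k (lpBase ψ0 k)`. -/
def lpBase {n : ℕ} (ψ0 : Rn n → ℝ) (k : ℕ) (ξ : Rn n) : ℂ :=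
  if k = 0 then (ψ0 ξ : ℂ) else (ψ0 ξ : ℂ) - (ψ0 ((2 : ℝ) • ξ) : ℂ)

/-- Fattened versions of `lpBase`. -/
def lpFat {n : ℕ} (ψ0 : Rn n → ℝ) (k : ℕ) (ξ : Rn n) : ℂ :=
  if k = 0 then (ψ0 ((2 : ℝ)⁻¹ • ξ) : ℂ)
  else (ψ0 ((2 : ℝ)⁻¹ • ξ) : ℂ) - (ψ0 ((8 : ℝ) • ξ) : ℂ)

lemma IsLPBase.tst_smul {n : ℕ} {ψ0 : Rn n → ℝ} (h : IsLPBase n ψ0) {c : ℝ} (hc : c ≠ 0) :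
    Tst (fun ξ => (ψ0 (c • ξ) : ℂ)) := by
  have hcs : HasCompactSupport ψ0 := by
    refine HasCompactSupport.of_support_subset_isCompact (isCompact_closedBall 0 2) fun ξ hξ => ?_
    by_contra h2
    refine hξ (h.2.2 ξ ?_)
    simpa using h2
  refine ⟨?_, ?_⟩
  · exact Complex.ofRealCLM.contDiff.comp (h.1.comp (contDiff_const_smul c))
  · have : HasCompactSupport (fun ξ => ψ0 (c • ξ)) :=
      hcs.comp_homeomorph (Homeomorph.smulOfNeZero c hc)
    exact this.comp_left (g := fun r : ℝ => (r : ℂ)) (by simp)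

lemma Tst.sub {n : ℕ} {u v : Rn n → ℂ} (hu : Tst u) (hv : Tst v) :
    Tst (fun ξ => u ξ - v ξ) := by
  simpa [sub_eq_add_neg] using hu.add (hv.const_mul (-1))

lemma IsLPBase.tst_base {n : ℕ} {ψ0 : Rn n → ℝ} (h : IsLPBase n ψ0) (k : ℕ) :
    Tst (lpBase ψ0 k) := by
  have h1 : Tst (fun ξ => (ψ0 ξ : ℂ)) := by simpa using h.tst_smul (one_ne_zero)
  unfold lpBase
  split_ifs
  · exact h1
  · exact h1.sub (h.tst_smul two_ne_zero)

lemma IsLPBase.tst_fat {n : ℕ} {ψ0 : Rn n → ℝ} (h : IsLPBase n ψ0) (k : ℕ) :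
    Tst (lpFat ψ0 k) := by
  unfold lpFat
  split_ifs
  · exact h.tst_smul (by norm_num)
  · exact (h.tst_smul (by norm_num)).sub (h.tst_smul (by norm_num))

lemma notMem_tsupport_of_ball {n : ℕ} {u : Rn n → ℂ} {r : ℝ} (hr : 0 < r)
    (h : ∀ ξ, ‖ξ‖ < r → u ξ = 0) : (0 : Rn n) ∉ tsupport u := by
  rw [notMem_tsupport_iff_eventuallyEq]
  filter_upwards [Metric.ball_mem_nhds (0 : Rn n) hr] with ξ hξ
  exact h ξ (by simpa using hξ)

lemma IsLPBase.tst0_base {n : ℕ} {ψ0 : Rn n → ℝ} (h : IsLPBase n ψ0) {k : ℕ} (hk : k ≠ 0) :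
    Tst0 (lpBase ψ0 k) := by
  refine ⟨h.tst_base k, notMem_tsupport_of_ball (r := 1 / 2) (by norm_num) fun ξ hξ => ?_⟩
  rw [lpBase, if_neg hk, h.2.1 ξ (by linarith), h.2.1 _ (by rw [norm_smul]; norm_num; linarith),
    sub_self]

lemma IsLPBase.tst0_fat {n : ℕ} {ψ0 : Rn n → ℝ} (h : IsLPBase n ψ0) {k : ℕ} (hk : k ≠ 0) :
    Tst0 (lpFat ψ0 k) := by
  refine ⟨h.tst_fat k, notMem_tsupport_of_ball (r := 1 / 8) (by norm_num) fun ξ hξ => ?_⟩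
  rw [lpFat, if_neg hk, h.2.1 _ (by rw [norm_smul]; norm_num; linarith),
    h.2.1 _ (by rw [norm_smul]; norm_num; linarith), sub_self]

lemma IsLPBase.fat_mul_base {n : ℕ} {ψ0 : Rn n → ℝ} (h : IsLPBase n ψ0) (k : ℕ) (ξ : Rn n) :
    lpFat ψ0 k ξ * lpBase ψ0 k ξ = lpBase ψ0 k ξ := by
  rcases le_or_gt ‖ξ‖ 2 with h2 | h2
  · have e1 : ψ0 ((2 : ℝ)⁻¹ • ξ) = 1 := h.2.1 _ (by rw [norm_smul]; norm_num; linarith)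
    by_cases hk : k = 0
    · simp [lpFat, lpBase, hk, e1]
    rcases le_or_gt ‖ξ‖ (1 / 2) with h3 | h3
    · rw [lpBase, if_neg hk, h.2.1 ξ (by linarith),
        h.2.1 ((2 : ℝ) • ξ) (by rw [norm_smul]; norm_num; linarith)]
      simp
    · have e2 : ψ0 ((8 : ℝ) • ξ) = 0 := h.2.2 _ (by rw [norm_smul]; norm_num; linarith)
      simp [lpFat, hk, e1, e2]
  · have : lpBase ψ0 k ξ = 0 := by
      rw [lpBase, h.2.2 ξ h2, h.2.2 ((2 : ℝ) • ξ) (by rw [norm_smul]; norm_num; linarith)]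
      simp
    rw [this, mul_zero]

lemma lpPiece_eq_dil {n : ℕ} (ψ0 : Rn n → ℝ) (k : ℕ) :
    (fun ξ => (lpPiece n ψ0 k ξ : ℂ)) = dil k (lpBase ψ0 k) := by
  ext ξ
  unfold lpPiece dil lpBase
  split_ifs with hk
  · simp [hk]
  · rw [smul_smul, zpow_add₀ two_ne_zero, zpow_neg, zpow_natCast, zpow_one, mul_comm]
    push_cast
    ring

lemma sum_dil_lpBase {n : ℕ} (ψ0 : Rn n → ℝ) (K : ℕ) (ξ : Rn n) :
    ∑ k ∈ Finset.range (K + 1), dil k (lpBase ψ0 k) ξ = (ψ0 (((2 : ℝ) ^ K)⁻¹ • ξ) : ℂ) := by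
  induction K with
  | zero => simp [dil, lpBase]
  | succ K ih =>
    rw [Finset.sum_range_succ, ih, dil, lpBase, if_neg (Nat.succ_ne_zero K), smul_smul, pow_succ,
      mul_inv, mul_comm ((2 : ℝ) ^ K)⁻¹, ← mul_assoc, mul_inv_cancel₀ two_ne_zero, one_mul]
    ring

lemma IsLPBase.exists_bound {n : ℕ} {ψ0 : Rn n → ℝ} (h : IsLPBase n ψ0) :
    ∃ C : ℝ, 0 ≤ C ∧ ∀ ξ, ‖(ψ0 ξ : ℂ)‖ ≤ C := by
  have h1 : Tst (fun ξ => (ψ0 ξ : ℂ)) := by simpa using h.tst_smul (one_ne_zero)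
  obtain ⟨C, hC⟩ := h1.2.exists_bound_of_continuous h1.continuous
  exact ⟨C, (norm_nonneg _).trans (hC 0), hC⟩

lemma IsLPBase.tendsto_dil {n : ℕ} {ψ0 : Rn n → ℝ} (h : IsLPBase n ψ0) (ξ : Rn n) :
    Filter.Tendsto (fun K : ℕ => (ψ0 (((2 : ℝ) ^ K)⁻¹ • ξ) : ℂ)) Filter.atTop (nhds 1) := by
  have h0 : Filter.Tendsto (fun K : ℕ => ((2 : ℝ) ^ K)⁻¹ * ‖ξ‖) Filter.atTop (nhds (0 * ‖ξ‖)) := by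
    refine Filter.Tendsto.mul_const _ ?_
    exact (tendsto_pow_atTop_atTop_of_one_lt (by norm_num)).inv_tendsto_atTop
  rw [zero_mul] at h0
  refine tendsto_const_nhds.congr' ?_
  filter_upwards [h0.eventually (eventually_le_nhds one_pos)] with K hK
  rw [h.2.1 _ (by rwa [norm_smul, Real.norm_of_nonneg (by positivity)])]
  simp

lemma ftransform_schwartz_eq {n : ℕ} (f : SchwartzMap (Rn n) ℂ) (ξ : Rn n) :
    ftransform n f ξ = FourierTransform.fourier f ((2 * Real.pi)⁻¹ • ξ) := by
  rw [SchwartzMap.fourier_coe, Real.fourier_eq']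
  unfold ftransform
  congr 1 with x
  rw [smul_eq_mul, inner_smul_right]
  congr 2
  have : (Real.pi : ℂ) ≠ 0 := by exact_mod_cast Real.pi_ne_zero
  push_cast
  field_simp

lemma continuous_ftransform_schwartz {n : ℕ} (f : SchwartzMap (Rn n) ℂ) :
    Continuous (ftransform n f) := by
  have : ftransform n f = fun ξ => FourierTransform.fourier f ((2 * Real.pi)⁻¹ • ξ) :=
    funext (ftransform_schwartz_eq f)
  rw [this]
  exact (SchwartzMap.continuous _).comp (continuous_const_smul _)

lemma ftransform_schwartz_decay {n : ℕ} (f : SchwartzMap (Rn n) ℂ) (N : ℕ) :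
    ∃ C : ℝ, 0 ≤ C ∧ ∀ ξ : Rn n, (1 + ‖ξ‖) ^ N * ‖ftransform n f ξ‖ ≤ C := by
  have h := fun x => SchwartzMap.one_add_le_sup_seminorm_apply (𝕜 := ℝ) (m := (N, 0)) le_rfl le_rfl
    (FourierTransform.fourier f : SchwartzMap (Rn n) ℂ) x
  set D := 2 ^ (N, 0).1 * ((Finset.Iic (N, 0)).sup fun m => SchwartzMap.seminorm ℝ m.1 m.2)
    (FourierTransform.fourier f : SchwartzMap (Rn n) ℂ)
  have hD : 0 ≤ D := le_trans (by positivity) (h 0)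
  refine ⟨(2 * Real.pi) ^ N * D, by positivity, fun ξ => ?_⟩
  have h1 := h ((2 * Real.pi)⁻¹ • ξ)
  rw [norm_iteratedFDeriv_zero, ← ftransform_schwartz_eq] at h1
  have hpi : 1 ≤ 2 * Real.pi := by linarith [Real.pi_gt_three]
  have h2 : 1 + ‖ξ‖ ≤ 2 * Real.pi * (1 + ‖(2 * Real.pi)⁻¹ • ξ‖) := by
    rw [norm_smul, Real.norm_of_nonneg (by positivity), mul_add, mul_inv_cancel_left₀ (by positivity)]
    linarith
  calc (1 + ‖ξ‖) ^ N * ‖ftransform n f ξ‖ ≤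
      (2 * Real.pi * (1 + ‖(2 * Real.pi)⁻¹ • ξ‖)) ^ N * ‖ftransform n f ξ‖ := by gcongr
    _ = (2 * Real.pi) ^ N * ((1 + ‖(2 * Real.pi)⁻¹ • ξ‖) ^ N * ‖ftransform n f ξ‖) := by
      rw [mul_pow]; ring
    _ ≤ _ := by gcongr

/-- The half-wave factor `e^{i|ξ|}`. -/
def wavePh {n : ℕ} (ξ : Rn n) : ℂ := Complex.exp (Complex.I * ((‖ξ‖ : ℝ) : ℂ))

/-- The frequency localised half-wave evolution of `f`. -/
def wavePiece {n : ℕ} (ψ0 : Rn n → ℝ) (f : Rn n → ℂ) (k : ℕ) : Rn n → ℂ :=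
  kern n (fun ξ => wavePh ξ * (dil k (lpBase ψ0 k) ξ * ftransform n f ξ))

lemma norm_wavePh {n : ℕ} (ξ : Rn n) : ‖wavePh ξ‖ = 1 := by
  unfold wavePh
  rw [Complex.norm_exp]
  simp

lemma continuous_wavePh {n : ℕ} : Continuous (wavePh : Rn n → ℂ) := by
  unfold wavePh
  fun_prop

lemma integrable_inv_one_add_norm_pow (n : ℕ) :
    Integrable (fun x : Rn n => ((1 + ‖x‖) ^ (n + 1))⁻¹) := by
  have h := integrable_of_decay (n := n) (g := fun x => ((((1 + ‖x‖) ^ (n + 1))⁻¹ : ℝ) : ℂ))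
    (Complex.continuous_ofReal.comp ((Continuous.pow (by fun_prop) _).inv₀ fun x =>
      (by positivity : (0 : ℝ) < (1 + ‖x‖) ^ (n + 1)).ne'))
    (C := 1) (fun x => by
      rw [Complex.norm_real, Real.norm_of_nonneg (by positivity), mul_inv_cancel₀ (by positivity)])
  refine h.norm.congr (Filter.Eventually.of_forall fun x => ?_)
  simp only [Complex.norm_real]
  rw [Real.norm_of_nonneg (by positivity)]

lemma integrable_bracket_ftransform {n : ℕ} (f : SchwartzMap (Rn n) ℂ) (e : ℝ) :
    Integrable (fun ξ : Rn n => (1 + ‖ξ‖ ^ 2) ^ e * ‖ftransform n f ξ‖) := by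
  obtain ⟨N, hN⟩ := exists_nat_ge (2 * |e|)
  obtain ⟨C, hC0, hC⟩ := ftransform_schwartz_decay f (N + (n + 1))
  refine ((integrable_inv_one_add_norm_pow n).const_mul C).mono'
    ((continuous_bracket e).mul
      (continuous_ftransform_schwartz f).norm).aestronglyMeasurable
    (Filter.Eventually.of_forall fun ξ => ?_)
  rw [Real.norm_of_nonneg (by positivity)]
  have h1 : (1 + ‖ξ‖ ^ 2) ^ e ≤ (1 + ‖ξ‖) ^ N := by
    have hb : (1 : ℝ) ≤ 1 + ‖ξ‖ ^ 2 := by nlinarith [norm_nonneg ξ]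
    calc (1 + ‖ξ‖ ^ 2) ^ e ≤ (1 + ‖ξ‖ ^ 2) ^ |e| :=
          Real.rpow_le_rpow_of_exponent_le hb (le_abs_self e)
      _ ≤ ((1 + ‖ξ‖) ^ 2) ^ |e| :=
          Real.rpow_le_rpow (by positivity) (by nlinarith [norm_nonneg ξ]) (abs_nonneg e)
      _ = (1 + ‖ξ‖) ^ (2 * |e|) := by
          rw [← Real.rpow_natCast, ← Real.rpow_mul (by positivity)]
          norm_num
      _ ≤ (1 + ‖ξ‖) ^ (N : ℝ) :=
          Real.rpow_le_rpow_of_exponent_le (by linarith [norm_nonneg ξ]) hN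
      _ = _ := Real.rpow_natCast _ _
  have h2 := hC ξ
  rw [← div_eq_mul_inv, le_div_iff₀ (by positivity)]
  calc _ ≤ (1 + ‖ξ‖) ^ N * ‖ftransform n f ξ‖ * (1 + ‖ξ‖) ^ (n + 1) := by gcongr
    _ = (1 + ‖ξ‖) ^ (N + (n + 1)) * ‖ftransform n f ξ‖ := by rw [pow_add]; ring
    _ ≤ C := h2

lemma integrable_ftransform_schwartz {n : ℕ} (f : SchwartzMap (Rn n) ℂ) :
    Integrable (ftransform n f) := by
  have h := integrable_bracket_ftransform f 0
  simp only [Real.rpow_zero, one_mul] at h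
  exact (integrable_norm_iff (continuous_ftransform_schwartz f).aestronglyMeasurable).1 h

lemma integrable_tst_mul {n : ℕ} {χ u : Rn n → ℂ} (hχ : Tst χ) (hu : Integrable u) :
    Integrable (fun ξ => χ ξ * u ξ) := by
  obtain ⟨C, hC⟩ := hχ.2.exists_bound_of_continuous hχ.continuous
  exact hu.bdd_mul (c := C) hχ.continuous.aestronglyMeasurable (Filter.Eventually.of_forall hC)

lemma integrable_wavePh_mul {n : ℕ} {u : Rn n → ℂ} (hu : Integrable u) :
    Integrable (fun ξ => wavePh ξ * u ξ) :=
  hu.bdd_mul (c := 1) continuous_wavePh.aestronglyMeasurable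
    (Filter.Eventually.of_forall fun ξ => (norm_wavePh ξ).le)

lemma fio_wave_eq {n : ℕ} (a : Rn n → Rn n → ℂ) (f : Rn n → ℂ) (x : Rn n) :
    fio n a (fun x ξ => ⟪x, ξ⟫_ℝ + ‖ξ‖) f x =
      kern n (fun ξ => a x ξ * (wavePh ξ * ftransform n f ξ)) x := by
  unfold fio kern wavePh
  congr 2 with ξ
  push_cast
  rw [mul_add, Complex.exp_add]
  ring

lemma SymbolClass.continuous_kern_diag {n : ℕ} {m : ℝ} {b : Rn n → Rn n → ℂ}
    (hb : SymbolClass n m b) {v : Rn n → ℂ} (hv : Continuous v)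
    (h_int : Integrable (fun ξ => (1 + ‖ξ‖ ^ 2) ^ (m / 2) * ‖v ξ‖)) :
    Continuous (fun x => kern n (fun ξ => b x ξ * v ξ) x) := by
  obtain ⟨C, hC0, hC⟩ := hb.norm_le
  unfold kern
  refine continuous_const.mul (continuous_of_dominated
    (bound := fun ξ => C * ((1 + ‖ξ‖ ^ 2) ^ (m / 2) * ‖v ξ‖)) (fun x => ?_) (fun x => ?_)
    (h_int.const_mul C) ?_)
  · exact Continuous.aestronglyMeasurable
      (by have := (hb.contDiff_right x).continuous; fun_prop)
  · refine Filter.Eventually.of_forall fun ξ => ?_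
    rw [norm_mul, norm_exp_I_mul_ofReal', one_mul, norm_mul, ← mul_assoc]
    gcongr
    exact hC x ξ
  · refine Filter.Eventually.of_forall fun ξ => ?_
    have := (hb.contDiff_left ξ).continuous
    fun_prop

lemma SymbolClass.norm_kern_le {n : ℕ} {m : ℝ} {b : Rn n → Rn n → ℂ} {C : ℝ}
    (hC : ∀ x ξ : Rn n, ‖b x ξ‖ ≤ C * (1 + ‖ξ‖ ^ 2) ^ (m / 2)) {v : Rn n → ℂ}
    (h_int : Integrable (fun ξ => (1 + ‖ξ‖ ^ 2) ^ (m / 2) * ‖v ξ‖)) (x y : Rn n) :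
    ‖kern n (fun ξ => b x ξ * v ξ) y‖ ≤ C * ∫ ξ, (1 + ‖ξ‖ ^ 2) ^ (m / 2) * ‖v ξ‖ := by
  refine (_root_.norm_kern_le _ _).trans ?_
  rw [← integral_const_mul]
  refine integral_mono_of_nonneg (Filter.Eventually.of_forall fun ξ => norm_nonneg _)
    (h_int.const_mul C) (Filter.Eventually.of_forall fun ξ => ?_)
  simp only
  rw [norm_mul, ← mul_assoc]
  gcongr
  exact hC x ξ

/-- The kernels `pieceKer` represent the composition of a Fourier multiplier with a frequency
localised pseudodifferential operator. -/
lemma SymbolClass.integral_kern_mul_conv {n : ℕ} {m : ℝ} {b : Rn n → Rn n → ℂ}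
    (hb : SymbolClass n m b) {χ : Rn n → ℂ} (hχ : Tst χ) {θ : Rn n → ℂ} (hθ : Tst θ) (j k : ℕ)
    (x : Rn n) {h : Rn n → ℂ} (hh : Continuous h) {B : ℝ} (hB : ∀ y, ‖h y‖ ≤ B) :
    ∫ z, kern n (dil j θ) z *
        ∫ y, kern n (fun ξ => b (x - z) ξ * dil k χ ξ) (x - z - y) * h y =
      ∫ y, pieceKer θ χ b j k x (x - y) * h y := by
  obtain ⟨C, hC0, hC⟩ := hb.kern_decay (hχ.dil k) (n + 1)
  have hdec : ∀ x w, ‖kern n (fun ξ => b x ξ * dil k χ ξ) w‖ ≤ C * ((1 + ‖w‖) ^ (n + 1))⁻¹ := by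
    intro x w
    have := hC 0 (Or.inl rfl) x w
    rw [← div_eq_mul_inv, le_div_iff₀ (by positivity), mul_comm]
    simpa [dil] using this
  have hB0 : 0 ≤ B := (norm_nonneg _).trans (hB 0)
  have hF : Integrable (Function.uncurry fun z y : Rn n => kern n (dil j θ) z *
      (kern n (fun ξ => b (x - z) ξ * dil k χ ξ) (x - z - y) * h y))
      (volume.prod volume) := by
    have h1 := (hθ.dil j).integrable_kern.norm.convolution_integrand
      (ContinuousLinearMap.mul ℝ ℝ) (integrable_inv_one_add_norm_pow n)
    have mp : MeasurePreserving (fun p : Rn n × Rn n => (x - p.2, p.1))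
        (volume.prod volume) (volume.prod volume) :=
      (((volume : Measure (Rn n)).measurePreserving_sub_left x).prod (MeasurePreserving.id volume)).comp
        Measure.measurePreserving_swap
    have h2 := (mp.integrable_comp_of_integrable h1).const_mul (C * B)
    refine h2.mono' ?_ (Filter.Eventually.of_forall fun p => ?_)
    · have c1 : Continuous fun p : Rn n × Rn n => kern n (dil j θ) p.1 :=
        (_root_.continuous_kern (hθ.dil j).integrable).comp continuous_fst
      have c0 : Continuous fun p : Rn n × Rn n => (x - p.1, x - p.1 - p.2) :=
        (continuous_const.sub continuous_fst).prodMk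
          ((continuous_const.sub continuous_fst).sub continuous_snd)
      have c2 := (hb.continuous_kern (hχ.dil k)).comp c0
      have c3 : Continuous fun p : Rn n × Rn n => h p.2 := hh.comp continuous_snd
      exact (c1.mul (c2.mul c3)).aestronglyMeasurable
    · simp only [Function.uncurry, Function.comp, ContinuousLinearMap.mul_apply', norm_mul]
      rw [show x - p.2 - p.1 = x - p.1 - p.2 by abel]
      calc _ ≤ ‖kern n (dil j θ) p.1‖ * ((C * ((1 + ‖x - p.1 - p.2‖) ^ (n + 1))⁻¹) * B) := by
            gcongr
            · exact hdec _ _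
            · exact hB _
        _ = _ := by ring
  simp only [← integral_const_mul]
  rw [integral_integral_swap hF]
  congr 1 with y
  unfold pieceKer
  rw [← integral_mul_const]
  congr 1 with z
  rw [mul_assoc, show x - z - y = x - y - z by abel]

lemma integrable_wavePiece_symbol {n : ℕ} {ψ0 : Rn n → ℝ} (hψ : IsLPBase n ψ0)
    (f : SchwartzMap (Rn n) ℂ) (k : ℕ) :
    Integrable (fun ξ => wavePh ξ * (dil k (lpBase ψ0 k) ξ * ftransform n f ξ)) :=
  integrable_wavePh_mul (integrable_tst_mul ((hψ.tst_base k).dil k)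
    (integrable_ftransform_schwartz f))

lemma integral_kern_sub_eq {n : ℕ} (ψ0 : Rn n → ℝ) (j : ℕ) (g : Rn n → ℂ) (x : Rn n) :
    smoothOp n (lpPiece n ψ0 j) g x = ∫ z, kern n (dil j (lpBase ψ0 j)) z * g (x - z) := by
  unfold smoothOp
  rw [invFT_eq_kern, lpPiece_eq_dil,
    ← integral_sub_left_eq_self (fun y => kern n (dil j (lpBase ψ0 j)) (x - y) * g y) volume x]
  simp

lemma SymbolClass.kern_piece {n : ℕ} {m : ℝ} {a : Rn n → Rn n → ℂ} (ha : SymbolClass n m a)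
    {ψ0 : Rn n → ℝ} (hψ : IsLPBase n ψ0) (f : SchwartzMap (Rn n) ℂ) (k : ℕ) (y : Rn n) :
    kern n (fun ξ => a y ξ * (dil k (lpBase ψ0 k) ξ * (wavePh ξ * ftransform n f ξ))) y =
      ∫ y', kern n (fun ξ => a y ξ * dil k (lpFat ψ0 k) ξ) (y - y') * wavePiece ψ0 f k y' := by
  have ht := ((hψ.tst_fat k).dil k).mul_symbol ha y
  unfold wavePiece
  rw [← kern_mul ht.continuous ht.integrable ht.integrable_kern
    (integrable_wavePiece_symbol hψ f k)]
  congr 1 with ξ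
  have := hψ.fat_mul_base k (((2 : ℝ) ^ k)⁻¹ • ξ)
  unfold dil
  linear_combination (-a y ξ * wavePh ξ * ftransform n f ξ) * this

lemma SymbolClass.enorm_smoothOp_fio_le {n : ℕ} {m : ℝ} {a : Rn n → Rn n → ℂ}
    (ha : SymbolClass n m a) {ψ0 : Rn n → ℝ} (hψ : IsLPBase n ψ0) (f : SchwartzMap (Rn n) ℂ)
    (j : ℕ) (x : Rn n) :
    ‖smoothOp n (lpPiece n ψ0 j) (fio n a (fun x ξ => ⟪x, ξ⟫_ℝ + ‖ξ‖) f) x‖ₑ ≤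
      ∑' k, ∫⁻ y, ‖pieceKer (lpBase ψ0 j) (lpFat ψ0 k) a j k x (x - y)‖ₑ *
        ‖wavePiece ψ0 f k y‖ₑ := by
  obtain ⟨Ca, hCa0, hCa⟩ := ha.norm_le
  obtain ⟨B, hB0, hB⟩ := hψ.exists_bound
  set v : Rn n → ℂ := fun ξ => wavePh ξ * ftransform n f ξ with hv
  have hvc : Continuous v := continuous_wavePh.mul (continuous_ftransform_schwartz f)
  have hvi : Integrable v := integrable_wavePh_mul (integrable_ftransform_schwartz f)
  have hvb : Integrable (fun ξ => (1 + ‖ξ‖ ^ 2) ^ (m / 2) * ‖v ξ‖) := by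
    refine (integrable_bracket_ftransform f (m / 2)).congr (Filter.Eventually.of_forall fun ξ => ?_)
    simp only [hv, norm_mul, norm_wavePh, one_mul]
  have hψc : ∀ K : ℕ, Continuous fun ξ : Rn n => (ψ0 (((2 : ℝ) ^ K)⁻¹ • ξ) : ℂ) := fun K =>
    Complex.continuous_ofReal.comp (hψ.1.continuous.comp (continuous_const_smul _))
  set vK : ℕ → Rn n → ℂ := fun K ξ => (ψ0 (((2 : ℝ) ^ K)⁻¹ • ξ) : ℂ) * v ξ with hvK
  have hvKc : ∀ K, Continuous (vK K) := fun K => (hψc K).mul hvc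
  have hvKle : ∀ K ξ, ‖vK K ξ‖ ≤ B * ‖v ξ‖ := fun K ξ => by
    rw [hvK]
    simp only [norm_mul]
    exact mul_le_mul_of_nonneg_right (hB _) (norm_nonneg _)
  have hvKb : ∀ K, Integrable (fun ξ => (1 + ‖ξ‖ ^ 2) ^ (m / 2) * ‖vK K ξ‖) := fun K => by
    refine (hvb.const_mul B).mono' ((continuous_bracket _).mul (hvKc K).norm).aestronglyMeasurable
      (Filter.Eventually.of_forall fun ξ => ?_)
    rw [Real.norm_of_nonneg (by positivity)]
    calc _ ≤ (1 + ‖ξ‖ ^ 2) ^ (m / 2) * (B * ‖v ξ‖) := by gcongr; exact hvKle K ξ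
      _ = _ := by ring
  set T : Rn n → ℂ := fun y => kern n (fun ξ => a y ξ * v ξ) y with hT
  set TK : ℕ → Rn n → ℂ := fun K y => kern n (fun ξ => a y ξ * vK K ξ) y with hTK
  set I0 := ∫ ξ, (1 + ‖ξ‖ ^ 2) ^ (m / 2) * ‖v ξ‖ with hI0
  have hTKc : ∀ K, Continuous (TK K) := fun K => ha.continuous_kern_diag (hvKc K) (hvKb K)
  have hTKb : ∀ K y, ‖TK K y‖ ≤ Ca * (B * I0) := fun K y => by
    refine (SymbolClass.norm_kern_le hCa (hvKb K) y y).trans ?_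
    refine mul_le_mul_of_nonneg_left ?_ hCa0
    rw [hI0, ← integral_const_mul]
    refine integral_mono (hvKb K) (hvb.const_mul B) fun ξ => ?_
    simp only
    calc _ ≤ (1 + ‖ξ‖ ^ 2) ^ (m / 2) * (B * ‖v ξ‖) := by gcongr; exact hvKle K ξ
      _ = _ := by ring
  have hTKlim : ∀ y, Filter.Tendsto (fun K => TK K y) Filter.atTop (nhds (T y)) := fun y => by
    have hac := (ha.contDiff_right y).continuous
    simp only [hTK, hT]
    unfold kern
    refine Filter.Tendsto.const_mul _ (tendsto_integral_of_dominated_convergence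
      (fun ξ => Ca * (B * ((1 + ‖ξ‖ ^ 2) ^ (m / 2) * ‖v ξ‖))) (fun K => ?_)
      ((hvb.const_mul B).const_mul Ca) (fun K => ?_) ?_)
    · refine Continuous.aestronglyMeasurable ?_
      have := hvKc K
      fun_prop
    · refine Filter.Eventually.of_forall fun ξ => ?_
      rw [norm_mul, norm_exp_I_mul_ofReal', one_mul, norm_mul]
      calc _ ≤ (Ca * (1 + ‖ξ‖ ^ 2) ^ (m / 2)) * (B * ‖v ξ‖) := by
            gcongr
            · exact hCa y ξ
            · exact hvKle K ξ
        _ = _ := by ring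
    · refine Filter.Eventually.of_forall fun ξ => ?_
      have h1 := (hψ.tendsto_dil ξ).mul_const (v ξ)
      rw [one_mul] at h1
      exact Filter.Tendsto.const_mul _ (Filter.Tendsto.const_mul _ h1)
  have hTKsum : ∀ K y, TK K y = ∑ k ∈ Finset.range (K + 1),
      ∫ y', kern n (fun ξ => a y ξ * dil k (lpFat ψ0 k) ξ) (y - y') * wavePiece ψ0 f k y' := by
    intro K y
    simp only [← ha.kern_piece hψ f]
    rw [← kern_sum]
    · simp only [hTK, hvK]
      congr 1 with ξ
      rw [← sum_dil_lpBase, Finset.sum_mul, Finset.mul_sum]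
    · intro k _
      have := integrable_tst_mul (((hψ.tst_base k).dil k).mul_symbol ha y) hvi
      refine this.congr (Filter.Eventually.of_forall fun ξ => ?_)
      simp only [mul_assoc, hv]
  have hwc : ∀ k, Continuous (wavePiece ψ0 f k) := fun k =>
    _root_.continuous_kern (integrable_wavePiece_symbol hψ f k)
  have hkI := ((hψ.tst_base j).dil j).integrable_kern
  have hpieces : ∀ k, Continuous fun y => kern n
      (fun ξ => a y ξ * (dil k (lpBase ψ0 k) ξ * v ξ)) y := fun k => by
    refine ha.continuous_kern_diag (((hψ.tst_base k).dil k).continuous.mul hvc) ?_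
    obtain ⟨D, hD⟩ := ((hψ.tst_base k).dil k).2.exists_bound_of_continuous
      ((hψ.tst_base k).dil k).continuous
    refine (hvb.const_mul D).mono' ((continuous_bracket _).mul
      (((hψ.tst_base k).dil k).continuous.mul hvc).norm).aestronglyMeasurable
      (Filter.Eventually.of_forall fun ξ => ?_)
    rw [Real.norm_of_nonneg (by positivity), norm_mul]
    calc _ ≤ (1 + ‖ξ‖ ^ 2) ^ (m / 2) * (D * ‖v ξ‖) := by gcongr; exact hD ξ
      _ = _ := by ring
  have hpb : ∀ k, ∃ D : ℝ, ∀ y, ‖kern n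
      (fun ξ => a y ξ * (dil k (lpBase ψ0 k) ξ * v ξ)) y‖ ≤ D := fun k => by
    obtain ⟨D, hD⟩ := ((hψ.tst_base k).dil k).2.exists_bound_of_continuous
      ((hψ.tst_base k).dil k).continuous
    have : Integrable (fun ξ => (1 + ‖ξ‖ ^ 2) ^ (m / 2) * ‖dil k (lpBase ψ0 k) ξ * v ξ‖) := by
      refine (hvb.const_mul D).mono' ((continuous_bracket _).mul
        (((hψ.tst_base k).dil k).continuous.mul hvc).norm).aestronglyMeasurable
        (Filter.Eventually.of_forall fun ξ => ?_)
      rw [Real.norm_of_nonneg (by positivity), norm_mul]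
      calc _ ≤ (1 + ‖ξ‖ ^ 2) ^ (m / 2) * (D * ‖v ξ‖) := by gcongr; exact hD ξ
        _ = _ := by ring
    exact ⟨_, fun y => SymbolClass.norm_kern_le hCa this y y⟩
  have hfin : ∀ K, ∫ z, kern n (dil j (lpBase ψ0 j)) z * TK K (x - z) =
      ∑ k ∈ Finset.range (K + 1),
        ∫ y, pieceKer (lpBase ψ0 j) (lpFat ψ0 k) a j k x (x - y) * wavePiece ψ0 f k y := by
    intro K
    simp only [hTKsum, Finset.mul_sum]
    rw [integral_finsetSum]
    · refine Finset.sum_congr rfl fun k _ => ?_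
      exact ha.integral_kern_mul_conv (hψ.tst_fat k) (hψ.tst_base j) j k x (hwc k)
        (fun y => _root_.norm_kern_le _ _)
    · intro k _
      simp only [← ha.kern_piece hψ f]
      obtain ⟨D, hD⟩ := hpb k
      exact hkI.mul_bdd (c := D) ((hpieces k).comp
        (continuous_const.sub continuous_id)).aestronglyMeasurable
        (Filter.Eventually.of_forall fun z => hD _)
  have hlim : Filter.Tendsto (fun K => ∫ z, kern n (dil j (lpBase ψ0 j)) z * TK K (x - z))
      Filter.atTop (nhds (∫ z, kern n (dil j (lpBase ψ0 j)) z * T (x - z))) := by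
    refine tendsto_integral_of_dominated_convergence
      (fun z => ‖kern n (dil j (lpBase ψ0 j)) z‖ * (Ca * (B * I0))) (fun K => ?_)
      (hkI.norm.mul_const _) (fun K => ?_) ?_
    · exact hkI.aestronglyMeasurable.mul
        ((hTKc K).comp (continuous_const.sub continuous_id)).aestronglyMeasurable
    · refine Filter.Eventually.of_forall fun z => ?_
      rw [norm_mul]
      gcongr
      exact hTKb K _
    · exact Filter.Eventually.of_forall fun z => Filter.Tendsto.const_mul _ (hTKlim _)
  have hfio : fio n a (fun x ξ => ⟪x, ξ⟫_ℝ + ‖ξ‖) f = T := funext fun y => fio_wave_eq a f y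
  rw [integral_kern_sub_eq, hfio]
  refine le_of_tendsto hlim.enorm (Filter.Eventually.of_forall fun K => ?_)
  rw [hfin]
  refine (enorm_sum_le _ _).trans (le_trans (Finset.sum_le_sum fun k _ => ?_)
    (ENNReal.sum_le_tsum (Finset.range (K + 1))))
  refine (enorm_integral_le_lintegral_enorm _).trans (le_of_eq ?_)
  simp only [enorm_mul]

/-- The `L¹`-normalised weight at scale `2^{-k}`. -/
def wtE {n : ℕ} (k N : ℕ) (x : Rn n) : ℝ≥0∞ :=
  ENNReal.ofReal (((2 : ℝ) ^ k) ^ n * ((1 + ‖(2 : ℝ) ^ k • x‖) ^ N)⁻¹)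

/-- Weighted average at scale `2^{-k}`. -/
def wavg {n : ℕ} (k N : ℕ) (H : Rn n → ℝ≥0∞) (x : Rn n) : ℝ≥0∞ :=
  ∫⁻ y, wtE k N (x - y) * H y

lemma lpBase_min {n : ℕ} (ψ0 : Rn n → ℝ) (k : ℕ) : lpBase ψ0 k = lpBase ψ0 (min k 1) := by
  ext ξ
  unfold lpBase
  rcases Nat.eq_zero_or_pos k with h | h
  · simp [h]
  · rw [min_eq_right h]
    simp [h.ne']

lemma lpFat_min {n : ℕ} (ψ0 : Rn n → ℝ) (k : ℕ) : lpFat ψ0 k = lpFat ψ0 (min k 1) := by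
  ext ξ
  unfold lpFat
  rcases Nat.eq_zero_or_pos k with h | h
  · simp [h]
  · rw [min_eq_right h]
    simp [h.ne']

lemma SymbolClass.norm_pieceKer_lp_le {n : ℕ} {m : ℝ} {a : Rn n → Rn n → ℂ}
    (ha : SymbolClass n m a) {ψ0 : Rn n → ℝ} (hψ : IsLPBase n ψ0) (σ : ℝ) (N : ℕ) :
    ∃ C : ℝ, 0 ≤ C ∧ ∀ (j k : ℕ) (x w : Rn n),
      (2 : ℝ) ^ ((j : ℝ) * σ) * ‖pieceKer (lpBase ψ0 j) (lpFat ψ0 k) a j k x w‖ ≤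
        C * (((2 : ℝ) ^ ((j - k) + (k - j)))⁻¹ * ((2 : ℝ) ^ ((k : ℝ) * (σ + m)) *
          (((2 : ℝ) ^ k) ^ n * ((1 + ‖(2 : ℝ) ^ k • w‖) ^ N)⁻¹))) := by
  obtain ⟨S, hS⟩ := exists_nat_ge |σ|
  choose C hC0 hC using fun p q : ℕ =>
    ha.pieceKer_gain (N + S + 1) N (hψ.tst_fat q) (hψ.tst_base p)
  refine ⟨∑ p ∈ Finset.range 2, ∑ q ∈ Finset.range 2, C p q,
    Finset.sum_nonneg fun p _ => Finset.sum_nonneg fun q _ => hC0 p q, fun j k x w => ?_⟩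
  have hle : C (min j 1) (min k 1) ≤ ∑ p ∈ Finset.range 2, ∑ q ∈ Finset.range 2, C p q := by
    refine le_trans ?_ (Finset.single_le_sum (f := fun p => ∑ q ∈ Finset.range 2, C p q)
      (fun p _ => Finset.sum_nonneg fun q _ => hC0 p q)
      (Finset.mem_range.2 (by omega : min j 1 < 2)))
    exact Finset.single_le_sum (f := fun q => C (min j 1) q) (fun q _ => hC0 _ q)
      (Finset.mem_range.2 (by omega : min k 1 < 2))
  have h1 := hC (min j 1) (min k 1) j k
    (by
      rcases Nat.eq_zero_or_pos k with h | h
      · exact Or.inl h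
      · exact Or.inr (hψ.tst0_fat (by omega)))
    (by
      rcases Nat.eq_zero_or_pos j with h | h
      · exact Or.inl (by omega)
      · exact Or.inr (hψ.tst0_base (by omega))) x w
  rw [← lpBase_min, ← lpFat_min] at h1
  replace h1 := h1.trans (mul_le_mul_of_nonneg_right hle (by positivity))
  set D := ∑ p ∈ Finset.range 2, ∑ q ∈ Finset.range 2, C p q
  have hD : 0 ≤ D := (hC0 _ _).trans hle
  set d := (j - k) + (k - j) with hd
  rw [← pow_add, ← hd] at h1
  set A : ℝ := 2 ^ d with hA
  have hA1 : 1 ≤ A := one_le_pow₀ (by norm_num)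
  have hkj : (2 : ℝ) ^ (k - j) ≤ A := pow_le_pow_right₀ (by norm_num) (by omega)
  have hσ : (2 : ℝ) ^ ((j : ℝ) * σ) ≤ (2 : ℝ) ^ ((k : ℝ) * σ) * A ^ S := by
    rw [hA, ← pow_mul, ← Real.rpow_natCast, ← Real.rpow_add two_pos]
    refine Real.rpow_le_rpow_of_exponent_le (by norm_num) ?_
    have hjk : |(j : ℝ) - k| ≤ d := by
      rcases le_total j k with h | h
      · rw [abs_of_nonpos (by simpa using h), hd]
        push_cast [Nat.sub_eq_zero_of_le h, Nat.cast_sub h]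
        linarith
      · rw [abs_of_nonneg (by simpa using h), hd]
        push_cast [Nat.sub_eq_zero_of_le h, Nat.cast_sub h]
        linarith
    have h3 : ((j : ℝ) - k) * σ ≤ d * S :=
      (le_abs_self _).trans (by rw [abs_mul]; gcongr)
    push_cast
    linarith
  have hm : (2 : ℝ) ^ ((k : ℝ) * (σ + m)) = (2 : ℝ) ^ ((k : ℝ) * σ) * ((2 : ℝ) ^ k) ^ m := by
    rw [mul_add, Real.rpow_add two_pos, ← Real.rpow_natCast 2 k, ← Real.rpow_mul (by norm_num)]
  set W := (1 + ‖(2 : ℝ) ^ k • w‖) ^ N with hW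
  have hW0 : 0 < W := by positivity
  set J := ‖pieceKer (lpBase ψ0 j) (lpFat ψ0 k) a j k x w‖
  have hJ : 0 ≤ J := norm_nonneg _
  have h2 : W * J * A ^ (N + S + 1) ≤ D * (A ^ N * ((2 : ℝ) ^ k) ^ m * ((2 : ℝ) ^ k) ^ n) := by
    refine h1.trans ?_
    gcongr
  have hA0 : 0 < A := by positivity
  rw [hm]
  set P : ℝ := ((2 : ℝ) ^ k) ^ m
  set Q : ℝ := ((2 : ℝ) ^ k) ^ n
  set R : ℝ := (2 : ℝ) ^ ((k : ℝ) * σ)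
  have hR : 0 < R := by positivity
  have h4 : W * J * A ^ (S + 1) ≤ D * (P * Q) := by
    have hAN : 0 < A ^ N := by positivity
    refine le_of_mul_le_mul_right ?_ hAN
    calc _ = W * J * A ^ (N + S + 1) := by rw [pow_add, pow_add, pow_add]; ring
      _ ≤ _ := h2
      _ = _ := by ring
  calc _ ≤ R * A ^ S * J := by gcongr
    _ = (A⁻¹ * W⁻¹ * R) * (W * J * A ^ (S + 1)) := by
        rw [pow_succ]
        field_simp
    _ ≤ (A⁻¹ * W⁻¹ * R) * (D * (P * Q)) := by gcongr
    _ = _ := by ring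

/-- Reduction of the operator to averages of the frequency localised half-wave pieces. -/
lemma SymbolClass.enorm_fio_piece_le {n : ℕ} {m : ℝ} {a : Rn n → Rn n → ℂ}
    (ha : SymbolClass n m a) {ψ0 : Rn n → ℝ} (hψ : IsLPBase n ψ0) (σ : ℝ) (N : ℕ) :
    ∃ C : ℝ≥0, ∀ (f : SchwartzMap (Rn n) ℂ) (j : ℕ) (x : Rn n),
      ENNReal.ofReal ((2 : ℝ) ^ ((j : ℝ) * σ)) *
        ‖smoothOp n (lpPiece n ψ0 j) (fio n a (fun x ξ => ⟪x, ξ⟫_ℝ + ‖ξ‖) f) x‖ₑ ≤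
      C * ∑' k, ((2 : ℝ≥0∞)⁻¹) ^ ((j - k) + (k - j)) *
        wavg k N (fun y => ENNReal.ofReal ((2 : ℝ) ^ ((k : ℝ) * (σ + m))) *
          ‖wavePiece ψ0 f k y‖ₑ) x := by
  obtain ⟨C, hC0, hC⟩ := ha.norm_pieceKer_lp_le hψ σ N
  refine ⟨C.toNNReal, fun f j x => ?_⟩
  refine (mul_le_mul_right (ha.enorm_smoothOp_fio_le hψ f j x) _).trans ?_
  rw [← ENNReal.tsum_mul_left, ← ENNReal.tsum_mul_left]
  refine ENNReal.tsum_le_tsum fun k => ?_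
  unfold wavg
  rw [← lintegral_const_mul' _ _ ENNReal.ofReal_ne_top, ← lintegral_const_mul' _ _ (by finiteness),
    ← lintegral_const_mul' _ _ (by finiteness)]
  refine lintegral_mono fun y => ?_
  have h := ENNReal.ofReal_le_ofReal (hC j k x (x - y))
  rw [ENNReal.ofReal_mul (by positivity), ENNReal.ofReal_mul hC0,
    ENNReal.ofReal_mul (by positivity), ENNReal.ofReal_mul (by positivity), ofReal_norm,
    ENNReal.ofReal_inv_of_pos (by positivity), ENNReal.ofReal_pow (by norm_num),
    ENNReal.ofReal_ofNat] at h
  calc _ = ENNReal.ofReal (2 ^ ((j : ℝ) * σ)) *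
        ‖pieceKer (lpBase ψ0 j) (lpFat ψ0 k) a j k x (x - y)‖ₑ * ‖wavePiece ψ0 f k y‖ₑ := by
        ring
    _ ≤ _ := mul_le_mul_left h _
    _ = _ := by
      rw [ENNReal.inv_pow, wtE, ENNReal.ofReal]
      ring

lemma continuous_wt_aux {n : ℕ} (k N : ℕ) : Continuous (fun x : Rn n =>
    ((2 : ℝ) ^ k) ^ n * ((1 + ‖(2 : ℝ) ^ k • x‖) ^ N)⁻¹) := by
  refine continuous_const.mul (Continuous.inv₀ (by fun_prop) fun x => ?_)
  exact (by positivity : (0 : ℝ) < (1 + ‖(2 : ℝ) ^ k • x‖) ^ N).ne'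

lemma measurable_wtE {n : ℕ} (k N : ℕ) : Measurable (wtE (n := n) k N) :=
  (continuous_wt_aux k N).measurable.ennreal_ofReal

lemma wtE_neg {n : ℕ} (k N : ℕ) (x : Rn n) : wtE k N (-x) = wtE k N x := by
  unfold wtE
  rw [smul_neg, norm_neg]

lemma wtE_sub_comm {n : ℕ} (k N : ℕ) (x y : Rn n) : wtE k N (x - y) = wtE k N (y - x) := by
  rw [← wtE_neg, neg_sub]

lemma wtE_anti {n : ℕ} (k : ℕ) {N N' : ℕ} (h : N ≤ N') (x : Rn n) :
    wtE k N' x ≤ wtE k N x := by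
  unfold wtE
  gcongr
  linarith [norm_nonneg ((2 : ℝ) ^ k • x)]

lemma measurable_wavg {n : ℕ} (k N : ℕ) {H : Rn n → ℝ≥0∞} (hH : Measurable H) :
    Measurable (wavg k N H) := by
  unfold wavg
  refine Measurable.lintegral_prod_right' (f := fun p : Rn n × Rn n => wtE k N (p.1 - p.2) * H p.2)
    ?_
  exact ((measurable_wtE k N).comp (measurable_fst.sub measurable_snd)).mul
    (hH.comp measurable_snd)

lemma wavg_mono {n : ℕ} (k N : ℕ) {H H' : Rn n → ℝ≥0∞} (h : ∀ x, H x ≤ H' x) (x : Rn n) :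
    wavg k N H x ≤ wavg k N H' x :=
  lintegral_mono fun y => mul_le_mul_right (h y) _

/-- The common mass of the weights `wtE k (n + 1)`. -/
def wtMass (n : ℕ) : ℝ≥0∞ := ∫⁻ x : Rn n, wtE 0 (n + 1) x

lemma wtMass_ne_top (n : ℕ) : wtMass n ≠ ∞ := by
  have h := (integrable_inv_one_add_norm_pow n).lintegral_lt_top
  unfold wtMass wtE
  simpa using h.ne

lemma lintegral_comp_smul' {n : ℕ} (F : Rn n → ℝ≥0∞) (hF : Measurable F) {r : ℝ} (hr : 0 < r) :
    ∫⁻ x, F (r • x) = ENNReal.ofReal ((r ^ n)⁻¹) * ∫⁻ x, F x := by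
  have h1 := lintegral_map hF (measurable_const_smul r (α := Rn n)) (μ := volume)
  rw [Measure.map_addHaar_smul volume hr.ne', lintegral_smul_measure,
    finrank_euclideanSpace_fin, abs_of_pos (by positivity)] at h1
  exact h1.symm

lemma lintegral_wtE {n : ℕ} (k : ℕ) : ∫⁻ x : Rn n, wtE k (n + 1) x = wtMass n := by
  have hk : (0 : ℝ) < 2 ^ k := by positivity
  have h1 : ∀ x : Rn n, wtE k (n + 1) x =
      ENNReal.ofReal (((2 : ℝ) ^ k) ^ n) * wtE 0 (n + 1) ((2 : ℝ) ^ k • x) := fun x => by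
    unfold wtE
    rw [← ENNReal.ofReal_mul (by positivity)]
    simp
  simp only [h1]
  rw [lintegral_const_mul' _ _ ENNReal.ofReal_ne_top,
    lintegral_comp_smul' _ (measurable_wtE 0 (n + 1)) hk, ← mul_assoc,
    ← ENNReal.ofReal_mul (by positivity), mul_inv_cancel₀ (by positivity), ENNReal.ofReal_one,
    one_mul]
  rfl

lemma lintegral_wtE_sub_left {n : ℕ} (k : ℕ) (x : Rn n) :
    ∫⁻ y : Rn n, wtE k (n + 1) (x - y) = wtMass n := by
  rw [lintegral_sub_left_eq_self (fun y => wtE k (n + 1) y) x, lintegral_wtE]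

/-- The averaging operators are symmetric. -/
lemma lintegral_mul_wavg {n : ℕ} (k N : ℕ) {F H : Rn n → ℝ≥0∞} (hF : Measurable F)
    (hH : Measurable H) : ∫⁻ x, F x * wavg k N H x = ∫⁻ x, wavg k N F x * H x := by
  unfold wavg
  have hw : Measurable fun p : Rn n × Rn n => wtE k N (p.1 - p.2) :=
    (measurable_wtE k N).comp (measurable_fst.sub measurable_snd)
  have e1 : ∀ x, F x * ∫⁻ y, wtE k N (x - y) * H y = ∫⁻ y, F x * (wtE k N (x - y) * H y) :=
    fun x => (lintegral_const_mul _ (((measurable_wtE k N).comp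
      (measurable_const.sub measurable_id)).mul hH)).symm
  have e2 : ∀ y, (∫⁻ x, wtE k N (y - x) * F x) * H y = ∫⁻ x, F x * (wtE k N (x - y) * H y) := by
    intro y
    have hm : Measurable fun x => wtE k N (y - x) * F x :=
      ((measurable_wtE k N).comp (measurable_const.sub measurable_id)).mul hF
    rw [← lintegral_mul_const _ hm]
    refine lintegral_congr fun x => ?_
    rw [wtE_sub_comm]
    ring
  simp only [e1, e2]
  exact lintegral_lintegral_swap ((hF.comp measurable_fst).mul
    (hw.mul (hH.comp measurable_snd))).aemeasurable

lemma lintegral_wavg {n : ℕ} (k : ℕ) {H : Rn n → ℝ≥0∞} (hH : Measurable H) :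
    ∫⁻ x, wavg k (n + 1) H x = wtMass n * ∫⁻ x, H x := by
  have h := lintegral_mul_wavg k (n + 1) (F := fun _ : Rn n => 1) measurable_const hH
  simp only [one_mul] at h
  rw [h]
  have : ∀ x : Rn n, wavg k (n + 1) (fun _ => 1) x = wtMass n := fun x => by
    unfold wavg
    simp only [mul_one]
    exact lintegral_wtE_sub_left k x
  simp only [this]
  exact lintegral_const_mul _ hH

lemma lintegral_mul_sq_le {n : ℕ} {F G : Rn n → ℝ≥0∞} (hF : Measurable F) (hG : Measurable G) :
    (∫⁻ x, F x * G x) ^ 2 ≤ (∫⁻ x, F x ^ 2) * ∫⁻ x, G x ^ 2 := by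
  have h := ENNReal.lintegral_mul_le_Lp_mul_Lq (volume : Measure (Rn n))
    (Real.HolderConjugate.two_two) hF.aemeasurable hG.aemeasurable
  simp only [Pi.mul_apply, ENNReal.rpow_two] at h
  calc _ ≤ ((∫⁻ x, F x ^ 2) ^ (1 / (2 : ℝ)) * (∫⁻ x, G x ^ 2) ^ (1 / (2 : ℝ))) ^ 2 := by gcongr
    _ = _ := by
      rw [mul_pow, ← ENNReal.rpow_two, ← ENNReal.rpow_two, ← ENNReal.rpow_mul, ← ENNReal.rpow_mul]
      norm_num

/-- Jensen's inequality for the averages. -/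
lemma wavg_sq_le {n : ℕ} (k : ℕ) {H : Rn n → ℝ≥0∞} (hH : Measurable H) (x : Rn n) :
    wavg k (n + 1) H x ^ 2 ≤ wtMass n * wavg k (n + 1) (fun y => H y ^ 2) x := by
  have hw : Measurable fun y : Rn n => wtE k (n + 1) (x - y) :=
    (measurable_wtE k _).comp (measurable_const.sub measurable_id)
  have h := lintegral_mul_sq_le (F := fun y : Rn n => wtE k (n + 1) (x - y) ^ (1 / (2 : ℝ)))
    (G := fun y => wtE k (n + 1) (x - y) ^ (1 / (2 : ℝ)) * H y) (hw.pow_const _)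
    ((hw.pow_const _).mul hH)
  have e : ∀ y : Rn n, (wtE k (n + 1) (x - y) ^ (1 / (2 : ℝ))) ^ 2 = wtE k (n + 1) (x - y) := by
    intro y
    rw [← ENNReal.rpow_two, ← ENNReal.rpow_mul]
    norm_num
  simp only [← mul_assoc, mul_pow, ← pow_two, e] at h
  rw [lintegral_wtE_sub_left] at h
  exact h

lemma inv_pow_le_mul_inv_pow {c d K : ℝ} (N : ℕ) (hc : 0 < c) (hd : 0 < d) (h : d ≤ K * c) :
    (c ^ N)⁻¹ ≤ K ^ N * (d ^ N)⁻¹ := by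
  rw [inv_le_iff_one_le_mul₀ (by positivity), mul_right_comm, ← div_eq_mul_inv,
    one_le_div (by positivity), ← mul_pow]
  gcongr

lemma weight_mul_le (n : ℕ) {t T a b c : ℝ} (ht : 0 < t) (hT : t ≤ T) (ha : 0 ≤ a) (hb : 0 ≤ b)
    (hc : 0 ≤ c) (h : a ≤ b + c) :
    T ^ n * ((1 + T * c) ^ (n + 1))⁻¹ * (t ^ n * ((1 + t * b) ^ (n + 1))⁻¹) ≤
      4 ^ (n + 1) * (t ^ n * ((1 + t * a) ^ (n + 1))⁻¹) *
        (T ^ n * ((1 + T * c) ^ (n + 1))⁻¹ + t ^ n * ((1 + t * b) ^ (n + 1))⁻¹) := by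
  have hT0 : 0 < T := ht.trans_le hT
  have key : ∀ s p q : ℝ, 0 < s → 0 ≤ q → 0 ≤ p → 1 + s * p ≤ 4 * (1 + s * q) →
      s ^ n * ((1 + s * q) ^ (n + 1))⁻¹ ≤ 4 ^ (n + 1) * (s ^ n * ((1 + s * p) ^ (n + 1))⁻¹) := by
    intro s p q hs hq hp hle
    have h1 : ((1 + s * q) ^ (n + 1))⁻¹ ≤ 4 ^ (n + 1) * ((1 + s * p) ^ (n + 1))⁻¹ := 
      inv_pow_le_mul_inv_pow _ (by positivity) (by positivity) hle
    calc _ ≤ s ^ n * (4 ^ (n + 1) * ((1 + s * p) ^ (n + 1))⁻¹) := by gcongr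
      _ = _ := by ring
  set A := t ^ n * ((1 + t * a) ^ (n + 1))⁻¹ with hA
  set B := t ^ n * ((1 + t * b) ^ (n + 1))⁻¹ with hB
  set D := T ^ n * ((1 + T * c) ^ (n + 1))⁻¹ with hD
  have hA0 : 0 ≤ A := by positivity
  have hB0 : 0 ≤ B := by positivity
  have hD0 : 0 ≤ D := by positivity
  by_cases h1 : 1 + t * a ≤ 4 * (1 + t * b)
  · have h2 := key t a b ht hb ha h1
    calc D * B ≤ D * (4 ^ (n + 1) * A) := by gcongr
      _ ≤ 4 ^ (n + 1) * A * (D + B) := by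
        have : 0 ≤ 4 ^ (n + 1) * A * B := by positivity
        nlinarith
  · push Not at h1
    have h3 : T * a ≤ 2 * (1 + T * c) := by
      have : t * b ≤ t * a / 4 := by nlinarith
      have : b ≤ a / 4 := by
        have h5 : t * b ≤ t * (a / 4) := by linarith
        exact le_of_mul_le_mul_left h5 ht
      have h4 : a / 2 ≤ c := by linarith
      nlinarith
    have h6 : 1 ≤ t * a := by nlinarith [mul_nonneg ht.le hb]
    have ha0 : 0 < a := by
      rcases ha.eq_or_lt with h | h
      · rw [← h] at h6; norm_num at h6
      · exact h
    have h7 : D ≤ 4 ^ (n + 1) * A := by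
      have e1 : D ≤ T ^ n * (2 ^ (n + 1) * ((T * a) ^ (n + 1))⁻¹) := by
        rw [hD]
        gcongr
        exact inv_pow_le_mul_inv_pow _ (by positivity) (by positivity) h3
      have e2 : T ^ n * (2 ^ (n + 1) * ((T * a) ^ (n + 1))⁻¹) ≤
          t ^ n * (2 ^ (n + 1) * ((t * a) ^ (n + 1))⁻¹) := by
        have : ∀ s : ℝ, 0 < s → s ^ n * (2 ^ (n + 1) * ((s * a) ^ (n + 1))⁻¹) =
            s⁻¹ * (2 ^ (n + 1) * (a ^ (n + 1))⁻¹) := by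
          intro s hs
          field_simp
          ring
        rw [this T hT0, this t ht]
        gcongr
      have e3 : t ^ n * (2 ^ (n + 1) * ((t * a) ^ (n + 1))⁻¹) ≤ 4 ^ (n + 1) * A := by
        rw [hA, mul_left_comm (4 ^ (n + 1))]
        have : (4 : ℝ) ^ (n + 1) = 2 ^ (n + 1) * 2 ^ (n + 1) := by rw [← mul_pow]; norm_num
        rw [this, mul_assoc]
        gcongr
        exact inv_pow_le_mul_inv_pow _ (by positivity) (by positivity) (by linarith)
      linarith
    calc D * B ≤ (4 ^ (n + 1) * A) * B := by gcongr
      _ ≤ 4 ^ (n + 1) * A * (D + B) := by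
        have : 0 ≤ 4 ^ (n + 1) * A * D := by positivity
        nlinarith

lemma wtE_mul_le {n : ℕ} {k l : ℕ} (hkl : l ≤ k) (x y : Rn n) :
    wtE k (n + 1) (x - y) * wtE l (n + 1) y ≤
      ENNReal.ofReal (4 ^ (n + 1)) * wtE l (n + 1) x *
        (wtE k (n + 1) (x - y) + wtE l (n + 1) y) := by
  have h := weight_mul_le n (t := 2 ^ l) (T := 2 ^ k) (a := ‖x‖) (b := ‖y‖) (c := ‖x - y‖)
    (by positivity) (pow_le_pow_right₀ (by norm_num) hkl) (norm_nonneg _) (norm_nonneg _)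
    (norm_nonneg _) (by simpa using norm_add_le y (x - y))
  unfold wtE
  simp only [norm_smul, norm_pow, RCLike.norm_ofNat]
  rw [← ENNReal.ofReal_add (by positivity) (by positivity), ← ENNReal.ofReal_mul (by positivity),
    ← ENNReal.ofReal_mul (by positivity), ← ENNReal.ofReal_mul (by positivity)]
  exact ENNReal.ofReal_le_ofReal h

/-- The constant in the convolution inequality for the weights. -/
def wtConv (n : ℕ) : ℝ≥0∞ := ENNReal.ofReal (4 ^ (n + 1)) * (2 * wtMass n)

lemma wtConv_ne_top (n : ℕ) : wtConv n ≠ ∞ :=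
  ENNReal.mul_ne_top ENNReal.ofReal_ne_top (ENNReal.mul_ne_top (by norm_num) (wtMass_ne_top n))

lemma lintegral_wtE_mul_le {n : ℕ} (k l : ℕ) (x : Rn n) :
    ∫⁻ y, wtE k (n + 1) (x - y) * wtE l (n + 1) y ≤ wtConv n * wtE (min k l) (n + 1) x := by
  wlog hkl : l ≤ k generalizing k l
  · have := this l k (by omega)
    rw [min_comm] at this
    refine le_trans (le_of_eq ?_) this
    rw [← lintegral_sub_left_eq_self (fun y => wtE k (n + 1) (x - y) * wtE l (n + 1) y) x]
    refine lintegral_congr fun y => ?_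
    rw [sub_sub_cancel, mul_comm]
  rw [min_eq_right hkl]
  calc _ ≤ ∫⁻ y, ENNReal.ofReal (4 ^ (n + 1)) * wtE l (n + 1) x *
        (wtE k (n + 1) (x - y) + wtE l (n + 1) y) := lintegral_mono fun y => wtE_mul_le hkl x y
    _ = _ := by
      rw [lintegral_const_mul' _ _ (ENNReal.mul_ne_top ENNReal.ofReal_ne_top
        (show wtE l (n + 1) x ≠ ∞ from ENNReal.ofReal_ne_top)), lintegral_add_right _ (measurable_wtE l (n + 1)),
        lintegral_wtE_sub_left, lintegral_wtE, wtConv]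
      ring

lemma wavg_wavg_le {n : ℕ} (k l : ℕ) {H : Rn n → ℝ≥0∞} (hH : Measurable H) (x : Rn n) :
    wavg k (n + 1) (wavg l (n + 1) H) x ≤ wtConv n * wavg (min k l) (n + 1) H x := by
  have hw : ∀ k, Measurable (wtE (n := n) k (n + 1)) := fun k => measurable_wtE k (n + 1)
  have e1 : ∀ y, wtE k (n + 1) (x - y) * ∫⁻ z, wtE l (n + 1) (y - z) * H z =
      ∫⁻ z, wtE k (n + 1) (x - y) * (wtE l (n + 1) (y - z) * H z) := fun y =>
    (lintegral_const_mul' _ _ ENNReal.ofReal_ne_top).symm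
  unfold wavg
  simp only [e1]
  have hm : Measurable (Function.uncurry fun y z : Rn n =>
      wtE k (n + 1) (x - y) * (wtE l (n + 1) (y - z) * H z)) :=
    ((hw k).comp (measurable_const.sub measurable_fst)).mul
      (((hw l).comp (measurable_fst.sub measurable_snd)).mul (hH.comp measurable_snd))
  rw [lintegral_lintegral_swap hm.aemeasurable,
    ← lintegral_const_mul' _ _ (wtConv_ne_top n)]
  refine lintegral_mono fun z => ?_
  have hm' : Measurable fun y : Rn n => wtE k (n + 1) (x - y) * wtE l (n + 1) (y - z) :=
    ((hw k).comp (measurable_const.sub measurable_id)).mul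
      ((hw l).comp (measurable_id.sub measurable_const))
  calc _ = (∫⁻ y, wtE k (n + 1) (x - y) * wtE l (n + 1) (y - z)) * H z := by
        rw [← lintegral_mul_const _ hm']
        simp only [mul_assoc]
    _ = (∫⁻ y, wtE k (n + 1) (x - z - y) * wtE l (n + 1) y) * H z := by
        rw [← lintegral_add_right_eq_self _ z]
        simp only [add_sub_cancel_right]
        congr 2
        ext y
        rw [show x - (y + z) = x - z - y by abel]
    _ ≤ wtConv n * wtE (min k l) (n + 1) (x - z) * H z := by
        gcongr
        exact lintegral_wtE_mul_le k l _
    _ = _ := mul_assoc _ _ _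

lemma measurable_range_sup_ennreal {α : Type*} [MeasurableSpace α] {v : ℕ → α → ℝ≥0∞}
    (hv : ∀ k, Measurable (v k)) (K : ℕ) :
    Measurable fun x => (Finset.range K).sup (fun k => v k x) := by
  induction K with
  | zero => simp
  | succ K ih =>
    simp only [Finset.range_add_one, Finset.sup_insert]
    exact (hv K).sup ih

lemma exists_argmax_decomposition {α : Type*} [MeasurableSpace α] {v : ℕ → α → ℝ≥0∞}
    (hv : ∀ k, Measurable (v k)) (K : ℕ) : ∃ w : ℕ → α → ℝ≥0∞, (∀ k, Measurable (w k)) ∧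
      ∀ x, ∑ k ∈ Finset.range K, w k x = (Finset.range K).sup (fun k => v k x) ∧
        ∑ k ∈ Finset.range K, w k x * v k x = (Finset.range K).sup (fun k => v k x) ^ 2 ∧
        ∀ k, w k x ≤ v k x := by
  induction K with
  | zero => exact ⟨fun _ _ => 0, fun _ => measurable_const, fun x => by simp⟩
  | succ K ih =>
    obtain ⟨w, hw, h⟩ := ih
    have hs : Measurable fun x => (Finset.range K).sup (fun k => v k x) :=
      measurable_range_sup_ennreal hv K
    have hA : MeasurableSet {x | (Finset.range K).sup (fun k => v k x) < v K x} :=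
      measurableSet_lt hs (hv K)
    refine ⟨fun k x => if (Finset.range K).sup (fun k => v k x) < v K x then
        (if k = K then v K x else 0) else (if k = K then 0 else w k x), fun k => ?_, fun x => ?_⟩
    · refine Measurable.ite hA ?_ ?_
      · by_cases hk : k = K <;> simp [hk, hv]
      · by_cases hk : k = K <;> simp [hk, hw]
    · have hne : ∀ k ∈ Finset.range K, k ≠ K := fun k hk => (Finset.mem_range.1 hk).ne
      have hsup : (Finset.range (K + 1)).sup (fun k => v k x) =
          v K x ⊔ (Finset.range K).sup (fun k => v k x) := by
        rw [Finset.range_add_one, Finset.sup_insert]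
      rw [hsup, Finset.sum_range_succ, Finset.sum_range_succ]
      by_cases hlt : (Finset.range K).sup (fun k => v k x) < v K x
      · simp only [hlt, if_true]
        rw [sup_eq_left.2 hlt.le, Finset.sum_eq_zero fun k hk => if_neg (hne k hk),
          Finset.sum_eq_zero fun k hk => by rw [if_neg (hne k hk), zero_mul]]
        refine ⟨by simp, by simp [pow_two], fun k => ?_⟩
        by_cases hk : k = K <;> simp [hk]
      · simp only [hlt, if_false]
        have e1 : ∑ k ∈ Finset.range K, (if k = K then 0 else w k x) =
            ∑ k ∈ Finset.range K, w k x := Finset.sum_congr rfl fun k hk => if_neg (hne k hk)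
        have e2 : ∑ k ∈ Finset.range K, (if k = K then 0 else w k x) * v k x =
            ∑ k ∈ Finset.range K, w k x * v k x :=
          Finset.sum_congr rfl fun k hk => by rw [if_neg (hne k hk)]
        rw [sup_eq_right.2 (not_lt.1 hlt), e1, e2, (h x).1, (h x).2.1]
        refine ⟨by simp, by simp, fun k => ?_⟩
        by_cases hk : k = K <;> simp [hk, (h x).2.2]

lemma lintegral_wavg_sq_le {n : ℕ} (k : ℕ) {H : Rn n → ℝ≥0∞} (hH : Measurable H) :
    ∫⁻ x, wavg k (n + 1) H x ^ 2 ≤ wtMass n ^ 2 * ∫⁻ x, H x ^ 2 := by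
  calc _ ≤ ∫⁻ x, wtMass n * wavg k (n + 1) (fun y => H y ^ 2) x :=
        lintegral_mono fun x => wavg_sq_le k hH x
    _ = _ := by
      rw [lintegral_const_mul' _ _ (wtMass_ne_top n), lintegral_wavg k (hH.pow_const 2)]
      ring

/-- The dyadic maximal function with respect to the weights `wtE`. -/
def wmax {n : ℕ} (H : Rn n → ℝ≥0∞) (x : Rn n) : ℝ≥0∞ := ⨆ k, wavg k (n + 1) H x

lemma measurable_wmax {n : ℕ} {H : Rn n → ℝ≥0∞} (hH : Measurable H) : Measurable (wmax H) :=
  Measurable.iSup fun k => measurable_wavg k _ hH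

lemma ENNReal.le_of_sq_le_mul {X Y : ℝ≥0∞} (hX : X ≠ ∞) (h : X ^ 2 ≤ X * Y) : X ≤ Y := by
  rcases eq_or_ne X 0 with h0 | h0
  · rw [h0]; exact zero_le
  · rw [pow_two] at h
    exact (ENNReal.mul_le_mul_iff_right h0 hX).1 h

lemma lintegral_finite_max_sq_le {n : ℕ} {H : Rn n → ℝ≥0∞} (hH : Measurable H) (K : ℕ) :
    ∫⁻ x, (Finset.range K).sup (fun k => wavg k (n + 1) H x) ^ 2 ≤
      (2 * wtConv n) ^ 2 * ∫⁻ x, H x ^ 2 := by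
  set g : Rn n → ℝ≥0∞ := fun x => (Finset.range K).sup (fun k => wavg k (n + 1) H x) with hg
  obtain ⟨w, hw, hsum⟩ := exists_argmax_decomposition
    (v := fun k => wavg k (n + 1) H) (fun k => measurable_wavg k _ hH) K
  have hgm : Measurable g := measurable_range_sup_ennreal (fun k => measurable_wavg k _ hH) K
  set G : Rn n → ℝ≥0∞ := fun x => ∑ k ∈ Finset.range K, wavg k (n + 1) (w k) x with hG
  have hwm : ∀ k, Measurable (wavg k (n + 1) (w k)) := fun k => measurable_wavg k _ (hw k)
  have hGm : Measurable G := Finset.measurable_fun_sum _ fun k _ => hwm k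
  by_cases hZ : ∫⁻ x, H x ^ 2 = ∞
  · rw [hZ]
    by_cases hc : wtConv n = 0
    · have h0 : ∀ k, ∀ x : Rn n, wtE k (n + 1) x = 0 := by
        intro k x
        rw [wtConv] at hc
        have : wtMass n = 0 := by
          rcases mul_eq_zero.1 hc with h | h
          · exact absurd h (by simp)
          · simpa using h
        rw [← lintegral_wtE k] at this
        exfalso
        have h1 : ∀ y : Rn n, 0 < wtE k (n + 1) y := fun y => by
          unfold wtE
          exact ENNReal.ofReal_pos.2 (by positivity)
        rw [lintegral_eq_zero_iff (measurable_wtE k _)] at this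
        obtain ⟨y, hy⟩ := this.exists
        exact (h1 y).ne' hy
      simp [wavg, h0, hc]
    · rw [ENNReal.mul_top (by simpa using hc)]
      exact le_top
  have hY : ∫⁻ x, g x ^ 2 ≠ ∞ := by
    refine ne_top_of_le_ne_top (b := ∑ k ∈ Finset.range K, wtMass n ^ 2 * ∫⁻ x, H x ^ 2)
      (ENNReal.sum_ne_top.2 fun k _ => ENNReal.mul_ne_top (ENNReal.pow_ne_top (wtMass_ne_top n)) hZ)
      ?_
    calc _ ≤ ∫⁻ x, ∑ k ∈ Finset.range K, wavg k (n + 1) H x ^ 2 := by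
          refine lintegral_mono fun x => ?_
          rw [← (hsum x).2.1]
          gcongr with k hk
          rw [pow_two]
          gcongr
          exact (hsum x).2.2 k
      _ ≤ _ := by
        rw [lintegral_finsetSum _ fun k _ => (measurable_wavg k _ hH).pow_const 2]
        gcongr
        exact lintegral_wavg_sq_le _ hH
  have hYH : ∫⁻ x, g x ^ 2 = ∫⁻ x, G x * H x := by
    simp only [hG, hg, ← (hsum _).2.1, Finset.sum_mul]
    rw [lintegral_finsetSum _ fun k _ => (hw k).fun_mul (measurable_wavg k _ hH),
      lintegral_finsetSum _ fun k _ => (hwm k).fun_mul hH]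
    exact Finset.sum_congr rfl fun k _ => lintegral_mul_wavg k _ (hw k) hH
  have hw2 : ∀ k ∈ Finset.range K, ∫⁻ x, w k x ^ 2 ≤ ∫⁻ x, g x ^ 2 := fun k hk => by
    refine lintegral_mono fun x => ?_
    gcongr
    rw [hg]
    simp only
    rw [← (hsum x).1]
    exact Finset.single_le_sum (f := fun k => w k x) (fun _ _ => zero_le) hk
  have hXe : ∫⁻ x, G x ^ 2 = ∑ k ∈ Finset.range K, ∑ l ∈ Finset.range K,
      ∫⁻ x, wavg k (n + 1) (w k) x * wavg l (n + 1) (w l) x := by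
    simp only [hG, pow_two, Finset.sum_mul_sum]
    rw [lintegral_finsetSum _ fun k _ => Finset.measurable_fun_sum _ fun l _ =>
      (hwm k).fun_mul (hwm l)]
    refine Finset.sum_congr rfl fun k _ => ?_
    rw [lintegral_finsetSum _ fun l _ => (hwm k).fun_mul (hwm l)]
  have hX : ∫⁻ x, G x ^ 2 ≠ ∞ := by
    rw [hXe]
    refine ENNReal.sum_ne_top.2 fun k hk => ENNReal.sum_ne_top.2 fun l hl => ?_
    have h1 := lintegral_mul_sq_le (hwm k) (hwm l)
    have h2 : ∀ k ∈ Finset.range K, ∫⁻ x, wavg k (n + 1) (w k) x ^ 2 ≠ ∞ := fun k hk =>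
      ne_top_of_le_ne_top (ENNReal.mul_ne_top (ENNReal.pow_ne_top (wtMass_ne_top n))
        (ne_top_of_le_ne_top hY (hw2 k hk))) (lintegral_wavg_sq_le k (hw k))
    have h3 := ne_top_of_le_ne_top (ENNReal.mul_ne_top (h2 k hk) (h2 l hl)) h1
    intro h4
    simp [h4] at h3
  have hXG : ∫⁻ x, G x ^ 2 ≤ 2 * wtConv n * ∫⁻ x, G x * g x := by
    have e1 : ∀ k l, ∫⁻ x, wavg k (n + 1) (w k) x * wavg l (n + 1) (w l) x ≤
        wtConv n * ((∫⁻ x, wavg k (n + 1) (w k) x * w l x) + ∫⁻ x, wavg l (n + 1) (w l) x * w k x) := by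
      intro k l
      calc _ = ∫⁻ x, w k x * wavg k (n + 1) (wavg l (n + 1) (w l)) x :=
            (lintegral_mul_wavg k _ (hw k) (hwm l)).symm
        _ ≤ ∫⁻ x, wtConv n * (w k x * wavg (min k l) (n + 1) (w l) x) := by
            refine lintegral_mono fun x => ?_
            rw [mul_left_comm]
            gcongr
            exact wavg_wavg_le k l (hw l) x
        _ = wtConv n * ∫⁻ x, w k x * wavg (min k l) (n + 1) (w l) x :=
            lintegral_const_mul' _ _ (wtConv_ne_top n)
        _ ≤ _ := by
            refine mul_le_mul_right ?_ _
            rcases le_total k l with h | h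
            · rw [min_eq_left h, lintegral_mul_wavg k _ (hw k) (hw l)]
              exact le_self_add
            · rw [min_eq_right h]
              simp only [mul_comm (w k _)]
              exact le_add_self
    have e2 : ∫⁻ x, G x * g x = ∑ k ∈ Finset.range K, ∑ l ∈ Finset.range K,
        ∫⁻ x, wavg k (n + 1) (w k) x * w l x := by
      simp only [hG, hg, ← (hsum _).1, Finset.sum_mul_sum]
      rw [lintegral_finsetSum _ fun k _ => Finset.measurable_fun_sum _ fun l _ =>
        (hwm k).fun_mul (hw l)]
      refine Finset.sum_congr rfl fun k _ => ?_
      rw [lintegral_finsetSum _ fun l _ => (hwm k).fun_mul (hw l)]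
    rw [hXe]
    calc _ ≤ ∑ k ∈ Finset.range K, ∑ l ∈ Finset.range K, wtConv n *
        ((∫⁻ x, wavg k (n + 1) (w k) x * w l x) + ∫⁻ x, wavg l (n + 1) (w l) x * w k x) := by
          gcongr with k _ l _
          exact e1 k l
      _ = _ := by
        simp only [← Finset.mul_sum, Finset.sum_add_distrib]
        rw [e2, Finset.sum_comm (f := fun k l => ∫⁻ x, wavg l (n + 1) (w l) x * w k x)]
        ring
  have h1 : ∫⁻ x, G x ^ 2 ≤ (2 * wtConv n) ^ 2 * ∫⁻ x, g x ^ 2 := by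
    refine ENNReal.le_of_sq_le_mul hX ?_
    calc _ ≤ (2 * wtConv n * ∫⁻ x, G x * g x) ^ 2 := by gcongr
      _ = (2 * wtConv n) ^ 2 * (∫⁻ x, G x * g x) ^ 2 := mul_pow _ _ _
      _ ≤ (2 * wtConv n) ^ 2 * ((∫⁻ x, G x ^ 2) * ∫⁻ x, g x ^ 2) := by
        gcongr
        exact lintegral_mul_sq_le hGm hgm
      _ = _ := by ring
  refine ENNReal.le_of_sq_le_mul hY ?_
  calc _ = (∫⁻ x, G x * H x) ^ 2 := by rw [hYH]
    _ ≤ (∫⁻ x, G x ^ 2) * ∫⁻ x, H x ^ 2 := lintegral_mul_sq_le hGm hH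
    _ ≤ ((2 * wtConv n) ^ 2 * ∫⁻ x, g x ^ 2) * ∫⁻ x, H x ^ 2 := by gcongr
    _ = _ := by ring

/-- The maximal theorem on `L²`. -/
lemma lintegral_wmax_sq_le {n : ℕ} {H : Rn n → ℝ≥0∞} (hH : Measurable H) :
    ∫⁻ x, wmax H x ^ 2 ≤ (2 * wtConv n) ^ 2 * ∫⁻ x, H x ^ 2 := by
  have hmono : ∀ x, Monotone fun K => (Finset.range K).sup (fun k => wavg k (n + 1) H x) :=
    fun x K L h => Finset.sup_mono (Finset.range_mono h)
  have h1 : ∀ x, wmax H x ^ 2 =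
      ⨆ K, (Finset.range K).sup (fun k => wavg k (n + 1) H x) ^ 2 := by
    intro x
    have e : wmax H x = ⨆ K, (Finset.range K).sup (fun k => wavg k (n + 1) H x) := by
      refine le_antisymm (iSup_le fun k => ?_) (iSup_le fun K => Finset.sup_le fun k _ =>
        le_iSup (fun k => wavg k (n + 1) H x) k)
      exact le_iSup_of_le (k + 1)
        (Finset.le_sup (f := fun k => wavg k (n + 1) H x) (Finset.self_mem_range_succ k))
    rw [e]
    exact Monotone.map_iSup_of_continuousAt (f := fun t : ℝ≥0∞ => t ^ 2)
      (ENNReal.continuous_pow 2).continuousAt (fun a b h => by simp only; gcongr) (by simp)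
  simp only [h1]
  rw [lintegral_iSup (fun K => (measurable_range_sup_ennreal
    (fun k => measurable_wavg k (n + 1) hH) K).pow_const 2) (fun K L h x => by
      have := hmono x h
      simp only at this ⊢
      gcongr)]
  exact iSup_le fun K => lintegral_finite_max_sq_le hH K

lemma tsum_mul_sq_le (F G : ℕ → ℝ≥0∞) :
    (∑' i, F i * G i) ^ 2 ≤ (∑' i, F i ^ 2) * ∑' i, G i ^ 2 := by
  have h := ENNReal.lintegral_mul_le_Lp_mul_Lq (Measure.count : Measure ℕ)
    (Real.HolderConjugate.two_two) (Measurable.of_discrete (f := F)).aemeasurable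
    (Measurable.of_discrete (f := G)).aemeasurable
  simp only [Pi.mul_apply, ENNReal.rpow_two, lintegral_count] at h
  calc _ ≤ ((∑' i, F i ^ 2) ^ (1 / (2 : ℝ)) * (∑' i, G i ^ 2) ^ (1 / (2 : ℝ))) ^ 2 := by gcongr
    _ = _ := by
      rw [mul_pow, ← ENNReal.rpow_two, ← ENNReal.rpow_two, ← ENNReal.rpow_mul, ← ENNReal.rpow_mul]
      norm_num

lemma wavg_tsum {n : ℕ} (k N : ℕ) {H : ℕ → Rn n → ℝ≥0∞} (hH : ∀ i, Measurable (H i)) (x : Rn n) :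
    wavg k N (fun y => ∑' i, H i y) x = ∑' i, wavg k N (H i) x := by
  unfold wavg
  simp only [← ENNReal.tsum_mul_left]
  exact lintegral_tsum fun i => (((measurable_wtE k N).comp
    (measurable_const.sub measurable_id)).mul (hH i)).aemeasurable

lemma wavg_const_mul {n : ℕ} (k N : ℕ) {c : ℝ≥0∞} (hc : c ≠ ∞) (H : Rn n → ℝ≥0∞) (x : Rn n) :
    wavg k N (fun y => c * H y) x = c * wavg k N H x := by
  unfold wavg
  rw [← lintegral_const_mul' _ _ hc]
  exact lintegral_congr fun y => mul_left_comm _ _ _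

/-- The iterates of the maximal function, normalised to be uniformly bounded on `L²`. -/
def wmaxIter {n : ℕ} (H : Rn n → ℝ≥0∞) : ℕ → Rn n → ℝ≥0∞
  | 0 => H
  | i + 1 => fun x => (2 * wtConv n + 1)⁻¹ * wmax (wmaxIter H i) x

lemma measurable_wmaxIter {n : ℕ} {H : Rn n → ℝ≥0∞} (hH : Measurable H) (i : ℕ) :
    Measurable (wmaxIter H i) := by
  induction i with
  | zero => exact hH
  | succ i ih => exact (measurable_wmax ih).const_mul _

lemma lintegral_wmaxIter_sq_le {n : ℕ} {H : Rn n → ℝ≥0∞} (hH : Measurable H) (i : ℕ) :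
    ∫⁻ x, wmaxIter H i x ^ 2 ≤ ∫⁻ x, H x ^ 2 := by
  induction i with
  | zero => exact le_rfl
  | succ i ih =>
    refine le_trans ?_ ih
    have hA : 2 * wtConv n + 1 ≠ 0 := by simp
    have hA' : 2 * wtConv n + 1 ≠ ∞ :=
      ENNReal.add_ne_top.2 ⟨ENNReal.mul_ne_top (by norm_num) (wtConv_ne_top n), by norm_num⟩
    calc _ = ((2 * wtConv n + 1)⁻¹) ^ 2 * ∫⁻ x, wmax (wmaxIter H i) x ^ 2 := by
          rw [← lintegral_const_mul' _ _ (ENNReal.pow_ne_top (ENNReal.inv_ne_top.2 hA))]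
          exact lintegral_congr fun x => mul_pow _ _ _
      _ ≤ ((2 * wtConv n + 1)⁻¹) ^ 2 *
          ((2 * wtConv n + 1) ^ 2 * ∫⁻ x, wmaxIter H i x ^ 2) := by
        gcongr
        refine (lintegral_wmax_sq_le (measurable_wmaxIter hH i)).trans ?_
        gcongr
        exact le_self_add
      _ = _ := by
        rw [← mul_assoc, ← mul_pow, ENNReal.inv_mul_cancel hA hA', one_pow, one_mul]

/-- The Rubio de Francia algorithm. -/
lemma exists_majorant {n : ℕ} {H : Rn n → ℝ≥0∞} (hH : Measurable H) :
    ∃ R : Rn n → ℝ≥0∞, Measurable R ∧ (∀ x, H x ≤ R x) ∧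
      (∀ k x, wavg k (n + 1) R x ≤ 2 * (2 * wtConv n + 1) * R x) ∧
      ∫⁻ x, R x ^ 2 ≤ 4 * ∫⁻ x, H x ^ 2 := by
  have hA : 2 * wtConv n + 1 ≠ 0 := by simp
  have hA' : 2 * wtConv n + 1 ≠ ∞ :=
    ENNReal.add_ne_top.2 ⟨ENNReal.mul_ne_top (by norm_num) (wtConv_ne_top n), by norm_num⟩
  have hm := measurable_wmaxIter hH
  have h2 : (2⁻¹ : ℝ≥0∞) ≠ ∞ := by simp
  have htwo : ∑' i : ℕ, (2⁻¹ : ℝ≥0∞) ^ i = 2 := by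
    rw [ENNReal.tsum_geometric, ENNReal.one_sub_inv_two, inv_inv]
  refine ⟨fun x => ∑' i, (2⁻¹ : ℝ≥0∞) ^ i * wmaxIter H i x,
    Measurable.tsum fun i => (hm i).const_mul _, fun x => ?_, fun k x => ?_, ?_⟩
  · refine le_trans (le_of_eq ?_) (ENNReal.le_tsum 0)
    simp [wmaxIter]
  · rw [wavg_tsum k _ fun i => (hm i).const_mul _, tsum_eq_zero_add' ENNReal.summable,
      ← ENNReal.tsum_mul_left, ← tsum_eq_zero_add' (f := fun i =>
        wavg k (n + 1) (fun y => (2⁻¹ : ℝ≥0∞) ^ i * wmaxIter H i y) x) ENNReal.summable]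
    rw [tsum_eq_zero_add' (f := fun i => 2 * (2 * wtConv n + 1) *
      ((2⁻¹ : ℝ≥0∞) ^ i * wmaxIter H i x)) ENNReal.summable]
    refine le_trans (ENNReal.tsum_le_tsum fun i => ?_) le_add_self
    rw [wavg_const_mul k _ (ENNReal.pow_ne_top h2)]
    have e : wavg k (n + 1) (wmaxIter H i) x ≤ (2 * wtConv n + 1) * wmaxIter H (i + 1) x := by
      simp only [wmaxIter]
      rw [← mul_assoc, ENNReal.mul_inv_cancel hA hA', one_mul]
      exact le_iSup (fun k => wavg k (n + 1) (wmaxIter H i) x) k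
    calc _ ≤ (2⁻¹ : ℝ≥0∞) ^ i * ((2 * wtConv n + 1) * wmaxIter H (i + 1) x) := by gcongr
      _ = (2 * 2⁻¹) * ((2⁻¹ : ℝ≥0∞) ^ i * ((2 * wtConv n + 1) * wmaxIter H (i + 1) x)) := by
        rw [ENNReal.mul_inv_cancel (by norm_num) (by norm_num), one_mul]
      _ = _ := by rw [pow_succ]; ring
  · have e : ∀ x, (∑' i, (2⁻¹ : ℝ≥0∞) ^ i * wmaxIter H i x) ^ 2 ≤
        2 * ∑' i, (2⁻¹ : ℝ≥0∞) ^ i * wmaxIter H i x ^ 2 := by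
      intro x
      have hs : ∀ i : ℕ, (((2⁻¹ : ℝ≥0∞) ^ i) ^ (1 / (2 : ℝ))) ^ 2 = (2⁻¹ : ℝ≥0∞) ^ i := fun i => by
        rw [← ENNReal.rpow_two, ← ENNReal.rpow_mul]
        norm_num
      have := tsum_mul_sq_le (fun i => ((2⁻¹ : ℝ≥0∞) ^ i) ^ (1 / (2 : ℝ)))
        (fun i => ((2⁻¹ : ℝ≥0∞) ^ i) ^ (1 / (2 : ℝ)) * wmaxIter H i x)
      simp only [← mul_assoc, mul_pow, ← pow_two, hs, htwo] at this
      exact this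
    calc _ ≤ ∫⁻ x, 2 * ∑' i, (2⁻¹ : ℝ≥0∞) ^ i * wmaxIter H i x ^ 2 := lintegral_mono e
      _ = 2 * ∑' i, (2⁻¹ : ℝ≥0∞) ^ i * ∫⁻ x, wmaxIter H i x ^ 2 := by
        rw [lintegral_const_mul' _ _ (by norm_num),
          lintegral_tsum fun i => (((hm i).pow_const 2).const_mul _).aemeasurable]
        congr 1
        exact tsum_congr fun i => lintegral_const_mul' _ _ (ENNReal.pow_ne_top h2)
      _ ≤ 2 * ∑' i, (2⁻¹ : ℝ≥0∞) ^ i * ∫⁻ x, H x ^ 2 := by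
        exact mul_le_mul_right (ENNReal.tsum_le_tsum fun i =>
          mul_le_mul_right (lintegral_wmaxIter_sq_le hH i) _) _
      _ = _ := by
        rw [ENNReal.tsum_mul_right, htwo, ← mul_assoc]
        norm_num

lemma wavg_mul_rpow_le {n : ℕ} (k : ℕ) {v R : Rn n → ℝ≥0∞} (hv : Measurable v) (hR : Measurable R)
    {Q : ℝ} (hQ : 1 < Q) (x : Rn n) :
    wavg k (n + 1) (fun y => v y * R y) x ^ Q ≤
      wavg k (n + 1) (fun y => v y ^ Q * R y) x * wavg k (n + 1) R x ^ (Q - 1) := by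
  have hc := Real.HolderConjugate.conjExponent hQ
  have hQ0 : 0 < Q := by linarith
  set Q' := Q.conjExponent
  have hw : Measurable fun y : Rn n => wtE k (n + 1) (x - y) * R y :=
    ((measurable_wtE k _).comp (measurable_const.sub measurable_id)).mul hR
  have h := ENNReal.lintegral_mul_le_Lp_mul_Lq (volume : Measure (Rn n)) hc
    (f := fun y => v y * (wtE k (n + 1) (x - y) * R y) ^ (1 / Q))
    (g := fun y => (wtE k (n + 1) (x - y) * R y) ^ (1 / Q'))
    (hv.mul (hw.pow_const _)).aemeasurable (hw.pow_const _).aemeasurable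
  have e1 : ∀ y, ((wtE k (n + 1) (x - y) * R y) ^ (1 / Q)) ^ Q = wtE k (n + 1) (x - y) * R y :=
    fun y => by rw [← ENNReal.rpow_mul, one_div_mul_cancel hQ0.ne', ENNReal.rpow_one]
  have e2 : ∀ y, ((wtE k (n + 1) (x - y) * R y) ^ (1 / Q')) ^ Q' = wtE k (n + 1) (x - y) * R y :=
    fun y => by rw [← ENNReal.rpow_mul, one_div_mul_cancel hc.symm.ne_zero, ENNReal.rpow_one]
  have e3 : ∀ y, v y * (wtE k (n + 1) (x - y) * R y) ^ (1 / Q) *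
      (wtE k (n + 1) (x - y) * R y) ^ (1 / Q') = wtE k (n + 1) (x - y) * (v y * R y) := by
    intro y
    rw [mul_assoc, ← ENNReal.rpow_add_of_nonneg _ _ (by positivity) (one_div_nonneg.2 hc.symm.nonneg),
      one_div, one_div, hc.inv_add_inv_eq_one, ENNReal.rpow_one]
    ring
  have e4 : ∀ y, v y ^ Q * (wtE k (n + 1) (x - y) * R y) = wtE k (n + 1) (x - y) * (v y ^ Q * R y) :=
    fun y => by ring
  simp only [Pi.mul_apply, ENNReal.mul_rpow_of_nonneg _ _ hQ0.le, e1, e2, e4] at h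
  unfold wavg
  calc (∫⁻ y, wtE k (n + 1) (x - y) * (v y * R y)) ^ Q
      ≤ ((∫⁻ y, wtE k (n + 1) (x - y) * (v y ^ Q * R y)) ^ (1 / Q) *
        (∫⁻ y, wtE k (n + 1) (x - y) * R y) ^ (1 / Q')) ^ Q := by
        gcongr
        refine le_trans (le_of_eq (lintegral_congr fun y => ?_)) h
        rw [← e3 y, ENNReal.mul_rpow_of_nonneg _ _ (by positivity)]
    _ = _ := by
        rw [ENNReal.mul_rpow_of_nonneg _ _ hQ0.le, ← ENNReal.rpow_mul, ← ENNReal.rpow_mul,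
          one_div_mul_cancel hQ0.ne', ENNReal.rpow_one]
        congr 2
        rw [← hc.div_conj_eq_sub_one]
        ring

lemma lqSum_top (u : ℕ → ℝ≥0∞) : lqSum ∞ u = ⨆ j, u j := if_pos rfl

lemma lqSum_of_ne_top {q : ℝ≥0∞} (hq : q ≠ ∞) (u : ℕ → ℝ≥0∞) :
    lqSum q u = (∑' j, u j ^ q.toReal) ^ (1 / q.toReal) := if_neg hq

lemma one_le_toReal {q : ℝ≥0∞} (hq : 1 ≤ q) (h : q ≠ ∞) : 1 ≤ q.toReal := by
  rw [← ENNReal.toReal_one]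
  exact ENNReal.toReal_mono h hq

lemma measurable_lqSum {α : Type*} [MeasurableSpace α] (q : ℝ≥0∞) {u : ℕ → α → ℝ≥0∞}
    (hu : ∀ k, Measurable (u k)) : Measurable fun x => lqSum q fun k => u k x := by
  unfold lqSum
  split_ifs
  · exact Measurable.iSup hu
  · exact (Measurable.tsum fun k => (hu k).pow_const _).pow_const _

lemma ENNReal.rpow_mul_rpow_le (a b : ℝ≥0∞) {θ : ℝ} (h0 : 0 ≤ θ) (h1 : θ ≤ 1) :
    a ^ (1 - θ) * b ^ θ ≤ a + b := by
  calc _ ≤ (a + b) ^ (1 - θ) * (a + b) ^ θ := by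
        gcongr
        · exact le_self_add
        · exact le_add_self
    _ = _ := by
      rw [← ENNReal.rpow_add_of_nonneg _ _ (by linarith) h0]
      simp

/-- The constant in the vector-valued maximal inequality. -/
def fsConst (n : ℕ) : ℝ≥0∞ := 8 * (2 * (2 * wtConv n + 1)) ^ 2

lemma fsConst_ne_top (n : ℕ) : fsConst n ≠ ∞ :=
  ENNReal.mul_ne_top (by norm_num) (ENNReal.pow_ne_top (ENNReal.mul_ne_top (by norm_num)
    (ENNReal.add_ne_top.2 ⟨ENNReal.mul_ne_top (by norm_num) (wtConv_ne_top n), by norm_num⟩)))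

/-- A vector-valued maximal inequality of Fefferman–Stein type. -/
lemma lintegral_lqSum_wavg_sq_le {n : ℕ} {q : ℝ≥0∞} (hq : 1 ≤ q) {h : ℕ → Rn n → ℝ≥0∞}
    (hh : ∀ k, Measurable (h k)) :
    ∫⁻ x, (lqSum q fun k => wavg k (n + 1) (h k) x ^ 2) ≤
      fsConst n * ∫⁻ x, lqSum q fun k => h k x ^ 2 := by
  set B : ℝ≥0∞ := 2 * (2 * wtConv n + 1) with hB
  have hBt : B ≠ ∞ := ENNReal.mul_ne_top (by norm_num)
    (ENNReal.add_ne_top.2 ⟨ENNReal.mul_ne_top (by norm_num) (wtConv_ne_top n), by norm_num⟩)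
  have hF : fsConst n = 8 * B ^ 2 := rfl
  have hF0 : fsConst n ≠ 0 := by simp [hF, hB]
  set H : Rn n → ℝ≥0∞ := fun x => (lqSum q fun k => h k x ^ 2) ^ (1 / (2 : ℝ)) with hHd
  have hH : Measurable H := (measurable_lqSum q fun k => (hh k).pow_const 2).pow_const _
  have hH2 : ∀ x, H x ^ 2 = lqSum q fun k => h k x ^ 2 := fun x => by
    rw [hHd, ← ENNReal.rpow_two, ← ENNReal.rpow_mul]
    norm_num
  simp only [← hH2]
  by_cases hfin : ∫⁻ x, H x ^ 2 = ∞
  · rw [hfin, ENNReal.mul_top hF0]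
    exact le_top
  obtain ⟨R, hR, hHR, hwR, hRi⟩ := exists_majorant hH
  simp only [← hB] at hwR
  have hRfin : ∀ᵐ x, R x ≠ ∞ := by
    have := ae_lt_top (hR.pow_const 2) (ne_top_of_le_ne_top (ENNReal.mul_ne_top (by norm_num) hfin)
      hRi)
    filter_upwards [this] with x hx h
    simp [h] at hx
  rcases eq_or_ne q ∞ with rfl | hqt
  · have hle : ∀ k x, h k x ≤ R x := fun k x => by
      refine le_trans ?_ (hHR x)
      have h1 : h k x ^ 2 ≤ H x ^ 2 := by
        rw [hH2, lqSum_top]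
        exact le_iSup (fun k => h k x ^ 2) k
      exact (ENNReal.pow_le_pow_left_iff two_ne_zero).1 h1
    calc _ ≤ ∫⁻ x, B ^ 2 * R x ^ 2 := by
          refine lintegral_mono fun x => ?_
          rw [lqSum_top]
          refine iSup_le fun k => ?_
          rw [← mul_pow]
          gcongr
          exact (wavg_mono k _ (hle k) x).trans (hwR k x)
      _ = B ^ 2 * ∫⁻ x, R x ^ 2 := lintegral_const_mul' _ _ (ENNReal.pow_ne_top hBt)
      _ ≤ B ^ 2 * (4 * ∫⁻ x, H x ^ 2) := by gcongr
      _ ≤ _ := by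
        rw [hF, ← mul_assoc, mul_comm (B ^ 2)]
        gcongr
        norm_num
  · set r := q.toReal with hr
    have hr1 : 1 ≤ r := one_le_toReal hq hqt
    have hr0 : 0 < r := by linarith
    have hHr : ∀ x, H x ^ (2 * r) = ∑' k, h k x ^ (2 * r) := fun x => by
      rw [ENNReal.rpow_mul, ENNReal.rpow_two, hH2, lqSum_of_ne_top hqt, ← ENNReal.rpow_mul,
        one_div_mul_cancel hr0.ne', ENNReal.rpow_one]
      exact tsum_congr fun k => by rw [ENNReal.rpow_mul, ENNReal.rpow_two]
    have hle : ∀ k x, h k x ≤ R x := fun k x => by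
      refine le_trans ?_ (hHR x)
      have h1 : h k x ^ (2 * r) ≤ H x ^ (2 * r) := by
        rw [hHr]
        exact ENNReal.le_tsum k
      exact (ENNReal.rpow_le_rpow_iff (by positivity)).1 h1
    set v : ℕ → Rn n → ℝ≥0∞ := fun k x => h k x / R x with hv
    have hvm : ∀ k, Measurable (v k) := fun k => (hh k).div hR
    have hvs : ∀ x, ∑' k, v k x ^ (2 * r) ≤ 1 := fun x => by
      simp only [hv, ENNReal.div_rpow_of_nonneg _ _ (by positivity : 0 ≤ 2 * r)]
      simp only [div_eq_mul_inv]
      rw [ENNReal.tsum_mul_right, ← hHr, ← div_eq_mul_inv]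
      refine ENNReal.div_le_of_le_mul ?_
      rw [one_mul]
      exact ENNReal.rpow_le_rpow (hHR x) (by positivity)
    have hvR : ∀ k x, wavg k (n + 1) (h k) x = wavg k (n + 1) (fun y => v k y * R y) x := by
      intro k x
      refine lintegral_congr_ae ?_
      filter_upwards [hRfin] with y hy
      congr 1
      rcases eq_or_ne (R y) 0 with h0 | h0
      · have := hle k y
        rw [h0] at this ⊢
        simpa using this
      · exact (ENNReal.div_mul_cancel h0 hy).symm
    set T : Rn n → ℝ≥0∞ := fun x => ∑' k, wavg k (n + 1) (fun y => v k y ^ (2 * r) * R y) x with hT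
    have hvRm : ∀ k, Measurable fun y => v k y ^ (2 * r) * R y := fun k =>
      ((hvm k).pow_const _).mul hR
    have hTm : Measurable T := Measurable.tsum fun k => measurable_wavg k _ (hvRm k)
    have hpt : ∀ x, (lqSum q fun k => wavg k (n + 1) (h k) x ^ 2) ≤
        B ^ 2 * R x ^ 2 + B * (R x * T x) := by
      intro x
      rw [lqSum_of_ne_top hqt]
      have e1 : ∀ k, (wavg k (n + 1) (h k) x ^ 2) ^ r ≤
          (B * R x) ^ (2 * r - 1) * wavg k (n + 1) (fun y => v k y ^ (2 * r) * R y) x := by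
        intro k
        rw [hvR, ← ENNReal.rpow_two, ← ENNReal.rpow_mul, mul_comm (_ ^ (2 * r - 1))]
        refine (wavg_mul_rpow_le k (hvm k) hR (by linarith) x).trans ?_
        gcongr
        · linarith
        · exact hwR k x
      calc _ ≤ (∑' k, (B * R x) ^ (2 * r - 1) *
            wavg k (n + 1) (fun y => v k y ^ (2 * r) * R y) x) ^ (1 / r) :=
            ENNReal.rpow_le_rpow (ENNReal.tsum_le_tsum e1) (by positivity)
        _ = (B * R x) * ((B * R x) ^ (1 - 1 / r) * T x ^ (1 / r)) := by
            have h1 : 1 / r ≤ 1 := by rw [div_le_one hr0]; exact hr1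
            rw [ENNReal.tsum_mul_left, ENNReal.mul_rpow_of_nonneg _ _ (by positivity),
              ← ENNReal.rpow_mul, ← mul_assoc]
            congr 1
            nth_rewrite 2 [← ENNReal.rpow_one (B * R x)]
            rw [← ENNReal.rpow_add_of_nonneg _ _ zero_le_one (by linarith)]
            congr 1
            field_simp
            ring
        _ ≤ (B * R x) * (B * R x + T x) := by
            gcongr
            exact ENNReal.rpow_mul_rpow_le _ _ (by positivity)
              (by rw [div_le_one hr0]; exact hr1)
        _ = _ := by ring
    have hRT : ∫⁻ x, R x * T x ≤ B * ∫⁻ x, R x ^ 2 := by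
      simp only [hT, ← ENNReal.tsum_mul_left]
      rw [lintegral_tsum fun k => (hR.fun_mul (measurable_wavg k _ (hvRm k))).aemeasurable]
      simp only [fun k => lintegral_mul_wavg k (n + 1) hR (hvRm k)]
      rw [← lintegral_tsum fun k => ((measurable_wavg k _ hR).fun_mul (hvRm k)).aemeasurable,
        ← lintegral_const_mul' _ _ hBt]
      refine lintegral_mono fun x => ?_
      calc _ ≤ ∑' k, B * R x * (v k x ^ (2 * r) * R x) :=
            ENNReal.tsum_le_tsum fun k => mul_le_mul_left (hwR k x) _
        _ = B * R x ^ 2 * ∑' k, v k x ^ (2 * r) := by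
            rw [← ENNReal.tsum_mul_left]
            exact tsum_congr fun k => by ring
        _ ≤ B * R x ^ 2 * 1 := by
            gcongr
            exact hvs x
        _ = _ := mul_one _
    calc _ ≤ ∫⁻ x, (B ^ 2 * R x ^ 2 + B * (R x * T x)) := lintegral_mono hpt
      _ = B ^ 2 * (∫⁻ x, R x ^ 2) + B * ∫⁻ x, R x * T x := by
        rw [lintegral_add_left ((hR.pow_const 2).const_mul _),
          lintegral_const_mul' _ _ (ENNReal.pow_ne_top hBt), lintegral_const_mul' _ _ hBt]
      _ ≤ B ^ 2 * (∫⁻ x, R x ^ 2) + B * (B * ∫⁻ x, R x ^ 2) := by gcongr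
      _ = 2 * B ^ 2 * ∫⁻ x, R x ^ 2 := by ring
      _ ≤ 2 * B ^ 2 * (4 * ∫⁻ x, H x ^ 2) := by gcongr
      _ = _ := by rw [hF]; ring

/-- The Peetre weight `(1 + 2^k |z|)^{-P}`. -/
def pkE {n : ℕ} (k P : ℕ) (z : Rn n) : ℝ≥0∞ := ENNReal.ofReal (((1 + ‖(2 : ℝ) ^ k • z‖) ^ P)⁻¹)

/-- The Peetre maximal function. -/
def peetre {n : ℕ} (k P : ℕ) (U : Rn n → ℝ≥0∞) (x : Rn n) : ℝ≥0∞ := ⨆ y, U y * pkE k P (x - y)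

lemma wtE_eq {n : ℕ} (k N : ℕ) (z : Rn n) :
    wtE k N z = ENNReal.ofReal (((2 : ℝ) ^ k) ^ n) * pkE k N z := by
  unfold wtE pkE
  rw [ENNReal.ofReal_mul (by positivity)]

lemma pkE_le_one {n : ℕ} (k P : ℕ) (z : Rn n) : pkE k P z ≤ 1 := by
  unfold pkE
  rw [ENNReal.ofReal_le_one]
  exact inv_le_one_of_one_le₀ (one_le_pow₀ (by linarith [norm_nonneg ((2 : ℝ) ^ k • z)]))

lemma pkE_add {n : ℕ} (k P Q : ℕ) (z : Rn n) : pkE k (P + Q) z = pkE k P z * pkE k Q z := by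
  unfold pkE
  rw [← ENNReal.ofReal_mul (by positivity), pow_add, mul_inv]

lemma pkE_mul_le {n : ℕ} (k P : ℕ) (a b : Rn n) : pkE k P a * pkE k P b ≤ pkE k P (a + b) := by
  unfold pkE
  rw [← ENNReal.ofReal_mul (by positivity), ← mul_inv, ← mul_pow]
  gcongr
  rw [smul_add]
  have := norm_add_le ((2 : ℝ) ^ k • a) ((2 : ℝ) ^ k • b)
  nlinarith [norm_nonneg ((2 : ℝ) ^ k • a), norm_nonneg ((2 : ℝ) ^ k • b)]

lemma peetre_le_sq {n : ℕ} (k : ℕ) {U : Rn n → ℝ≥0∞} {B C : ℝ≥0∞} (hB : B ≠ ∞)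
    (hU : ∀ y, U y ≤ B) (hrep : ∀ y, U y ≤ C * wavg k ((n + 1) + (n + 1)) U y) (x : Rn n) :
    peetre k ((n + 1) + (n + 1)) U x ≤
      C ^ 2 * wavg k (n + 1) (fun y => U y ^ (1 / (2 : ℝ))) x ^ 2 := by
  set P := (n + 1) + (n + 1) with hP
  set S := peetre k P U x with hS
  have hsq : ∀ a : ℝ≥0∞, (a ^ (1 / (2 : ℝ))) * (a ^ (1 / (2 : ℝ))) = a := fun a => by
    rw [← ENNReal.rpow_add_of_nonneg _ _ (by norm_num) (by norm_num)]
    norm_num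
  have hSt : S ≠ ∞ := by
    refine ne_top_of_le_ne_top hB (iSup_le fun y => ?_)
    calc _ ≤ B * 1 := by
          gcongr
          · exact hU y
          · exact pkE_le_one _ _ _
      _ = B := mul_one B
  have hW : S ≤ C * (S ^ (1 / (2 : ℝ)) * wavg k (n + 1) (fun y => U y ^ (1 / (2 : ℝ))) x) := by
    refine iSup_le fun y => ?_
    have hS2 : S ^ (1 / (2 : ℝ)) ≠ ∞ := ENNReal.rpow_ne_top_of_nonneg (by norm_num) hSt
    calc U y * pkE k P (x - y) ≤ C * wavg k P U y * pkE k P (x - y) := by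
          gcongr
          exact hrep y
      _ = C * ∫⁻ z, wtE k P (y - z) * U z * pkE k P (x - y) := by
          rw [mul_assoc, wavg, lintegral_mul_const' _ _ (show pkE k P (x - y) ≠ ∞ from
            ENNReal.ofReal_ne_top)]
      _ ≤ C * ∫⁻ z, S ^ (1 / (2 : ℝ)) * (wtE k (n + 1) (x - z) * U z ^ (1 / (2 : ℝ))) := by
          refine mul_le_mul_right (lintegral_mono fun z => ?_) _
          have h1 : pkE k P (x - y) * pkE k P (y - z) ≤ pkE k P (x - z) := by
            have := pkE_mul_le k P (x - y) (y - z)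
            rwa [sub_add_sub_cancel] at this
          have h2 : U z ^ (1 / (2 : ℝ)) * pkE k (n + 1) (x - z) ≤ S ^ (1 / (2 : ℝ)) := by
            have h3 : pkE k (n + 1) (x - z) = pkE k P (x - z) ^ (1 / (2 : ℝ)) := by
              rw [hP, pkE_add k (n + 1) (n + 1), ENNReal.mul_rpow_of_nonneg _ _ (by norm_num), hsq]
            rw [h3, ← ENNReal.mul_rpow_of_nonneg _ _ (by norm_num)]
            exact ENNReal.rpow_le_rpow (le_iSup (fun y => U y * pkE k P (x - y)) z) (by norm_num)
          calc wtE k P (y - z) * U z * pkE k P (x - y)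
              = ENNReal.ofReal (((2 : ℝ) ^ k) ^ n) *
                (pkE k P (x - y) * pkE k P (y - z)) * U z := by rw [wtE_eq]; ring
            _ ≤ ENNReal.ofReal (((2 : ℝ) ^ k) ^ n) * pkE k P (x - z) * U z := by gcongr
            _ = (U z ^ (1 / (2 : ℝ)) * pkE k (n + 1) (x - z)) *
                (wtE k (n + 1) (x - z) * U z ^ (1 / (2 : ℝ))) := by
                rw [wtE_eq, hP, pkE_add]
                nth_rewrite 1 [← hsq (U z)]
                ring
            _ ≤ _ := by gcongr
      _ = _ := by rw [lintegral_const_mul' _ _ hS2, wavg]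
  have h2 : S ^ (1 / (2 : ℝ)) ≤ C * wavg k (n + 1) (fun y => U y ^ (1 / (2 : ℝ))) x := by
    refine ENNReal.le_of_sq_le_mul (ENNReal.rpow_ne_top_of_nonneg (by norm_num) hSt) ?_
    rw [pow_two, hsq, mul_left_comm]
    exact hW
  calc S = (S ^ (1 / (2 : ℝ))) ^ 2 := by rw [pow_two, hsq]
    _ ≤ (C * wavg k (n + 1) (fun y => U y ^ (1 / (2 : ℝ))) x) ^ 2 := by gcongr
    _ = _ := mul_pow _ _ _

lemma lqSum_mono {q : ℝ≥0∞} {u v : ℕ → ℝ≥0∞} (h : ∀ k, u k ≤ v k) : lqSum q u ≤ lqSum q v := by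
  unfold lqSum
  split_ifs
  · exact iSup_mono h
  · exact ENNReal.rpow_le_rpow (ENNReal.tsum_le_tsum fun k =>
      ENNReal.rpow_le_rpow (h k) ENNReal.toReal_nonneg) (by positivity)

lemma lqSum_const_mul {q : ℝ≥0∞} (hq : 1 ≤ q) (c : ℝ≥0∞) (u : ℕ → ℝ≥0∞) :
    (lqSum q fun k => c * u k) = c * lqSum q u := by
  rcases eq_or_ne q ∞ with rfl | hqt
  · simp only [lqSum_top, ENNReal.mul_iSup]
  · have h1 := one_le_toReal hq hqt
    rw [lqSum_of_ne_top hqt, lqSum_of_ne_top hqt]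
    simp only [ENNReal.mul_rpow_of_nonneg _ _ (zero_le_one.trans h1)]
    rw [ENNReal.tsum_mul_left, ENNReal.mul_rpow_of_nonneg _ _ (by positivity), ← ENNReal.rpow_mul,
      mul_one_div_cancel (by linarith), ENNReal.rpow_one]

lemma lintegral_lqSum_peetre_le {n : ℕ} {q : ℝ≥0∞} (hq : 1 ≤ q) {U : ℕ → Rn n → ℝ≥0∞}
    (hUm : ∀ k, Measurable (U k)) {C : ℝ≥0∞} (hC : C ≠ ∞) (hU : ∀ k, ∃ B ≠ ∞, ∀ y, U k y ≤ B)
    (hrep : ∀ k y, U k y ≤ C * wavg k ((n + 1) + (n + 1)) (U k) y) :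
    ∫⁻ x, (lqSum q fun k => peetre k ((n + 1) + (n + 1)) (U k) x) ≤
      C ^ 2 * fsConst n * ∫⁻ x, lqSum q fun k => U k x := by
  have h := lintegral_lqSum_wavg_sq_le hq (h := fun k y => U k y ^ (1 / (2 : ℝ)))
    fun k => (hUm k).pow_const _
  have hsq : ∀ a : ℝ≥0∞, (a ^ (1 / (2 : ℝ))) ^ 2 = a := fun a => by
    rw [← ENNReal.rpow_two, ← ENNReal.rpow_mul]
    norm_num
  simp only [hsq] at h
  calc _ ≤ ∫⁻ x, C ^ 2 * lqSum q fun k => wavg k (n + 1) (fun y => U k y ^ (1 / (2 : ℝ))) x ^ 2 := by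
        refine lintegral_mono fun x => ?_
        rw [← lqSum_const_mul hq]
        refine lqSum_mono fun k => ?_
        obtain ⟨B, hB, hBU⟩ := hU k
        exact peetre_le_sq k hB hBU (hrep k) x
    _ ≤ _ := by
        rw [lintegral_const_mul' _ _ (ENNReal.pow_ne_top hC), mul_assoc]
        gcongr

lemma Tst.exists_enorm_kern_dil_le {n : ℕ} {χ : Rn n → ℂ} (hχ : Tst χ) (N : ℕ) :
    ∃ C : ℝ≥0, ∀ k z, ‖kern n (_root_.dil k χ) z‖ₑ ≤ C * wtE k N z := by
  obtain ⟨C, hC0, hC⟩ := hχ.decay N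
  refine ⟨C.toNNReal, fun k z => ?_⟩
  rw [wtE, ← ofReal_norm]
  change _ ≤ ENNReal.ofReal C * _
  rw [← ENNReal.ofReal_mul hC0]
  refine ENNReal.ofReal_le_ofReal ?_
  rw [kern_dil, norm_mul, Complex.norm_real, Real.norm_of_nonneg (by positivity), mul_left_comm]
  gcongr
  rw [← div_eq_mul_inv, le_div_iff₀ (by positivity), mul_comm]
  exact hC _

/-- The Littlewood–Paley pieces of `f`. -/
def lpf {n : ℕ} (ψ0 : Rn n → ℝ) (f : Rn n → ℂ) (k : ℕ) : Rn n → ℂ :=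
  kern n (fun ξ => dil k (lpBase ψ0 k) ξ * ftransform n f ξ)

lemma IsLPBase.integrable_lpf_symbol {n : ℕ} {ψ0 : Rn n → ℝ} (hψ : IsLPBase n ψ0)
    (f : SchwartzMap (Rn n) ℂ) (k : ℕ) :
    Integrable (fun ξ => dil k (lpBase ψ0 k) ξ * ftransform n f ξ) :=
  integrable_tst_mul ((hψ.tst_base k).dil k) (integrable_ftransform_schwartz f)

lemma IsLPBase.smoothOp_eq_lpf {n : ℕ} {ψ0 : Rn n → ℝ} (hψ : IsLPBase n ψ0)
    (f : SchwartzMap (Rn n) ℂ) (k : ℕ) (x : Rn n) :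
    smoothOp n (lpPiece n ψ0 k) f x = lpf ψ0 f k x := by
  unfold lpf smoothOp
  rw [kern_mul_ftransform ((hψ.tst_base k).dil k).integrable f.integrable, invFT_eq_kern,
    lpPiece_eq_dil]

lemma IsLPBase.continuous_lpf {n : ℕ} {ψ0 : Rn n → ℝ} (hψ : IsLPBase n ψ0)
    (f : SchwartzMap (Rn n) ℂ) (k : ℕ) : Continuous (lpf ψ0 f k) :=
  continuous_kern (hψ.integrable_lpf_symbol f k)

/-- Frequency localised reproducing formula, with an arbitrary further multiplier. -/
lemma IsLPBase.kern_mul_lpf {n : ℕ} {ψ0 : Rn n → ℝ} (hψ : IsLPBase n ψ0)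
    (f : SchwartzMap (Rn n) ℂ) (k : ℕ) {χ : Rn n → ℂ} (hc : Continuous χ) (hχ : Integrable χ)
    (hk : Integrable (kern n χ)) (x : Rn n) :
    kern n (fun ξ => χ ξ * (dil k (lpBase ψ0 k) ξ * ftransform n f ξ)) x =
      ∫ y, kern n χ (x - y) * lpf ψ0 f k y :=
  kern_mul hc hχ hk (hψ.integrable_lpf_symbol f k) x

lemma IsLPBase.exists_enorm_kern_fat_le {n : ℕ} {ψ0 : Rn n → ℝ} (hψ : IsLPBase n ψ0) (N : ℕ) :
    ∃ C : ℝ≥0, ∀ k z, ‖kern n (dil k (lpFat ψ0 k)) z‖ₑ ≤ C * wtE k N z := by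
  choose C hC using fun i : ℕ => (hψ.tst_fat i).exists_enorm_kern_dil_le N
  refine ⟨C 0 + C 1, fun k z => ?_⟩
  rw [lpFat_min]
  refine (hC (min k 1) k z).trans (mul_le_mul_left ?_ _)
  rcases Nat.eq_zero_or_pos k with h | h
  · simp [h]
  · rw [min_eq_right h]
    simp

lemma IsLPBase.enorm_lpf_le {n : ℕ} {ψ0 : Rn n → ℝ} (hψ : IsLPBase n ψ0) (N : ℕ) :
    ∃ C : ℝ≥0, ∀ (f : SchwartzMap (Rn n) ℂ) (k : ℕ) (x : Rn n),
      ‖lpf ψ0 f k x‖ₑ ≤ C * wavg k N (fun y => ‖lpf ψ0 f k y‖ₑ) x := by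
  obtain ⟨C, hC⟩ := hψ.exists_enorm_kern_fat_le N
  refine ⟨C, fun f k x => ?_⟩
  have ht := (hψ.tst_fat k).dil k
  have h := hψ.kern_mul_lpf f k ht.continuous ht.integrable ht.integrable_kern x
  have e : (fun ξ => dil k (lpFat ψ0 k) ξ * (dil k (lpBase ψ0 k) ξ * ftransform n f ξ)) =
      fun ξ => dil k (lpBase ψ0 k) ξ * ftransform n f ξ := by
    ext ξ
    rw [← mul_assoc]
    congr 1
    exact hψ.fat_mul_base k _
  rw [e] at h
  calc _ = ‖∫ y, kern n (dil k (lpFat ψ0 k)) (x - y) * lpf ψ0 f k y‖ₑ := by rw [← h]; rfl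
    _ ≤ ∫⁻ y, ‖kern n (dil k (lpFat ψ0 k)) (x - y) * lpf ψ0 f k y‖ₑ := enorm_integral_le_lintegral_enorm _
    _ ≤ ∫⁻ y, C * (wtE k N (x - y) * ‖lpf ψ0 f k y‖ₑ) := by
      refine lintegral_mono fun y => ?_
      rw [enorm_mul, ← mul_assoc]
      gcongr
      exact hC k _
    _ = _ := lintegral_const_mul' _ _ (by simp)

/-- The weighted Littlewood–Paley pieces entering the norm of `F^s_{p,q}`. -/
def lpU {n : ℕ} (ψ0 : Rn n → ℝ) (s : ℝ) (f : Rn n → ℂ) (k : ℕ) (x : Rn n) : ℝ≥0∞ :=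
  ENNReal.ofReal ((2 : ℝ) ^ ((k : ℝ) * s)) * ‖lpf ψ0 f k x‖ₑ

lemma IsLPBase.measurable_lpU {n : ℕ} {ψ0 : Rn n → ℝ} (hψ : IsLPBase n ψ0) (s : ℝ)
    (f : SchwartzMap (Rn n) ℂ) (k : ℕ) : Measurable (lpU ψ0 s f k) :=
  (hψ.continuous_lpf f k).enorm.measurable.const_mul _

lemma IsLPBase.exists_lintegral_peetre_le {n : ℕ} {ψ0 : Rn n → ℝ} (hψ : IsLPBase n ψ0) (s : ℝ)
    {q : ℝ≥0∞} (hq : 1 ≤ q) : ∃ C : ℝ≥0, ∀ f : SchwartzMap (Rn n) ℂ,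
      ∫⁻ x, (lqSum q fun k => peetre k ((n + 1) + (n + 1)) (lpU ψ0 s f k) x) ≤
        C * ∫⁻ x, lqSum q fun k => lpU ψ0 s f k x := by
  obtain ⟨C, hC⟩ := hψ.enorm_lpf_le ((n + 1) + (n + 1))
  refine ⟨C ^ 2 * (fsConst n).toNNReal, fun f => ?_⟩
  rw [ENNReal.coe_mul, ENNReal.coe_pow, ENNReal.coe_toNNReal (fsConst_ne_top n)]
  refine lintegral_lqSum_peetre_le hq (hψ.measurable_lpU s f) ENNReal.coe_ne_top (fun k => ?_) ?_
  · refine ⟨ENNReal.ofReal ((2 : ℝ) ^ ((k : ℝ) * s)) * ENNReal.ofReal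
      (∫ ξ, ‖dil k (lpBase ψ0 k) ξ * ftransform n f ξ‖), by finiteness, fun y => ?_⟩
    unfold lpU
    rw [← ofReal_norm]
    gcongr
    exact norm_kern_le _ _
  · intro k y
    unfold lpU
    rw [wavg_const_mul k _ ENNReal.ofReal_ne_top, mul_left_comm]
    gcongr
    exact hC f k y

lemma IsLPBase.tlNorm_one_eq {n : ℕ} {ψ0 : Rn n → ℝ} (hψ : IsLPBase n ψ0) (s : ℝ) (q : ℝ≥0∞)
    (f : SchwartzMap (Rn n) ℂ) :
    tlNorm n ψ0 s 1 q f = ∫⁻ x, lqSum q fun k => lpU ψ0 s f k x := by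
  unfold tlNorm lpU
  simp only [ENNReal.one_ne_top, if_false, ENNReal.toReal_one, ENNReal.rpow_one, div_one,
    hψ.smoothOp_eq_lpf]
  rfl

/-- The half-wave modulation `e^{it|ξ|} χ(ξ)`. -/
def wv {n : ℕ} (t : ℝ) (χ : Rn n → ℂ) (ξ : Rn n) : ℂ :=
  Complex.exp (Complex.I * ((t * ‖ξ‖ : ℝ) : ℂ)) * χ ξ

/-- Multiplication by `ξ_i / |ξ|`. -/
def cdir {n : ℕ} (i : Fin n) (χ : Rn n → ℂ) (ξ : Rn n) : ℂ := ((ξ i / ‖ξ‖ : ℝ) : ℂ) * χ ξ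

/-- Multiplication by `|ξ|`. -/
def cnorm {n : ℕ} (χ : Rn n → ℂ) (ξ : Rn n) : ℂ := ((‖ξ‖ : ℝ) : ℂ) * χ ξ

lemma norm_wv {n : ℕ} (t : ℝ) (χ : Rn n → ℂ) (ξ : Rn n) : ‖wv t χ ξ‖ = ‖χ ξ‖ := by
  unfold wv
  rw [norm_mul, norm_exp_I_mul_ofReal', one_mul]

lemma contDiffAt_exp_norm {n : ℕ} (t : ℝ) {ξ : Rn n} (hξ : ξ ≠ 0) :
    ContDiffAt ℝ (⊤ : ℕ∞) (fun ξ : Rn n => Complex.exp (Complex.I * ((t * ‖ξ‖ : ℝ) : ℂ))) ξ := by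
  have h1 : ContDiffAt ℝ (⊤ : ℕ∞) (fun ξ : Rn n => t * ‖ξ‖) ξ :=
    contDiffAt_const.mul (contDiffAt_norm ℝ hξ)
  exact (contDiffAt_const.mul (Complex.ofRealCLM.contDiff.contDiffAt.comp ξ h1)).cexp

lemma Tst0.wv {n : ℕ} {χ : Rn n → ℂ} (h : Tst0 χ) (t : ℝ) : Tst0 (wv t χ) :=
  h.mul_left fun _ hξ => contDiffAt_exp_norm t hξ

lemma Tst0.cdir {n : ℕ} {χ : Rn n → ℂ} (h : Tst0 χ) (i : Fin n) : Tst0 (cdir i χ) := by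
  refine h.mul_left fun ξ hξ => ?_
  have h1 : ContDiffAt ℝ (⊤ : ℕ∞) (fun ξ : Rn n => ξ i / ‖ξ‖) ξ :=
    ContDiffAt.div (EuclideanSpace.proj i : Rn n →L[ℝ] ℝ).contDiff.contDiffAt
      (contDiffAt_norm ℝ hξ) (norm_ne_zero_iff.2 hξ)
  exact Complex.ofRealCLM.contDiff.contDiffAt.comp ξ h1

lemma Tst0.cnorm {n : ℕ} {χ : Rn n → ℂ} (h : Tst0 χ) : Tst0 (cnorm χ) :=
  h.mul_left fun ξ hξ => Complex.ofRealCLM.contDiff.contDiffAt.comp ξ (contDiffAt_norm ℝ hξ)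

lemma Tst0.pd {n : ℕ} {χ : Rn n → ℂ} (h : Tst0 χ) (i : Fin n) : Tst0 (pd i χ) :=
  h.of_tsupport (h.1.pd i) (tsupport_pd_subset _ _)

lemma pd_exp_norm {n : ℕ} (t : ℝ) (i : Fin n) {ξ : Rn n} (hξ : ξ ≠ 0) :
    pd i (fun ξ : Rn n => Complex.exp (Complex.I * ((t * ‖ξ‖ : ℝ) : ℂ))) ξ =
      Complex.exp (Complex.I * ((t * ‖ξ‖ : ℝ) : ℂ)) * (Complex.I * t * ((ξ i / ‖ξ‖ : ℝ) : ℂ)) := by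
  have h0 : DifferentiableAt ℝ (fun ξ : Rn n => Complex.exp (Complex.I * ((t * ‖ξ‖ : ℝ) : ℂ))) ξ :=
    (contDiffAt_exp_norm t hξ).differentiableAt (by simp)
  unfold pd
  rw [← h0.lineDeriv_eq_fderiv]
  refine HasLineDerivAt.lineDeriv ?_
  unfold HasLineDerivAt
  have h1 : HasDerivAt (fun r : ℝ => ‖ξ + r • EuclideanSpace.single i (1 : ℝ)‖) (ξ i / ‖ξ‖) 0 := by
    have h2 : HasDerivAt (fun r : ℝ => ‖ξ + r • EuclideanSpace.single i (1 : ℝ)‖ ^ 2)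
        (2 * ξ i) 0 := by
      have e : (fun r : ℝ => ‖ξ + r • EuclideanSpace.single i (1 : ℝ)‖ ^ 2) =
          fun r => ‖ξ‖ ^ 2 + 2 * (r * ξ i) + r ^ 2 := by
        ext r
        rw [norm_add_sq_real, inner_smul_right, inner_single_one, norm_smul]
        simp
      rw [e]
      have := ((((hasDerivAt_id (0 : ℝ)).mul_const (ξ i)).const_mul 2).const_add (‖ξ‖ ^ 2)).add
        ((hasDerivAt_id (0 : ℝ)).pow 2)
      refine this.congr_deriv ?_
      simp
    have h3 := h2.sqrt (by simpa using hξ)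
    simp only [Real.sqrt_sq (norm_nonneg _)] at h3
    refine h3.congr_deriv ?_
    simp only [zero_smul, add_zero]
    have : ‖ξ‖ ≠ 0 := norm_ne_zero_iff.2 hξ
    field_simp
  have h4 := (((h1.const_mul t).ofReal_comp).const_mul Complex.I).cexp
  refine h4.congr_deriv ?_
  simp only [zero_smul, add_zero]
  push_cast
  ring

lemma Tst0.pd_wv {n : ℕ} {χ : Rn n → ℂ} (h : Tst0 χ) (t : ℝ) (i : Fin n) (ξ : Rn n) :
    _root_.pd i (_root_.wv t χ) ξ =
      Complex.I * t * _root_.wv t (_root_.cdir i χ) ξ + _root_.wv t (_root_.pd i χ) ξ := by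
  by_cases h0 : ξ = 0
  · have e1 : ∀ {v : Rn n → ℂ}, Tst0 v → v 0 = 0 := fun hv => image_eq_zero_of_notMem_tsupport hv.2
    rw [h0, e1 ((h.wv t).pd i), e1 ((h.cdir i).wv t), e1 ((h.pd i).wv t)]
    simp
  · have h1 := pd_mul (u := fun ξ : Rn n => Complex.exp (Complex.I * ((t * ‖ξ‖ : ℝ) : ℂ)))
      (v := χ) ((contDiffAt_exp_norm t h0).differentiableAt (by simp))
      (h.1.1.differentiable (by simp) ξ) i
    rw [pd_exp_norm t i h0] at h1
    unfold _root_.wv _root_.cdir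
    rw [h1]
    ring

lemma Tst0.kern_wv_coord {n : ℕ} {χ : Rn n → ℂ} (h : Tst0 χ) (t : ℝ) (i : Fin n) (w : Rn n) :
    -(Complex.I * (w i : ℂ)) * kern n (_root_.wv t χ) w =
      Complex.I * t * kern n (_root_.wv t (_root_.cdir i χ)) w +
        kern n (_root_.wv t (_root_.pd i χ)) w := by
  rw [← kern_pd (h.wv t).1 i w, ← kern_const_mul, ← kern_add
    (((h.cdir i).wv t).1.integrable.const_mul _) ((h.pd i).wv t).1.integrable]
  congr 1
  exact funext (h.pd_wv t i)

lemma Tst0.abs_coord_mul_norm_kern_wv_le {n : ℕ} {χ : Rn n → ℂ} (h : Tst0 χ) (t : ℝ) (i : Fin n)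
    (w : Rn n) : |w i| * ‖kern n (_root_.wv t χ) w‖ ≤
      |t| * ‖kern n (_root_.wv t (_root_.cdir i χ)) w‖ + ‖kern n (_root_.wv t (_root_.pd i χ)) w‖ := by
  have h1 := congrArg norm (h.kern_wv_coord t i w)
  rw [norm_mul, norm_neg, norm_mul, Complex.norm_I, one_mul, Complex.norm_real,
    Real.norm_eq_abs] at h1
  rw [h1]
  refine (norm_add_le _ _).trans_eq ?_
  rw [norm_mul, norm_mul, Complex.norm_I, one_mul, Complex.norm_real, Real.norm_eq_abs]

lemma norm_kern_wv_le {n : ℕ} (t : ℝ) (χ : Rn n → ℂ) (w : Rn n) :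
    ‖kern n (wv t χ) w‖ ≤ ∫ ξ, ‖χ ξ‖ := by
  refine (norm_kern_le _ w).trans_eq ?_
  simp only [norm_wv]

lemma Tst0.abs_coord_pow_mul_norm_kern_wv_le {n : ℕ} (i : Fin n) (N : ℕ) : ∀ {χ : Rn n → ℂ},
    Tst0 χ → ∃ C : ℝ, ∀ t w, |t| ≤ 1 → |w i| ^ N * ‖kern n (_root_.wv t χ) w‖ ≤ C := by
  induction N with
  | zero => exact fun {χ} _ => ⟨∫ ξ, ‖χ ξ‖, fun t w _ => by simpa using norm_kern_wv_le t χ w⟩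
  | succ N ih =>
    intro χ h
    obtain ⟨C1, h1⟩ := ih (h.cdir i)
    obtain ⟨C2, h2⟩ := ih (h.pd i)
    refine ⟨C1 + C2, fun t w ht => ?_⟩
    have h3 := h1 t w ht
    have h4 := h2 t w ht
    have h5 := h.abs_coord_mul_norm_kern_wv_le t i w
    calc _ = |w i| ^ N * (|w i| * ‖kern n (_root_.wv t χ) w‖) := by ring
      _ ≤ |w i| ^ N * (1 * ‖kern n (_root_.wv t (_root_.cdir i χ)) w‖ +
          ‖kern n (_root_.wv t (_root_.pd i χ)) w‖) := by
        refine mul_le_mul_of_nonneg_left (h5.trans ?_) (by positivity)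
        gcongr
      _ ≤ _ := by linarith

lemma Tst0.wv_decay {n : ℕ} {χ : Rn n → ℂ} (h : Tst0 χ) (N : ℕ) :
    ∃ C : ℝ, 0 ≤ C ∧ ∀ t w, |t| ≤ 1 → (1 + ‖w‖) ^ N * ‖kern n (_root_.wv t χ) w‖ ≤ C := by
  obtain ⟨C, hC, h1⟩ := exists_decay_of_coord (ι := {t : ℝ // |t| ≤ 1})
    (F := fun t => kern n (_root_.wv t χ)) N
    ⟨_, fun t w => norm_kern_wv_le t.1 χ w⟩ (fun i => by
      obtain ⟨C, hC⟩ := abs_coord_pow_mul_norm_kern_wv_le i N h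
      exact ⟨C, fun t w => hC t w t.2⟩)
  exact ⟨C, hC, fun t w ht => h1 ⟨t, ht⟩ w⟩

lemma Tst0.hasDerivAt_kern_wv {n : ℕ} {χ : Rn n → ℂ} (h : Tst0 χ) (w : Rn n) (t : ℝ) :
    HasDerivAt (fun t => kern n (_root_.wv t χ) w)
      (Complex.I * kern n (_root_.wv t (_root_.cnorm χ)) w) t := by
  have hn := h.cnorm
  have h1 := hasDerivAt_kern_path (n := n) (u := fun t => _root_.wv t χ)
    (u' := fun t ξ => Complex.I * _root_.wv t (_root_.cnorm χ) ξ)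
    (bd := fun ξ => ‖χ ξ‖ + ‖_root_.cnorm χ ξ‖) w 0 t
    (fun t => (h.wv t).1.continuous) (fun t => continuous_const.mul (hn.wv t).1.continuous)
    (fun t ξ => by rw [norm_wv]; linarith [norm_nonneg (_root_.cnorm χ ξ)])
    (fun t ξ => by
      rw [norm_mul, norm_wv, Complex.norm_I, one_mul]; linarith [norm_nonneg (χ ξ)])
    (h.1.integrable.norm.add hn.1.integrable.norm)
    (by
      simp only [mul_add]
      exact (HasCompactSupport.integrable_norm_mul continuous_norm h.1).add
        (HasCompactSupport.integrable_norm_mul continuous_norm hn.1))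
    (fun t ξ => by
      have e1 : HasDerivAt (fun t : ℝ => t * ‖ξ‖) ‖ξ‖ t := by
        simpa using (hasDerivAt_id t).mul_const ‖ξ‖
      have e2 := (((e1.ofReal_comp).const_mul Complex.I).cexp).mul_const (χ ξ)
      refine e2.congr_deriv ?_
      unfold _root_.wv _root_.cnorm
      ring)
  simp only [smul_zero, add_zero, inner_zero_left, Complex.ofReal_zero, mul_zero, zero_mul,
    zero_add] at h1
  rwa [kern_const_mul] at h1

lemma Tst0.wv_sub_decay {n : ℕ} {χ : Rn n → ℂ} (h : Tst0 χ) (N : ℕ) :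
    ∃ C : ℝ, 0 ≤ C ∧ ∀ t w, t ∈ Set.Icc (0 : ℝ) 1 →
      (1 + ‖w‖) ^ N * ‖kern n (fun ξ => _root_.wv t χ ξ - χ ξ) w‖ ≤ C * t := by
  obtain ⟨C, hC0, hC⟩ := h.cnorm.wv_decay N
  refine ⟨C, hC0, fun t w ht => ?_⟩
  have hp : 0 < (1 + ‖w‖) ^ N := by positivity
  have key := (convex_Icc (0 : ℝ) 1).norm_image_sub_le_of_norm_hasDerivWithin_le
    (f := fun t => kern n (_root_.wv t χ) w) (C := C / (1 + ‖w‖) ^ N)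
    (fun r _ => (h.hasDerivAt_kern_wv w r).hasDerivWithinAt) (fun r hr => by
      rw [norm_mul, Complex.norm_I, one_mul, le_div_iff₀ hp, mul_comm]
      exact hC r w (abs_le.2 ⟨by linarith [hr.1], hr.2⟩)) (Set.left_mem_Icc.2 zero_le_one) ht
  have e : _root_.wv 0 χ = χ := by
    ext ξ
    simp [_root_.wv]
  simp only [e, sub_zero] at key
  rw [kern_sub (h.wv t).1.integrable h.1.integrable, mul_comm]
  rw [Real.norm_of_nonneg ht.1, div_mul_eq_mul_div, le_div_iff₀ hp] at key
  exact key

lemma lintegral_enorm_conv_le {n : ℕ} {K g : Rn n → ℂ} (hK : Continuous K) (hg : Continuous g) :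
    ∫⁻ x, ‖∫ y, K (x - y) * g y‖ₑ ≤ (∫⁻ x, ‖K x‖ₑ) * ∫⁻ x, ‖g x‖ₑ := by
  have hm : Measurable (fun p : Rn n × Rn n => ‖K (p.1 - p.2)‖ₑ * ‖g p.2‖ₑ) :=
    ((hK.measurable.comp (measurable_fst.sub measurable_snd)).enorm).mul
      (hg.measurable.comp measurable_snd).enorm
  calc _ ≤ ∫⁻ x, ∫⁻ y, ‖K (x - y)‖ₑ * ‖g y‖ₑ := by
        refine lintegral_mono fun x => (enorm_integral_le_lintegral_enorm _).trans_eq ?_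
        simp only [enorm_mul]
    _ = ∫⁻ y, ∫⁻ x, ‖K (x - y)‖ₑ * ‖g y‖ₑ := lintegral_lintegral_swap hm.aemeasurable
    _ = ∫⁻ y, (∫⁻ x, ‖K x‖ₑ) * ‖g y‖ₑ := by
        refine lintegral_congr fun y => ?_
        rw [lintegral_mul_const' _ _ enorm_ne_top,
          lintegral_sub_right_eq_self (fun x => ‖K x‖ₑ) y]
    _ = _ := lintegral_const_mul _ hg.measurable.enorm

/-- The annular cut-off `ψ_0(ξ/2) - ψ_0(ξ)`. -/
def lowCut {n : ℕ} (ψ0 : Rn n → ℝ) (ξ : Rn n) : ℂ := (ψ0 ((2 : ℝ)⁻¹ • ξ) : ℂ) - (ψ0 ξ : ℂ)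

lemma IsLPBase.tst0_lowCut {n : ℕ} {ψ0 : Rn n → ℝ} (h : IsLPBase n ψ0) : Tst0 (lowCut ψ0) := by
  refine ⟨(h.tst_smul (by norm_num)).sub (by simpa using h.tst_smul one_ne_zero),
    notMem_tsupport_of_ball (r := 1) (by norm_num) fun ξ hξ => ?_⟩
  rw [lowCut, h.2.1 ξ hξ.le, h.2.1 _ (by rw [norm_smul]; norm_num; linarith), sub_self]

/-- A dyadic piece of the low frequency part of the half-wave kernel. -/
def lowSym {n : ℕ} (ψ0 : Rn n → ℝ) (p : ℕ) (ξ : Rn n) : ℂ :=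
  (wavePh ξ - 1) * lowCut ψ0 ((2 : ℝ) ^ p • ξ)

lemma dil_lowSym {n : ℕ} (ψ0 : Rn n → ℝ) (p : ℕ) (ξ : Rn n) :
    dil p (lowSym ψ0 p) ξ = wv ((2 : ℝ) ^ p)⁻¹ (lowCut ψ0) ξ - lowCut ψ0 ξ := by
  unfold dil lowSym wavePh wv
  rw [smul_smul, mul_inv_cancel₀ (by positivity), one_smul, norm_smul, Real.norm_of_nonneg
    (by positivity)]
  ring

lemma IsLPBase.integrable_lowSym_aux {n : ℕ} {ψ0 : Rn n → ℝ} (h : IsLPBase n ψ0) {c : ℝ}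
    (hc : c ≠ 0) : Integrable (fun ξ => (wavePh ξ - 1) * (ψ0 (c • ξ) : ℂ)) := by
  have h1 := (h.tst_smul hc).integrable
  refine ((integrable_wavePh_mul h1).sub h1).congr (Filter.Eventually.of_forall fun ξ => ?_)
  simp only [Pi.sub_apply]
  ring

lemma IsLPBase.integrable_lowSym {n : ℕ} {ψ0 : Rn n → ℝ} (h : IsLPBase n ψ0) (p : ℕ) :
    Integrable (lowSym ψ0 p) := by
  have hp : (2 : ℝ) ^ p ≠ 0 := by positivity
  refine ((h.integrable_lowSym_aux (c := (2 : ℝ)⁻¹ * 2 ^ p) (by positivity)).sub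
    (h.integrable_lowSym_aux hp)).congr (Filter.Eventually.of_forall fun ξ => ?_)
  simp only [Pi.sub_apply, lowSym, lowCut, smul_smul]
  ring

lemma IsLPBase.sum_lowSym {n : ℕ} (ψ0 : Rn n → ℝ) (P : ℕ) (ξ : Rn n) :
    ∑ p ∈ Finset.range P, lowSym ψ0 p ξ = (wavePh ξ - 1) * (ψ0 ((2 : ℝ)⁻¹ • ξ) : ℂ) -
      (wavePh ξ - 1) * (ψ0 (((2 : ℝ)⁻¹ * 2 ^ P) • ξ) : ℂ) := by
  induction P with
  | zero => simp
  | succ P ih =>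
    rw [Finset.sum_range_succ, ih]
    have e : (2 : ℝ)⁻¹ * 2 ^ (P + 1) = 2 ^ P := by rw [pow_succ]; ring
    rw [e, lowSym, lowCut, smul_smul]
    ring

lemma IsLPBase.exists_lintegral_kern_lowSym_le {n : ℕ} {ψ0 : Rn n → ℝ} (h : IsLPBase n ψ0) :
    ∃ C : ℝ≥0, ∀ p, ∫⁻ x, ‖kern n (lowSym ψ0 p) x‖ₑ ≤ C * (2⁻¹ : ℝ≥0∞) ^ p := by
  obtain ⟨C, hC0, hC⟩ := h.tst0_lowCut.wv_sub_decay (n + 1)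
  set M := ∫⁻ x : Rn n, ENNReal.ofReal ((1 + ‖x‖) ^ (n + 1))⁻¹ with hM
  have hMt : M ≠ ∞ := (integrable_inv_one_add_norm_pow n).lintegral_lt_top.ne
  refine ⟨C.toNNReal * M.toNNReal, fun p => ?_⟩
  have hp : (0 : ℝ) < 2 ^ p := by positivity
  have h1 : ∀ x, ‖kern n (lowSym ψ0 p) ((2 : ℝ) ^ p • x)‖ₑ ≤
      ENNReal.ofReal ((2 ^ p) ^ n : ℝ)⁻¹ * (ENNReal.ofReal C * (2⁻¹ : ℝ≥0∞) ^ p *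
        ENNReal.ofReal ((1 + ‖x‖) ^ (n + 1))⁻¹) := by
    intro x
    have e := kern_dil p (lowSym ψ0 p) x
    have e2 : dil p (lowSym ψ0 p) = fun ξ => wv ((2 : ℝ) ^ p)⁻¹ (lowCut ψ0) ξ - lowCut ψ0 ξ :=
      funext (dil_lowSym ψ0 p)
    rw [e2] at e
    have h3 := hC ((2 : ℝ) ^ p)⁻¹ x ⟨by positivity, inv_le_one_of_one_le₀
      (one_le_pow₀ (by norm_num))⟩
    rw [e, norm_mul, Complex.norm_real, Real.norm_of_nonneg (by positivity)] at h3
    have e4 : (2⁻¹ : ℝ≥0∞) ^ p = ENNReal.ofReal (2 ^ p : ℝ)⁻¹ := by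
      rw [ENNReal.ofReal_inv_of_pos hp, ENNReal.ofReal_pow (by norm_num), ENNReal.inv_pow]
      norm_num
    rw [e4, ← ENNReal.ofReal_mul hC0, ← ENNReal.ofReal_mul (by positivity),
      ← ENNReal.ofReal_mul (by positivity), ← ofReal_norm]
    refine ENNReal.ofReal_le_ofReal ?_
    have hq : (0 : ℝ) < (2 ^ p) ^ n := by positivity
    have hr : (0 : ℝ) < (1 + ‖x‖) ^ (n + 1) := by positivity
    rw [inv_mul_eq_div, le_div_iff₀ hq, ← div_eq_mul_inv, le_div_iff₀ hr]
    linarith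
  have h2 := lintegral_comp_smul' (fun x => ‖kern n (lowSym ψ0 p) x‖ₑ)
    (continuous_kern (h.integrable_lowSym p)).measurable.enorm hp
  have h3 := h2.symm.le.trans (lintegral_mono h1)
  rw [lintegral_const_mul' _ _ (by finiteness)] at h3
  have hne : ENNReal.ofReal ((2 ^ p) ^ n : ℝ)⁻¹ ≠ 0 := by simp
  refine ((ENNReal.mul_le_mul_iff_right hne ENNReal.ofReal_ne_top).1 h3).trans_eq ?_
  rw [lintegral_const_mul' _ _ (by finiteness), ENNReal.coe_mul, ENNReal.coe_toNNReal hMt, ← hM]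
  change ENNReal.ofReal C * _ * _ = ENNReal.ofReal C * _ * _
  ring

lemma IsLPBase.enorm_kern_low_le {n : ℕ} (hn : 1 ≤ n) {ψ0 : Rn n → ℝ} (h : IsLPBase n ψ0)
    (x : Rn n) : ‖kern n (fun ξ => (wavePh ξ - 1) * (ψ0 ((2 : ℝ)⁻¹ • ξ) : ℂ)) x‖ₑ ≤
      ∑' p, ‖kern n (lowSym ψ0 p) x‖ₑ := by
  set K : ℝ := 2 * ∫ ξ : Rn n, ‖(ψ0 ξ : ℂ)‖ with hK
  have hK0 : 0 ≤ K := by positivity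
  have key : ∀ P : ℕ, ‖kern n (fun ξ => (wavePh ξ - 1) * (ψ0 ((2 : ℝ)⁻¹ • ξ) : ℂ)) x‖ₑ ≤
      ∑' p, ‖kern n (lowSym ψ0 p) x‖ₑ + ENNReal.ofReal (K * (1 / 2) ^ P) := by
    intro P
    set c : ℝ := (2 : ℝ)⁻¹ * 2 ^ (P + 1) with hc
    have hc2 : c = 2 ^ P := by rw [hc, pow_succ]; ring
    have hc0 : 0 < c := by positivity
    have e : (fun ξ : Rn n => (wavePh ξ - 1) * (ψ0 ((2 : ℝ)⁻¹ • ξ) : ℂ)) =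
        fun ξ => (∑ p ∈ Finset.range (P + 1), lowSym ψ0 p ξ) + (wavePh ξ - 1) * (ψ0 (c • ξ) : ℂ) := by
      ext ξ
      rw [IsLPBase.sum_lowSym]
      ring
    rw [e, kern_add (integrable_finsetSum _ fun p _ => h.integrable_lowSym p)
      (h.integrable_lowSym_aux hc0.ne'), kern_sum _ fun p _ => h.integrable_lowSym p]
    refine (enorm_add_le _ _).trans (add_le_add ((enorm_sum_le _ _).trans
      (ENNReal.sum_le_tsum _)) ?_)
    rw [← ofReal_norm]
    refine ENNReal.ofReal_le_ofReal ((norm_kern_le _ x).trans ?_)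
    have h1 := Measure.integral_comp_smul (volume : Measure (Rn n)) (fun ξ => ‖(ψ0 ξ : ℂ)‖) c
    have h0 : Integrable (fun ξ => ‖(ψ0 (c • ξ) : ℂ)‖) := (h.tst_smul hc0.ne').integrable.norm
    calc _ ≤ ∫ ξ, 2 * ‖(ψ0 (c • ξ) : ℂ)‖ := by
          refine integral_mono (h.integrable_lowSym_aux hc0.ne').norm (h0.const_mul _) fun ξ => ?_
          simp only [norm_mul]
          gcongr
          refine (norm_sub_le _ _).trans ?_
          rw [norm_wavePh, norm_one]
          norm_num
      _ = 2 * (|(c ^ n)⁻¹| * ∫ ξ : Rn n, ‖(ψ0 ξ : ℂ)‖) := by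
          rw [integral_const_mul, h1, finrank_euclideanSpace_fin, smul_eq_mul]
      _ ≤ _ := ?_
    rw [hK, mul_assoc 2, mul_comm (∫ ξ, _) ((1 / 2 : ℝ) ^ P)]
    gcongr
    rw [abs_of_pos (by positivity), one_div, inv_pow, hc2]
    gcongr
    exact le_self_pow₀ (one_le_pow₀ (by norm_num)) (by omega)
  have hlim : Filter.Tendsto (fun P : ℕ => ∑' p, ‖kern n (lowSym ψ0 p) x‖ₑ +
      ENNReal.ofReal (K * (1 / 2) ^ P)) Filter.atTop
      (nhds (∑' p, ‖kern n (lowSym ψ0 p) x‖ₑ + ENNReal.ofReal (K * 0))) := by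
    refine tendsto_const_nhds.add (ENNReal.tendsto_ofReal (tendsto_const_nhds.mul ?_))
    exact tendsto_pow_atTop_nhds_zero_of_lt_one (by norm_num) (by norm_num)
  rw [mul_zero, ENNReal.ofReal_zero, add_zero] at hlim
  exact ge_of_tendsto' hlim key

lemma IsLPBase.lintegral_kern_low_lt_top {n : ℕ} (hn : 1 ≤ n) {ψ0 : Rn n → ℝ}
    (h : IsLPBase n ψ0) : ∫⁻ x, ‖kern n (fun ξ => wavePh ξ * lpFat ψ0 0 ξ) x‖ₑ < ∞ := by
  obtain ⟨C, hC⟩ := h.exists_lintegral_kern_lowSym_le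
  have ht := h.tst_fat 0
  have e : (fun ξ => wavePh ξ * lpFat ψ0 0 ξ) = fun ξ =>
      lpFat ψ0 0 ξ + (wavePh ξ - 1) * (ψ0 ((2 : ℝ)⁻¹ • ξ) : ℂ) := by
    ext ξ
    simp only [lpFat, if_true]
    ring
  calc _ ≤ ∫⁻ x, (‖kern n (lpFat ψ0 0) x‖ₑ + ∑' p, ‖kern n (lowSym ψ0 p) x‖ₑ) := by
        refine lintegral_mono fun x => ?_
        rw [e, kern_add ht.integrable (h.integrable_lowSym_aux (by norm_num))]
        exact (enorm_add_le _ _).trans (by gcongr; exact h.enorm_kern_low_le hn x)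
    _ = (∫⁻ x, ‖kern n (lpFat ψ0 0) x‖ₑ) + ∑' p, ∫⁻ x, ‖kern n (lowSym ψ0 p) x‖ₑ := by
        rw [lintegral_add_left (continuous_kern ht.integrable).measurable.enorm, lintegral_tsum
          fun p => (continuous_kern (h.integrable_lowSym p)).measurable.enorm.aemeasurable]
    _ ≤ (∫⁻ x, ‖kern n (lpFat ψ0 0) x‖ₑ) + ∑' p, (C : ℝ≥0∞) * (2⁻¹ : ℝ≥0∞) ^ p := by
        gcongr with p
        exact hC p
    _ < ∞ := by
        rw [ENNReal.tsum_mul_left, ENNReal.tsum_geometric]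
        refine ENNReal.add_lt_top.2 ⟨ht.integrable_kern.2, ENNReal.mul_lt_top ENNReal.coe_lt_top ?_⟩
        simp

lemma IsLPBase.wavePiece_eq_conv {n : ℕ} {ψ0 : Rn n → ℝ} (h : IsLPBase n ψ0)
    (f : SchwartzMap (Rn n) ℂ) (k : ℕ)
    (hk : Integrable (kern n (fun ξ => wavePh ξ * dil k (lpFat ψ0 k) ξ))) (x : Rn n) :
    wavePiece ψ0 f k x =
      ∫ y, kern n (fun ξ => wavePh ξ * dil k (lpFat ψ0 k) ξ) (x - y) * lpf ψ0 f k y := by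
  have ht := (h.tst_fat k).dil k
  refine Eq.trans ?_ (h.kern_mul_lpf f k (χ := fun ξ => wavePh ξ * dil k (lpFat ψ0 k) ξ)
    (continuous_wavePh.mul ht.continuous) (integrable_wavePh_mul ht.integrable) hk x)
  unfold wavePiece
  congr 1 with ξ
  rw [mul_assoc, ← mul_assoc (dil k (lpFat ψ0 k) ξ)]
  congr 2
  exact (h.fat_mul_base k _).symm

lemma IsLPBase.exists_lintegral_wavePiece_zero_le {n : ℕ} (hn : 1 ≤ n) {ψ0 : Rn n → ℝ}
    (h : IsLPBase n ψ0) : ∃ C : ℝ≥0, ∀ f : SchwartzMap (Rn n) ℂ,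
      ∫⁻ x, ‖wavePiece ψ0 f 0 x‖ₑ ≤ C * ∫⁻ x, ‖lpf ψ0 f 0 x‖ₑ := by
  have hfin := h.lintegral_kern_low_lt_top hn
  have hc : Continuous (kern n (fun ξ => wavePh ξ * lpFat ψ0 0 ξ)) :=
    continuous_kern (integrable_wavePh_mul (h.tst_fat 0).integrable)
  have e : dil 0 (lpFat ψ0 0) = lpFat ψ0 0 := by
    ext ξ
    simp [dil]
  refine ⟨(∫⁻ x, ‖kern n (fun ξ => wavePh ξ * lpFat ψ0 0 ξ) x‖ₑ).toNNReal, fun f => ?_⟩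
  rw [ENNReal.coe_toNNReal hfin.ne]
  refine le_trans (lintegral_mono fun x => ?_)
    (lintegral_enorm_conv_le hc (h.continuous_lpf f 0))
  rw [h.wavePiece_eq_conv f 0 (by rw [e]; exact ⟨hc.aestronglyMeasurable, hfin⟩), e]

lemma Tst.lintegral_kern_sq_le {n : ℕ} {u : Rn n → ℂ} (hu : Tst u) :
    ∫⁻ x, ‖kern n u x‖ₑ ^ 2 ≤ ENNReal.ofReal (∫ ξ, ‖u ξ‖ ^ 2) := by
  have hk := hu.integrable_kern
  have h := integral_kern_mul_conj hu.continuous hu.integrable hk 0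
  have e1 : ∀ z : ℂ, z * (starRingEnd ℂ) z = ((‖z‖ ^ 2 : ℝ) : ℂ) := fun z => by
    rw [Complex.mul_conj, Complex.normSq_eq_norm_sq]
  have h1 : ∫ x, kern n u (x + 0) * (starRingEnd ℂ) (kern n u x) =
      ((∫ x, ‖kern n u x‖ ^ 2 : ℝ) : ℂ) := by
    rw [← integral_complex_ofReal]
    refine integral_congr_ae (Filter.Eventually.of_forall fun x => ?_)
    simp only [add_zero]
    exact e1 _
  have h2 : ∫ x, ‖kern n u x‖ ^ 2 ≤ ∫ ξ, ‖u ξ‖ ^ 2 := by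
    have h3 := congrArg norm (h1.symm.trans h)
    rw [Complex.norm_real, Real.norm_of_nonneg (integral_nonneg fun x => by positivity)] at h3
    rw [h3]
    refine (norm_kern_le _ _).trans_eq ?_
    congr 1 with ξ
    rw [e1, Complex.norm_real, Real.norm_of_nonneg (by positivity)]
  have h4 : Integrable (fun x => ‖kern n u x‖ ^ 2) := by
    have := hk.norm.bdd_mul (c := ∫ ξ, ‖u ξ‖) hk.norm.aestronglyMeasurable
      (Filter.Eventually.of_forall fun x => by rw [norm_norm]; exact norm_kern_le u x)
    simpa only [pow_two] using this
  refine le_trans (le_of_eq ?_) (ENNReal.ofReal_le_ofReal h2)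
  rw [ofReal_integral_eq_lintegral_ofReal h4 (Filter.Eventually.of_forall fun x => by positivity)]
  refine lintegral_congr fun x => ?_
  rw [ENNReal.ofReal_pow (norm_nonneg _), ofReal_norm]

/-- Families, indexed by `T`, that are bounded in `L²` uniformly for `T ≥ 1`. -/
def L2Bdd {n : ℕ} (F : ℝ → Rn n → ℝ≥0∞) : Prop :=
  (∀ T, Measurable (F T)) ∧ ∃ C : ℝ≥0, ∀ T, 1 ≤ T → ∫⁻ w, F T w ^ 2 ≤ C

lemma L2Bdd.mono {n : ℕ} {F G : ℝ → Rn n → ℝ≥0∞} (hF : L2Bdd F) (hG : ∀ T, Measurable (G T))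
    (h : ∀ T w, 1 ≤ T → G T w ≤ F T w) : L2Bdd G := by
  obtain ⟨C, hC⟩ := hF.2
  refine ⟨hG, C, fun T hT => (lintegral_mono fun w => ?_).trans (hC T hT)⟩
  exact pow_le_pow_left₀ (by simp) (h T w hT) 2

lemma ENNReal.add_sq_le_two_mul (a b : ℝ≥0∞) : (a + b) ^ 2 ≤ 2 * a ^ 2 + 2 * b ^ 2 := by
  have h := ENNReal.rpow_add_le_mul_rpow_add_rpow a b (p := 2) (by norm_num)
  norm_num at h
  norm_cast at h
  rwa [mul_add] at h

lemma L2Bdd.add {n : ℕ} {F G : ℝ → Rn n → ℝ≥0∞} (hF : L2Bdd F) (hG : L2Bdd G) :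
    L2Bdd (fun T w => F T w + G T w) := by
  obtain ⟨C, hC⟩ := hF.2
  obtain ⟨D, hD⟩ := hG.2
  refine ⟨fun T => (hF.1 T).add (hG.1 T), 2 * C + 2 * D, fun T hT => ?_⟩
  calc _ ≤ ∫⁻ w, (2 * F T w ^ 2 + 2 * G T w ^ 2) :=
        lintegral_mono fun w => ENNReal.add_sq_le_two_mul _ _
    _ = (2 * ∫⁻ w, F T w ^ 2) + 2 * ∫⁻ w, G T w ^ 2 := by
        rw [lintegral_add_left (((hF.1 T).pow_const 2).const_mul 2),
          lintegral_const_mul _ ((hF.1 T).pow_const 2), lintegral_const_mul _ ((hG.1 T).pow_const 2)]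
    _ ≤ _ := by
        push_cast
        gcongr
        · exact hC T hT
        · exact hD T hT

lemma L2Bdd.const_mul {n : ℕ} {F : ℝ → Rn n → ℝ≥0∞} (hF : L2Bdd F) (c : ℝ≥0) :
    L2Bdd (fun T w => c * F T w) := by
  obtain ⟨C, hC⟩ := hF.2
  refine ⟨fun T => (hF.1 T).const_mul _, c ^ 2 * C, fun T hT => ?_⟩
  simp only [mul_pow]
  rw [lintegral_const_mul _ ((hF.1 T).pow_const 2)]
  push_cast
  gcongr
  exact hC T hT

lemma L2Bdd.sum {n : ℕ} {ι : Type*} (s : Finset ι) {F : ι → ℝ → Rn n → ℝ≥0∞}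
    (hF : ∀ i, L2Bdd (F i)) : L2Bdd (fun T w => ∑ i ∈ s, F i T w) := by
  classical
  induction s using Finset.induction_on with
  | empty => exact ⟨fun T => by simp, 0, fun T _ => by simp⟩
  | insert a s ha ih =>
    simp only [Finset.sum_insert ha]
    exact (hF a).add ih

lemma Tst0.measurable_wv {n : ℕ} {χ : Rn n → ℂ} (h : Tst0 χ) {g : Rn n → ℝ} (hg : Continuous g)
    (T : ℝ) : Measurable (fun w => ENNReal.ofReal (g w) * ‖kern n (_root_.wv T χ) w‖ₑ) :=
  (ENNReal.measurable_ofReal.comp hg.measurable).mul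
    (_root_.continuous_kern (h.wv T).1.integrable).measurable.enorm

lemma continuous_abs_coord {n : ℕ} (i : Fin n) : Continuous (fun w : Rn n => |w i|) :=
  (EuclideanSpace.proj i : Rn n →L[ℝ] ℝ).continuous.abs

lemma Tst0.l2Bdd_kern {n : ℕ} {χ : Rn n → ℂ} (h : Tst0 χ) :
    L2Bdd (fun T w => ‖kern n (_root_.wv T χ) w‖ₑ) := by
  refine ⟨fun T => (_root_.continuous_kern (h.wv T).1.integrable).measurable.enorm,
    (∫ ξ, ‖χ ξ‖ ^ 2).toNNReal, fun T _ => ?_⟩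
  refine (h.wv T).1.lintegral_kern_sq_le.trans_eq ?_
  simp only [norm_wv]
  rfl

lemma Tst0.l2Bdd_coord {n : ℕ} (i : Fin n) (L : ℕ) : ∀ {χ : Rn n → ℂ}, Tst0 χ →
    L2Bdd (fun T w => ENNReal.ofReal ((|w i| / T) ^ L) * ‖kern n (_root_.wv T χ) w‖ₑ) := by
  induction L with
  | zero =>
    intro χ h
    simpa using h.l2Bdd_kern
  | succ L ih =>
    intro χ h
    refine ((ih (h.cdir i)).add (ih (h.pd i))).mono
      (fun T => h.measurable_wv (((continuous_abs_coord i).div_const _).pow _) T) fun T w hT => ?_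
    have hT0 : 0 < T := by linarith
    simp only [← ofReal_norm]
    rw [← ENNReal.ofReal_mul (by positivity), ← ENNReal.ofReal_mul (by positivity),
      ← ENNReal.ofReal_mul (by positivity), ← ENNReal.ofReal_add (by positivity) (by positivity)]
    refine ENNReal.ofReal_le_ofReal ?_
    have h5 := h.abs_coord_mul_norm_kern_wv_le T i w
    rw [abs_of_pos hT0] at h5
    rw [pow_succ, mul_assoc, ← mul_add]
    gcongr
    rw [div_mul_eq_mul_div, div_le_iff₀ hT0]
    refine h5.trans ?_
    nlinarith [norm_nonneg (kern n (_root_.wv T (_root_.pd i χ)) w)]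

lemma Tst0.l2Bdd_weight {n : ℕ} (L : ℕ) {χ : Rn n → ℂ} (h : Tst0 χ) :
    L2Bdd (fun T w => ENNReal.ofReal ((1 + ‖w‖ / T) ^ L) * ‖kern n (_root_.wv T χ) w‖ₑ) := by
  obtain ⟨C, hC, h1⟩ := one_add_norm_pow_le (n := n) L
  have hb := (h.l2Bdd_kern.add
    (L2Bdd.sum Finset.univ fun i => l2Bdd_coord i L h)).const_mul C.toNNReal
  refine hb.mono (fun T => h.measurable_wv (by fun_prop) T) fun T w hT => ?_
  have hT0 : 0 < T := by linarith
  have h2 := h1 (T⁻¹ • w)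
  rw [norm_smul, Real.norm_of_nonneg (by positivity), inv_mul_eq_div] at h2
  nth_rewrite 2 [← one_mul ‖kern n (_root_.wv T χ) w‖ₑ]
  rw [← Finset.sum_mul, ← add_mul, ← mul_assoc]
  gcongr
  rw [← ENNReal.ofReal_sum_of_nonneg fun i _ => by positivity, ← ENNReal.ofReal_one,
    ← ENNReal.ofReal_add (by norm_num) (Finset.sum_nonneg fun i _ => by positivity)]
  change _ ≤ ENNReal.ofReal C * _
  rw [← ENNReal.ofReal_mul hC]
  refine ENNReal.ofReal_le_ofReal (h2.trans_eq ?_)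
  congr 2
  refine Finset.sum_congr rfl fun i _ => ?_
  rw [PiLp.smul_apply, smul_eq_mul, abs_mul, abs_of_pos (by positivity), inv_mul_eq_div]

lemma Tst0.sum_cdir_cdir {n : ℕ} {χ : Rn n → ℂ} (h : Tst0 χ) (ξ : Rn n) :
    ∑ i, _root_.cdir i (_root_.cdir i χ) ξ = χ ξ := by
  by_cases h0 : ξ = 0
  · have : χ ξ = 0 := by
      rw [h0]
      exact image_eq_zero_of_notMem_tsupport h.2
    simp [_root_.cdir, this]
  · have h1 : ‖ξ‖ ^ 2 ≠ 0 := pow_ne_zero 2 (norm_ne_zero_iff.2 h0)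
    simp only [_root_.cdir, ← mul_assoc, ← Finset.sum_mul]
    have h2 : ∑ i, ((ξ i / ‖ξ‖ : ℝ) : ℂ) * ((ξ i / ‖ξ‖ : ℝ) : ℂ) =
        ((∑ i, ξ i ^ 2) / ‖ξ‖ ^ 2 : ℝ) := by
      rw [Finset.sum_div]
      push_cast
      refine Finset.sum_congr rfl fun i _ => by ring
    rw [h2, ← EuclideanSpace.real_norm_sq_eq, div_self h1]
    simp

lemma Tst0.kern_wv_coord' {n : ℕ} {χ : Rn n → ℂ} (h : Tst0 χ) (t : ℝ) (i : Fin n) (w : Rn n) :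
    (w i : ℂ) * kern n (_root_.wv t χ) w =
      -t * kern n (_root_.wv t (_root_.cdir i χ)) w +
        Complex.I * kern n (_root_.wv t (_root_.pd i χ)) w := by
  have h1 := congrArg (fun z => Complex.I * z) (h.kern_wv_coord t i w)
  have hI := Complex.I_mul_I
  simp only at h1
  linear_combination h1 + ((w i : ℂ) * kern n (_root_.wv t χ) w +
    t * kern n (_root_.wv t (_root_.cdir i χ)) w) * hI

lemma Tst0.kern_wv_cone {n : ℕ} {χ : Rn n → ℂ} (h : Tst0 χ) (t : ℝ) (w : Rn n) :
    ((‖w‖ ^ 2 - t ^ 2 : ℝ) : ℂ) * kern n (_root_.wv t χ) w =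
      ∑ i, (-(Complex.I * t) * (kern n (_root_.wv t (_root_.pd i (_root_.cdir i χ))) w +
        kern n (_root_.wv t (_root_.cdir i (_root_.pd i χ))) w) -
        kern n (_root_.wv t (_root_.pd i (_root_.pd i χ))) w) := by
  have hI := Complex.I_mul_I
  have e1 : ∀ i, (w i : ℂ) ^ 2 * kern n (_root_.wv t χ) w -
      t ^ 2 * kern n (_root_.wv t (_root_.cdir i (_root_.cdir i χ))) w =
      (-(Complex.I * t) * (kern n (_root_.wv t (_root_.pd i (_root_.cdir i χ))) w +
        kern n (_root_.wv t (_root_.cdir i (_root_.pd i χ))) w) -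
        kern n (_root_.wv t (_root_.pd i (_root_.pd i χ))) w) := by
    intro i
    have a1 := h.kern_wv_coord' t i w
    have a2 := (h.cdir i).kern_wv_coord' t i w
    have a3 := (h.pd i).kern_wv_coord' t i w
    linear_combination (w i : ℂ) * a1 - t * a2 + Complex.I * a3 +
      kern n (_root_.wv t (_root_.pd i (_root_.pd i χ))) w * hI
  have e2 : ∑ i, kern n (_root_.wv t (_root_.cdir i (_root_.cdir i χ))) w =
      kern n (_root_.wv t χ) w := by
    rw [← kern_sum _ fun i _ => (((h.cdir i).cdir i).wv t).1.integrable]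
    congr 1
    ext ξ
    unfold _root_.wv
    rw [← Finset.mul_sum, h.sum_cdir_cdir]
  rw [← Finset.sum_congr rfl fun i _ => e1 i, Finset.sum_sub_distrib, ← Finset.mul_sum, e2,
    ← Finset.sum_mul, EuclideanSpace.real_norm_sq_eq]
  push_cast
  ring

lemma Tst0.abs_cone_mul_norm_kern_wv_le {n : ℕ} {χ : Rn n → ℂ} (h : Tst0 χ) {T : ℝ} (hT : 1 ≤ T)
    (w : Rn n) : |‖w‖ ^ 2 - T ^ 2| / T * ‖kern n (_root_.wv T χ) w‖ ≤
      ∑ i, ((‖kern n (_root_.wv T (_root_.pd i (_root_.cdir i χ))) w‖ +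
        ‖kern n (_root_.wv T (_root_.cdir i (_root_.pd i χ))) w‖) +
        ‖kern n (_root_.wv T (_root_.pd i (_root_.pd i χ))) w‖) := by
  have hT0 : 0 < T := by linarith
  have h1 := congrArg norm (h.kern_wv_cone T w)
  rw [norm_mul, Complex.norm_real, Real.norm_eq_abs] at h1
  rw [div_mul_eq_mul_div, div_le_iff₀ hT0, h1, Finset.sum_mul]
  refine (norm_sum_le _ _).trans (Finset.sum_le_sum fun i _ => (norm_sub_le _ _).trans ?_)
  rw [norm_mul, norm_neg, norm_mul, Complex.norm_I, one_mul, Complex.norm_real,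
    Real.norm_of_nonneg hT0.le]
  have h2 := norm_add_le (kern n (_root_.wv T (_root_.pd i (_root_.cdir i χ))) w)
    (kern n (_root_.wv T (_root_.cdir i (_root_.pd i χ))) w)
  nlinarith [norm_nonneg (kern n (_root_.wv T (_root_.pd i (_root_.pd i χ))) w)]

lemma Tst0.l2Bdd_cone {n : ℕ} (L : ℕ) {χ : Rn n → ℂ} (h : Tst0 χ) :
    L2Bdd (fun T w => ENNReal.ofReal ((1 + ‖w‖ / T) ^ L * (|‖w‖ ^ 2 - T ^ 2| / T)) *
      ‖kern n (_root_.wv T χ) w‖ₑ) := by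
  have hb := L2Bdd.sum Finset.univ fun i =>
    ((((h.cdir i).pd i).l2Bdd_weight L).add (((h.pd i).cdir i).l2Bdd_weight L)).add
      (((h.pd i).pd i).l2Bdd_weight L)
  refine hb.mono (fun T => h.measurable_wv (by fun_prop) T) fun T w hT => ?_
  have hT0 : 0 < T := by linarith
  simp only [← mul_add, ← Finset.mul_sum]
  rw [ENNReal.ofReal_mul (by positivity), mul_assoc]
  refine mul_le_mul_right ?_ _
  simp only [← ofReal_norm]
  simp only [← ENNReal.ofReal_add, norm_nonneg, add_nonneg]
  rw [← ENNReal.ofReal_mul (by positivity), ← ENNReal.ofReal_sum_of_nonneg fun i _ => by positivity]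
  exact ENNReal.ofReal_le_ofReal (h.abs_cone_mul_norm_kern_wv_le hT w)

lemma integrable_inv_sub_sq_add_sq (T : ℝ) {μ : ℝ} (hμ : 0 < μ) :
    Integrable (fun y : ℝ => ((y - T) ^ 2 + μ ^ 2)⁻¹) ∧
      ∫ y : ℝ, ((y - T) ^ 2 + μ ^ 2)⁻¹ = Real.pi / μ := by
  have e : (fun y : ℝ => ((y - T) ^ 2 + μ ^ 2)⁻¹) =
      fun y => (μ ^ 2)⁻¹ * (1 + ((y - T) / μ) ^ 2)⁻¹ := by
    ext y
    rw [← mul_inv]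
    congr 1
    field_simp
    ring
  rw [e]
  have h1 := (integrable_inv_one_add_sq.comp_div hμ.ne').comp_sub_right T
  refine ⟨h1.const_mul _, ?_⟩
  rw [integral_const_mul, integral_sub_right_eq_self (fun y => (1 + (y / μ) ^ 2)⁻¹) T,
    Measure.integral_comp_div (fun y => (1 + y ^ 2)⁻¹) μ, integral_univ_inv_one_add_sq, abs_of_pos hμ,
    smul_eq_mul]
  field_simp

/-- The surface measure constant in polar coordinates. -/
def polarConst (n : ℕ) : ℝ := n * (volume : Measure (Rn n)).real (Metric.ball 0 1)

lemma polarConst_nonneg (n : ℕ) : 0 ≤ polarConst n := by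
  unfold polarConst
  positivity

lemma lintegral_norm_le {n : ℕ} (hn : 1 ≤ n) {f : ℝ → ℝ} (hf : ∀ r, 0 ≤ r → 0 ≤ f r) {g : ℝ → ℝ}
    (hg : Integrable g) (hg0 : ∀ r, 0 ≤ g r) (h : ∀ r, 0 < r → r ^ (n - 1) * f r ≤ g r)
    (hfm : Measurable f) :
    ∫⁻ x : Rn n, ENNReal.ofReal (f ‖x‖) ≤ ENNReal.ofReal (polarConst n * ∫ r, g r) := by
  have : Nonempty (Fin n) := ⟨⟨0, hn⟩⟩
  have hi : IntegrableOn (fun y : ℝ => y ^ (Module.finrank ℝ (Rn n) - 1) • f y) (Set.Ioi 0) := by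
    refine hg.integrableOn.mono' (by fun_prop) ?_
    filter_upwards [self_mem_ae_restrict measurableSet_Ioi] with r hr
    have hr' : (0 : ℝ) < r := hr
    rw [finrank_euclideanSpace_fin, smul_eq_mul, Real.norm_of_nonneg
      (mul_nonneg (by positivity) (hf r hr'.le))]
    exact h r hr
  have h1 := (integrable_fun_norm_addHaar (volume : Measure (Rn n)) (f := f)).2 hi
  rw [← ofReal_integral_eq_lintegral_ofReal h1
    (Filter.Eventually.of_forall fun x => hf _ (norm_nonneg x))]
  refine ENNReal.ofReal_le_ofReal ?_
  rw [integral_fun_norm_addHaar (volume : Measure (Rn n)) f, finrank_euclideanSpace_fin,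
    nsmul_eq_mul, smul_eq_mul, ← mul_assoc]
  unfold polarConst
  refine mul_le_mul_of_nonneg_left ?_ (by positivity)
  refine le_trans ?_ (setIntegral_le_integral hg (s := Set.Ioi 0) (Filter.Eventually.of_forall hg0))
  rw [finrank_euclideanSpace_fin] at hi
  refine setIntegral_mono_on hi hg.integrableOn measurableSet_Ioi fun r hr => ?_
  simpa using h r hr

lemma lintegral_radial_le {n : ℕ} (hn : 1 ≤ n) (T : ℝ) {μ : ℝ} (hμ : 0 < μ) :
    ∫⁻ x : Rn n, ENNReal.ofReal ((‖x‖ ^ (n - 1))⁻¹ * ((‖x‖ - T) ^ 2 + μ ^ 2)⁻¹) ≤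
      ENNReal.ofReal (polarConst n * (Real.pi / μ)) := by
  obtain ⟨h1, h2⟩ := integrable_inv_sub_sq_add_sq T hμ
  rw [← h2]
  refine lintegral_norm_le hn (f := fun r => (r ^ (n - 1))⁻¹ * ((r - T) ^ 2 + μ ^ 2)⁻¹)
    (fun r hr => by positivity) h1 (fun r => by positivity) (fun r hr => ?_) (by fun_prop)
  rw [← mul_assoc, mul_inv_cancel₀ (by positivity), one_mul]

/-- Thin spherical shells have small volume. -/
lemma volume_shell_le {n : ℕ} (hn : 1 ≤ n) (c : Rn n) {δ : ℝ} (hδ : 0 < δ) :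
    volume {x : Rn n | |‖x - c‖ - 1| ≤ δ} ≤
      ENNReal.ofReal (polarConst n * ((1 + δ) ^ (n - 1) * (2 * δ))) := by
  set f : ℝ → ℝ := (Set.Icc (1 - δ) (1 + δ)).indicator 1 with hf
  have hm : MeasurableSet (Set.Icc (1 - δ) (1 + δ)) := measurableSet_Icc
  have e : volume {x : Rn n | |‖x - c‖ - 1| ≤ δ} = ∫⁻ x : Rn n, ENNReal.ofReal (f ‖x‖) := by
    rw [← lintegral_sub_right_eq_self (fun x : Rn n => ENNReal.ofReal (f ‖x‖)) c]
    have hms : MeasurableSet {x : Rn n | |‖x - c‖ - 1| ≤ δ} :=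
      (isClosed_le (by fun_prop) continuous_const).measurableSet
    rw [← lintegral_indicator_one hms]
    refine lintegral_congr fun x => ?_
    by_cases h : |‖x - c‖ - 1| ≤ δ
    · have h' : ‖x - c‖ ∈ Set.Icc (1 - δ) (1 + δ) := by
        rw [abs_le] at h
        exact ⟨by linarith, by linarith⟩
      simp [hf, h, h']
    · have h' : ‖x - c‖ ∉ Set.Icc (1 - δ) (1 + δ) := fun h2 => h
        (abs_le.2 ⟨by linarith [h2.1], by linarith [h2.2]⟩)
      simp [hf, h, h']
  rw [e]
  have hi : ∫ r, (Set.Icc (1 - δ) (1 + δ)).indicator (fun _ => (1 + δ) ^ (n - 1)) r =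
      (1 + δ) ^ (n - 1) * (2 * δ) := by
    rw [integral_indicator hm, setIntegral_const, smul_eq_mul, Real.volume_real_Icc_of_le
      (by linarith)]
    ring
  rw [← hi]
  refine lintegral_norm_le hn (fun r _ => Set.indicator_nonneg (by simp) r)
    ((integrable_indicator_iff hm).2 (integrableOn_const (by simp)))
    (fun r => Set.indicator_nonneg (fun _ _ => by positivity) r) (fun r hr => ?_)
    (measurable_one.indicator hm)
  by_cases h : r ∈ Set.Icc (1 - δ) (1 + δ)
  · simp only [Set.indicator_of_mem h, Pi.one_apply, mul_one]
    exact pow_le_pow_left₀ hr.le h.2 _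
  · simp [Set.indicator_of_notMem h]

lemma Tst0.exists_far_le {n : ℕ} (hn : 1 ≤ n) {χ : Rn n → ℂ} (h : Tst0 χ) :
    ∃ C : ℝ≥0, ∀ T μ : ℝ, 1 ≤ T → 0 < μ →
      (∫⁻ w in {w : Rn n | μ ≤ |‖w‖ - T|}, ‖kern n (_root_.wv T χ) w‖ₑ) ^ 2 ≤
        C * ENNReal.ofReal (T ^ (n - 1) / μ) := by
  have : Nonempty (Fin n) := ⟨⟨0, hn⟩⟩
  obtain ⟨C, hC⟩ := (h.l2Bdd_cone n).2
  refine ⟨C * (2 * (polarConst n * Real.pi)).toNNReal, fun T μ hT hμ => ?_⟩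
  have hT0 : 0 < T := by linarith
  set W : Rn n → ℝ := fun w => (1 + ‖w‖ / T) ^ n * (|‖w‖ ^ 2 - T ^ 2| / T) with hW
  have hWc : Continuous W := by
    rw [hW]
    fun_prop
  set S := {w : Rn n | μ ≤ |‖w‖ - T|} with hS
  have hSm : MeasurableSet S := (isClosed_le continuous_const (by fun_prop)).measurableSet
  have hk : Measurable (fun w => ‖kern n (_root_.wv T χ) w‖ₑ) :=
    (_root_.continuous_kern (h.wv T).1.integrable).measurable.enorm
  have hpos : ∀ w ∈ S, |‖w‖ - T| ≤ |‖w‖ ^ 2 - T ^ 2| / T := by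
    intro w hw
    have e : ‖w‖ ^ 2 - T ^ 2 = (‖w‖ - T) * (‖w‖ + T) := by ring
    rw [le_div_iff₀ hT0, e, abs_mul, abs_of_pos (by positivity : 0 < ‖w‖ + T)]
    gcongr
    linarith [norm_nonneg w]
  have hWp : ∀ w ∈ S, 0 < W w := by
    intro w hw
    have h1 := hpos w hw
    have h2 : μ ≤ |‖w‖ - T| := hw
    have : 0 < |‖w‖ ^ 2 - T ^ 2| / T := by linarith
    rw [hW]
    positivity
  have e1 : ∫⁻ w in S, ‖kern n (_root_.wv T χ) w‖ₑ =
      ∫⁻ w, (ENNReal.ofReal (W w) * ‖kern n (_root_.wv T χ) w‖ₑ) *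
        S.indicator (fun w => ENNReal.ofReal (W w)⁻¹) w := by
    rw [← lintegral_indicator hSm]
    refine lintegral_congr fun w => ?_
    by_cases hw : w ∈ S
    · rw [Set.indicator_of_mem hw, Set.indicator_of_mem hw, mul_right_comm,
        ← ENNReal.ofReal_mul (hWp w hw).le, mul_inv_cancel₀ (hWp w hw).ne', ENNReal.ofReal_one,
        one_mul]
    · simp [Set.indicator_of_notMem hw]
  have e2 : ∫⁻ w, S.indicator (fun w => ENNReal.ofReal (W w)⁻¹) w ^ 2 ≤
      ENNReal.ofReal (2 * T ^ (n - 1)) * ENNReal.ofReal (polarConst n * (Real.pi / μ)) := by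
    refine le_trans ?_ (mul_le_mul_right (lintegral_radial_le hn T hμ) _)
    rw [← lintegral_const_mul' _ _ ENNReal.ofReal_ne_top]
    refine lintegral_mono_ae ?_
    filter_upwards [compl_mem_ae_iff.2 (measure_singleton (0 : Rn n))] with w hw0
    have hr : 0 < ‖w‖ := norm_pos_iff.2 hw0
    by_cases hw : w ∈ S
    · rw [Set.indicator_of_mem hw, ← ENNReal.ofReal_pow (inv_nonneg.2 (hWp w hw).le),
        ← ENNReal.ofReal_mul (by positivity)]
      refine ENNReal.ofReal_le_ofReal ?_
      have hW2 : (‖w‖ / T) ^ (n - 1) * (((‖w‖ - T) ^ 2 + μ ^ 2) / 2) ≤ W w ^ 2 := by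
        rw [hW]
        simp only [mul_pow]
        have a1 : (‖w‖ / T) ^ (n - 1) ≤ ((1 + ‖w‖ / T) ^ n) ^ 2 := by
          have b1 : 0 ≤ ‖w‖ / T := by positivity
          rw [← pow_mul]
          refine (pow_le_pow_left₀ b1 (by linarith : ‖w‖ / T ≤ 1 + ‖w‖ / T) _).trans
            (pow_le_pow_right₀ (by linarith) (by omega))
        have a2 : ((‖w‖ - T) ^ 2 + μ ^ 2) / 2 ≤ (|‖w‖ ^ 2 - T ^ 2| / T) ^ 2 := by
          have h1 : μ ^ 2 ≤ |‖w‖ - T| ^ 2 := pow_le_pow_left₀ hμ.le hw 2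
          have h2 := pow_le_pow_left₀ (abs_nonneg _) (hpos w hw) 2
          rw [sq_abs] at h1 h2
          linarith
        exact mul_le_mul a1 a2 (by positivity) (by positivity)
      rw [inv_pow]
      refine (inv_anti₀ (by positivity) hW2).trans_eq ?_
      rw [div_pow]
      field_simp
    · simp [Set.indicator_of_notMem hw]
  have hmI : Measurable (S.indicator fun w => ENNReal.ofReal (W w)⁻¹) :=
    (ENNReal.measurable_ofReal.comp hWc.measurable.inv).indicator hSm
  rw [e1]
  refine (lintegral_mul_sq_le ((ENNReal.measurable_ofReal.comp hWc.measurable).mul hk) hmI).trans ?_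
  refine (mul_le_mul' (hC T hT) e2).trans_eq ?_
  rw [ENNReal.coe_mul, mul_assoc]
  congr 1
  change _ = ENNReal.ofReal _ * _
  have := polarConst_nonneg n
  rw [← ENNReal.ofReal_mul (by positivity), ← ENNReal.ofReal_mul (by positivity)]
  congr 1
  ring

/-- The kernel of the frequency localised half-wave propagator. -/
def waveKern {n : ℕ} (χ : Rn n → ℂ) (k : ℕ) : Rn n → ℂ := kern n (fun ξ => wavePh ξ * dil k χ ξ)

lemma wavePh_mul_dil {n : ℕ} (χ : Rn n → ℂ) (k : ℕ) :
    (fun ξ => wavePh ξ * dil k χ ξ) = dil k (wv ((2 : ℝ) ^ k) χ) := by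
  ext ξ
  unfold wavePh dil wv
  rw [norm_smul, norm_inv, Real.norm_of_nonneg (by positivity : (0 : ℝ) ≤ 2 ^ k),
    mul_inv_cancel_left₀ (by positivity)]

lemma waveKern_apply {n : ℕ} (χ : Rn n → ℂ) (k : ℕ) (x : Rn n) :
    waveKern χ k x = (((2 : ℝ) ^ k) ^ n : ℝ) * kern n (wv ((2 : ℝ) ^ k) χ) ((2 : ℝ) ^ k • x) := by
  unfold waveKern
  rw [wavePh_mul_dil, kern_dil]

lemma Tst0.tst_wavePh_mul {n : ℕ} {χ : Rn n → ℂ} (h : Tst0 χ) (k : ℕ) :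
    Tst (fun ξ => wavePh ξ * _root_.dil k χ ξ) := by
  rw [wavePh_mul_dil]
  exact (h.wv _).1.dil k

lemma Tst0.integrable_waveKern {n : ℕ} {χ : Rn n → ℂ} (h : Tst0 χ) (k : ℕ) :
    Integrable (waveKern χ k) := (h.tst_wavePh_mul k).integrable_kern

lemma Tst0.continuous_waveKern {n : ℕ} {χ : Rn n → ℂ} (h : Tst0 χ) (k : ℕ) :
    Continuous (waveKern χ k) := _root_.continuous_kern (h.tst_wavePh_mul k).integrable

lemma Tst0.exists_waveKern_far_le {n : ℕ} (hn : 1 ≤ n) {χ : Rn n → ℂ} (h : Tst0 χ) :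
    ∃ C : ℝ≥0, ∀ (k : ℕ) (r : ℝ), 0 < r →
      (∫⁻ w in {w : Rn n | r ≤ |‖w‖ - 1|}, ‖waveKern χ k w‖ₑ) ^ 2 ≤
        C * ENNReal.ofReal (((2 : ℝ) ^ k) ^ (n - 1) / ((2 : ℝ) ^ k * r)) := by
  obtain ⟨C, hC⟩ := h.exists_far_le hn
  refine ⟨C, fun k r hr => ?_⟩
  have hk : (0 : ℝ) < 2 ^ k := by positivity
  have hk1 : (1 : ℝ) ≤ 2 ^ k := one_le_pow₀ (by norm_num)
  refine le_trans (le_of_eq ?_) (hC (2 ^ k) (2 ^ k * r) hk1 (by positivity))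
  congr 1
  set K : Rn n → ℂ := kern n (_root_.wv ((2 : ℝ) ^ k) χ) with hK
  have hKc : Continuous K := _root_.continuous_kern (h.wv _).1.integrable
  have hA : MeasurableSet {w : Rn n | r ≤ |‖w‖ - 1|} :=
    measurableSet_le measurable_const (continuous_norm.sub continuous_const).abs.measurable
  have hB : MeasurableSet {w : Rn n | 2 ^ k * r ≤ |‖w‖ - 2 ^ k|} :=
    measurableSet_le measurable_const (continuous_norm.sub continuous_const).abs.measurable
  rw [← lintegral_indicator hA, ← lintegral_indicator hB]
  have hpt : ∀ w, {w : Rn n | r ≤ |‖w‖ - 1|}.indicator (fun w => ‖waveKern χ k w‖ₑ) w =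
      ENNReal.ofReal (((2 : ℝ) ^ k) ^ n) *
        {w : Rn n | 2 ^ k * r ≤ |‖w‖ - 2 ^ k|}.indicator (fun w => ‖K w‖ₑ) ((2 : ℝ) ^ k • w) := by
    intro w
    have hiff : w ∈ {w : Rn n | r ≤ |‖w‖ - 1|} ↔
        (2 : ℝ) ^ k • w ∈ {w : Rn n | 2 ^ k * r ≤ |‖w‖ - 2 ^ k|} := by
      simp only [Set.mem_ofPred_eq]
      rw [norm_smul, Real.norm_of_nonneg hk.le, show (2 : ℝ) ^ k * ‖w‖ - 2 ^ k =
        2 ^ k * (‖w‖ - 1) by ring, abs_mul, abs_of_pos hk, mul_le_mul_iff_right₀ hk]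
    by_cases hw : w ∈ {w : Rn n | r ≤ |‖w‖ - 1|}
    · rw [Set.indicator_of_mem hw, Set.indicator_of_mem (hiff.1 hw), waveKern_apply, enorm_mul,
        ← ofReal_norm, Complex.norm_real, Real.norm_of_nonneg (by positivity)]
    · rw [Set.indicator_of_notMem hw, Set.indicator_of_notMem (fun h' => hw (hiff.2 h')), mul_zero]
  simp_rw [hpt]
  have hm : Measurable
      ({w : Rn n | 2 ^ k * r ≤ |‖w‖ - 2 ^ k|}.indicator (fun w => ‖K w‖ₑ)) :=
    hKc.measurable.enorm.indicator hB
  rw [lintegral_const_mul' _ _ (by finiteness), lintegral_comp_smul' _ hm hk, ← mul_assoc,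
    ← ENNReal.ofReal_mul (by positivity), mul_inv_cancel₀ (by positivity), ENNReal.ofReal_one,
    one_mul]

lemma lintegral_enorm_sq_kern {n : ℕ} {u : Rn n → ℂ} (hc : Continuous u) (hu : Integrable u)
    (hk : Integrable (kern n u)) :
    ∫⁻ x, ‖kern n u x‖ₑ ^ 2 = ‖kern n (fun ξ => u ξ * (starRingEnd ℂ) (u ξ)) 0‖ₑ := by
  have h := integral_kern_mul_conj hc hu hk 0
  have e1 : ∀ z : ℂ, z * (starRingEnd ℂ) z = ((‖z‖ ^ 2 : ℝ) : ℂ) := fun z => by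
    rw [Complex.mul_conj, Complex.normSq_eq_norm_sq]
  have h1 : ∫ x, kern n u (x + 0) * (starRingEnd ℂ) (kern n u x) =
      ((∫ x, ‖kern n u x‖ ^ 2 : ℝ) : ℂ) := by
    rw [← integral_complex_ofReal]
    refine integral_congr_ae (Filter.Eventually.of_forall fun x => ?_)
    simp only [add_zero]
    exact e1 _
  have h4 : Integrable (fun x => ‖kern n u x‖ ^ 2) := by
    have := hk.norm.bdd_mul (c := ∫ ξ, ‖u ξ‖) hk.norm.aestronglyMeasurable
      (Filter.Eventually.of_forall fun x => by rw [norm_norm]; exact norm_kern_le u x)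
    simpa only [pow_two] using this
  rw [← h, h1, ← ofReal_norm, Complex.norm_real,
    Real.norm_of_nonneg (integral_nonneg fun x => by positivity),
    ofReal_integral_eq_lintegral_ofReal h4 (Filter.Eventually.of_forall fun x => by positivity)]
  refine lintegral_congr fun x => ?_
  rw [ENNReal.ofReal_pow (norm_nonneg _), ofReal_norm]

lemma continuous_ftransform {n : ℕ} {b : Rn n → ℂ} (hb : Integrable b) :
    Continuous (ftransform n b) := by
  have h : ftransform n b = fun ξ => ((((2 * Real.pi) ^ n : ℝ)) : ℂ) * kern n b (-ξ) := by
    ext ξ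
    unfold ftransform kern
    rw [← mul_assoc]
    have : (((2 * Real.pi) ^ n : ℝ) : ℂ) * ((((2 * Real.pi) ^ n)⁻¹ : ℝ) : ℂ) = 1 := by
      rw [← Complex.ofReal_mul, mul_inv_cancel₀ (by positivity), Complex.ofReal_one]
    rw [this, one_mul]
    congr 1 with x
    rw [inner_neg_left, real_inner_comm, Complex.ofReal_neg, mul_neg]
  rw [h]
  exact continuous_const.mul ((continuous_kern hb).comp continuous_neg)

/-- Restricted form of Young's inequality. -/
lemma lintegral_enorm_conv_on_le {n : ℕ} {K b : Rn n → ℂ} (hK : Continuous K) (hb : Measurable b)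
    {S A : Set (Rn n)} (hS : MeasurableSet S) (hA : MeasurableSet A)
    (hSA : ∀ x ∈ S, ∀ y, b y ≠ 0 → x - y ∈ A) :
    ∫⁻ x in S, ‖∫ y, K (x - y) * b y‖ₑ ≤ (∫⁻ x in A, ‖K x‖ₑ) * ∫⁻ x, ‖b x‖ₑ := by
  have hKA : Measurable (A.indicator fun z => ‖K z‖ₑ) := hK.measurable.enorm.indicator hA
  have hm : Measurable (fun p : Rn n × Rn n => (A.indicator fun z => ‖K z‖ₑ) (p.1 - p.2) *
      ‖b p.2‖ₑ) :=
    (hKA.comp (measurable_fst.sub measurable_snd)).mul (hb.comp measurable_snd).enorm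
  calc _ ≤ ∫⁻ x in S, ∫⁻ y, (A.indicator fun z => ‖K z‖ₑ) (x - y) * ‖b y‖ₑ := by
        refine setLIntegral_mono' hS fun x hx => (enorm_integral_le_lintegral_enorm _).trans ?_
        refine lintegral_mono fun y => ?_
        rw [enorm_mul]
        by_cases hy : b y = 0
        · simp [hy]
        · rw [Set.indicator_of_mem (hSA x hx y hy)]
    _ ≤ ∫⁻ x, ∫⁻ y, (A.indicator fun z => ‖K z‖ₑ) (x - y) * ‖b y‖ₑ := setLIntegral_le_lintegral _ _
    _ = ∫⁻ y, ∫⁻ x, (A.indicator fun z => ‖K z‖ₑ) (x - y) * ‖b y‖ₑ :=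
        lintegral_lintegral_swap hm.aemeasurable
    _ = ∫⁻ y, (∫⁻ x in A, ‖K x‖ₑ) * ‖b y‖ₑ := by
        refine lintegral_congr fun y => ?_
        rw [lintegral_mul_const' _ _ enorm_ne_top,
          lintegral_sub_right_eq_self (A.indicator fun z => ‖K z‖ₑ) y, lintegral_indicator hA]
    _ = _ := lintegral_const_mul _ hb.enorm

lemma integrable_conv_of_continuous {n : ℕ} {K b : Rn n → ℂ} (hK : Integrable K)
    (hb : Integrable b) : Integrable (fun x => ∫ y, K (x - y) * b y) := by
  have h := (hb.integrable_convolution (ContinuousLinearMap.mul ℝ ℂ) hK)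
  refine h.congr (Filter.Eventually.of_forall fun x => ?_)
  simp only [convolution, ContinuousLinearMap.mul_apply']
  congr 1 with y
  rw [mul_comm]

lemma Tst0.exists_waveKern_sq_le {n : ℕ} {χ : Rn n → ℂ} (h : Tst0 χ) :
    ∃ C : ℝ≥0, ∀ (k : ℕ) (b : Rn n → ℂ) (β : ℝ≥0∞), Measurable b → Integrable b →
      (∀ x, ‖b x‖ₑ ≤ β) →
      ∫⁻ x, ‖∫ y, waveKern χ k (x - y) * b y‖ₑ ^ 2 ≤ C * (β * ∫⁻ x, ‖b x‖ₑ) := by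
  have hfin : ∫⁻ x, ‖kern n χ x‖ₑ < ∞ := h.1.integrable_kern.2
  refine ⟨((∫⁻ x, ‖kern n χ x‖ₑ) ^ 2).toNNReal, fun k b β hbm hbi hβ => ?_⟩
  rw [ENNReal.coe_toNNReal (by finiteness)]
  set M := ∫⁻ x, ‖kern n χ x‖ₑ with hM
  have hd : Tst (_root_.dil k χ) := h.1.dil k
  have hMk : ∫⁻ x, ‖kern n (_root_.dil k χ) x‖ₑ = M := by
    have hk : (0 : ℝ) < 2 ^ k := by positivity
    have : ∀ x, ‖kern n (_root_.dil k χ) x‖ₑ =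
        ENNReal.ofReal (((2 : ℝ) ^ k) ^ n) * (fun w => ‖kern n χ w‖ₑ) ((2 : ℝ) ^ k • x) := by
      intro x
      rw [_root_.kern_dil, enorm_mul, ← ofReal_norm, Complex.norm_real,
        Real.norm_of_nonneg (by positivity)]
    simp_rw [this]
    rw [lintegral_const_mul' _ _ (by finiteness), lintegral_comp_smul' _
      (_root_.continuous_kern h.1.integrable).measurable.enorm hk, ← mul_assoc,
      ← ENNReal.ofReal_mul (by positivity), mul_inv_cancel₀ (by positivity), ENNReal.ofReal_one,
      one_mul]
  have key : ∀ ψ : Rn n → ℂ, Tst ψ → ∫⁻ x, ‖∫ y, kern n ψ (x - y) * b y‖ₑ ^ 2 =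
      ‖kern n (fun ξ => (ψ ξ * (starRingEnd ℂ) (ψ ξ)) *
        (ftransform n b ξ * (starRingEnd ℂ) (ftransform n b ξ))) 0‖ₑ := by
    intro ψ hψ
    have e : ∀ x, ∫ y, kern n ψ (x - y) * b y = kern n (fun ξ => ψ ξ * ftransform n b ξ) x :=
      fun x => (kern_mul_ftransform hψ.integrable hbi x).symm
    have hc : Continuous (fun ξ => ψ ξ * ftransform n b ξ) :=
      hψ.continuous.mul (continuous_ftransform hbi)
    have hi : Integrable (fun ξ => ψ ξ * ftransform n b ξ) :=
      hc.integrable_of_hasCompactSupport hψ.2.mul_right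
    have hk : Integrable (kern n (fun ξ => ψ ξ * ftransform n b ξ)) := by
      have := integrable_conv_of_continuous hψ.integrable_kern hbi
      simpa only [e] using this
    simp_rw [e]
    rw [lintegral_enorm_sq_kern hc hi hk]
    congr 2
    ext ξ
    rw [map_mul]
    ring
  have heq : ∫⁻ x, ‖∫ y, waveKern χ k (x - y) * b y‖ₑ ^ 2 =
      ∫⁻ x, ‖∫ y, kern n (_root_.dil k χ) (x - y) * b y‖ₑ ^ 2 := by
    unfold waveKern
    rw [key _ (h.tst_wavePh_mul k), key _ hd]
    congr 2
    ext ξ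
    congr 1
    rw [Complex.mul_conj, Complex.mul_conj, Complex.normSq_eq_norm_sq, Complex.normSq_eq_norm_sq,
      norm_mul, norm_wavePh, one_mul]
  rw [heq]
  have hcont : Continuous (kern n (_root_.dil k χ)) := _root_.continuous_kern hd.integrable
  have hsup : ∀ x, ‖∫ y, kern n (_root_.dil k χ) (x - y) * b y‖ₑ ≤ M * β := by
    intro x
    refine (enorm_integral_le_lintegral_enorm _).trans ?_
    calc _ ≤ ∫⁻ y, ‖kern n (_root_.dil k χ) (x - y)‖ₑ * β := by
          refine lintegral_mono fun y => ?_
          rw [enorm_mul]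
          exact mul_le_mul_right (hβ y) _
      _ = _ := by
          have hmx : Measurable (fun y => ‖kern n (_root_.dil k χ) (x - y)‖ₑ) :=
            (hcont.comp (continuous_sub_left x)).measurable.enorm
          rw [lintegral_mul_const _ hmx,
            lintegral_sub_left_eq_self (fun y => ‖kern n (_root_.dil k χ) y‖ₑ) x, hMk]
  have hL1 : ∫⁻ x, ‖∫ y, kern n (_root_.dil k χ) (x - y) * b y‖ₑ ≤ M * ∫⁻ x, ‖b x‖ₑ := by
    have := lintegral_enorm_conv_on_le hcont hbm MeasurableSet.univ MeasurableSet.univ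
      (fun _ _ _ _ => Set.mem_univ _)
    simpa only [Measure.restrict_univ, hMk] using this
  have hmeas : AEMeasurable (fun x => ‖∫ y, kern n (_root_.dil k χ) (x - y) * b y‖ₑ) volume :=
    (integrable_conv_of_continuous hd.integrable_kern hbi).aestronglyMeasurable.aemeasurable.enorm
  calc _ ≤ ∫⁻ x, (M * β) * ‖∫ y, kern n (_root_.dil k χ) (x - y) * b y‖ₑ := by
        refine lintegral_mono fun x => ?_
        rw [pow_two]
        exact mul_le_mul_left (hsup x) _
    _ = (M * β) * ∫⁻ x, ‖∫ y, kern n (_root_.dil k χ) (x - y) * b y‖ₑ :=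
        lintegral_const_mul'' _ hmeas
    _ ≤ (M * β) * (M * ∫⁻ x, ‖b x‖ₑ) := mul_le_mul_right hL1 _
    _ = _ := by ring

/-- The gain for an atom at scale `2^{-i}` propagated at frequency `2^{i+d}`. -/
def atomGain (n i d : ℕ) : ℝ≥0∞ :=
  ENNReal.ofReal (Real.sqrt ((2 : ℝ) ^ (i + d)) ^ (n - 1) * (Real.sqrt 2)⁻¹ ^ d)

lemma atomGain_sq (n i d : ℕ) :
    atomGain n i d ^ 2 = ENNReal.ofReal (((2 : ℝ) ^ (i + d)) ^ (n - 1) * (2 ^ d)⁻¹) := by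
  unfold atomGain
  have h1 : ((Real.sqrt 2)⁻¹ ^ d) ^ 2 = ((2 : ℝ) ^ d)⁻¹ := by
    rw [← pow_mul, mul_comm, pow_mul, inv_pow, Real.sq_sqrt (by norm_num), inv_pow]
  rw [← ENNReal.ofReal_pow (by positivity), mul_pow, h1, ← pow_mul, mul_comm (n - 1), pow_mul,
    Real.sq_sqrt (by positivity)]

lemma measurable_conv {n : ℕ} {K b : Rn n → ℂ} (hK : Measurable K) (hb : Measurable b) :
    Measurable (fun x => ∫ y, K (x - y) * b y) := by
  have hm : Measurable (fun p : Rn n × Rn n => K (p.1 - p.2) * b p.2) :=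
    (hK.comp (measurable_fst.sub measurable_snd)).mul (hb.comp measurable_snd)
  exact (hm.stronglyMeasurable.integral_prod_right').measurable

lemma setLIntegral_sq_le {n : ℕ} {F : Rn n → ℝ≥0∞} (hF : Measurable F) {S : Set (Rn n)}
    (hS : MeasurableSet S) : (∫⁻ x in S, F x) ^ 2 ≤ volume S * ∫⁻ x, F x ^ 2 := by
  have h := lintegral_mul_sq_le (measurable_const.indicator hS : Measurable
    (S.indicator fun _ : Rn n => (1 : ℝ≥0∞))) hF
  have e1 : ∀ x, S.indicator (fun _ : Rn n => (1 : ℝ≥0∞)) x * F x = S.indicator F x := fun x => by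
    by_cases hx : x ∈ S <;> simp [hx]
  have e2 : ∀ x, S.indicator (fun _ : Rn n => (1 : ℝ≥0∞)) x ^ 2 =
      S.indicator (fun _ : Rn n => (1 : ℝ≥0∞)) x := fun x => by
    by_cases hx : x ∈ S <;> simp [hx]
  simp_rw [e1, e2] at h
  rw [lintegral_indicator hS, lintegral_indicator hS, setLIntegral_one] at h
  exact h

lemma ENNReal.le_mul_of_sq_le {X Y : ℝ≥0∞} (D : ℝ≥0∞) (h : X ^ 2 ≤ D * Y ^ 2) :
    X ≤ (D + 1) * Y := by
  have h1 : X ^ 2 ≤ ((D + 1) * Y) ^ 2 := by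
    refine h.trans ?_
    rw [mul_pow]
    refine mul_le_mul_left ?_ _
    calc D ≤ D + 1 := le_self_add
      _ = (D + 1) * 1 := (mul_one _).symm
      _ ≤ (D + 1) * (D + 1) := mul_le_mul_right le_add_self _
      _ = _ := (pow_two _).symm
  exact (ENNReal.pow_le_pow_left_iff two_ne_zero).1 h1

lemma atom_near_aux {n : ℕ} (hn : 2 ≤ n) (i d : ℕ) {c : ℝ} (hc : 0 ≤ c) :
    c * ((1 + 2 * (n * ((2 : ℝ) ^ i)⁻¹)) ^ (n - 1) * (2 * (2 * (n * ((2 : ℝ) ^ i)⁻¹)))) ≤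
      (c * (1 + 2 * n) ^ (n - 1) * (4 * n)) *
        ((((2 : ℝ) ^ i)⁻¹) ^ n * (((2 : ℝ) ^ (i + d)) ^ (n - 1) * (2 ^ d)⁻¹)) := by
  obtain ⟨m, rfl⟩ := Nat.exists_eq_add_of_le hn
  have hi : (1 : ℝ) ≤ 2 ^ i := one_le_pow₀ (by norm_num)
  have hd : (1 : ℝ) ≤ 2 ^ d := one_le_pow₀ (by norm_num)
  have hi' : ((2 : ℝ) ^ i)⁻¹ ≤ 1 := inv_le_one_of_one_le₀ hi
  have e : ((2 : ℝ) ^ i)⁻¹ ≤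
      (((2 : ℝ) ^ i)⁻¹) ^ (2 + m) * (((2 : ℝ) ^ (i + d)) ^ (2 + m - 1) * (2 ^ d)⁻¹) := by
    rw [show 2 + m - 1 = m + 1 by omega, pow_add 2 i d]
    set a := (2 : ℝ) ^ i
    set b := (2 : ℝ) ^ d
    have : a⁻¹ ^ (2 + m) * ((a * b) ^ (m + 1) * b⁻¹) = a⁻¹ * b ^ m := by
      have ha : a ≠ 0 := by positivity
      have hb : b ≠ 0 := by positivity
      rw [show 2 + m = (m + 1) + 1 by omega, pow_succ, mul_pow, pow_succ b m, inv_pow]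
      field_simp
    rw [this]
    exact le_mul_of_one_le_right (by positivity) (one_le_pow₀ hd)
  have h1 : (1 + 2 * (((2 + m : ℕ) : ℝ) * ((2 : ℝ) ^ i)⁻¹)) ^ (2 + m - 1) ≤
      (1 + 2 * ((2 + m : ℕ) : ℝ)) ^ (2 + m - 1) := by
    gcongr
    exact mul_le_of_le_one_right (by positivity) hi'
  calc _ = c * (1 + 2 * (((2 + m : ℕ) : ℝ) * ((2 : ℝ) ^ i)⁻¹)) ^ (2 + m - 1) *
        (4 * ((2 + m : ℕ) : ℝ)) * ((2 : ℝ) ^ i)⁻¹ := by ring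
    _ ≤ _ := by gcongr

/-- The half-wave propagator acting on a bounded function supported in a ball of radius
comparable to `2^{-i}`. -/
lemma Tst0.exists_atom_le {n : ℕ} (hn : 2 ≤ n) {χ : Rn n → ℂ} (h : Tst0 χ) :
    ∃ C : ℝ≥0, ∀ (i d : ℕ) (c : Rn n) (b : Rn n → ℂ) (β : ℝ≥0∞), β ≠ ∞ → Measurable b →
      (∀ x, ‖b x‖ₑ ≤ β) → (∀ x, b x ≠ 0 → ‖x - c‖ ≤ n * ((2 : ℝ) ^ i)⁻¹) →
      (∫⁻ x, ‖b x‖ₑ ≤ β * ENNReal.ofReal ((((2 : ℝ) ^ i)⁻¹) ^ n)) →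
      ∫⁻ x, ‖∫ y, waveKern χ (i + d) (x - y) * b y‖ₑ ≤
        C * (β * ENNReal.ofReal ((((2 : ℝ) ^ i)⁻¹) ^ n) * atomGain n i d) := by
  have hn1 : 1 ≤ n := by omega
  obtain ⟨C2, hC2⟩ := h.exists_waveKern_sq_le
  obtain ⟨C3, hC3⟩ := h.exists_waveKern_far_le hn1
  set D : ℝ := polarConst n * (1 + 2 * n) ^ (n - 1) * (4 * n) with hD
  refine ⟨(C2 * D.toNNReal + 1) + (C3 + 1), fun i d c b β hβ hbm hb hsupp hL1 => ?_⟩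
  set V : ℝ≥0∞ := ENNReal.ofReal ((((2 : ℝ) ^ i)⁻¹) ^ n) with hV
  have hbi : Integrable b := ⟨hbm.aestronglyMeasurable, hL1.trans_lt (by finiteness)⟩
  have hn0 : (0 : ℝ) < n := by exact_mod_cast (by omega : 0 < n)
  set r : ℝ := n * ((2 : ℝ) ^ i)⁻¹ with hr
  have hr0 : 0 < r := by positivity
  set F : Rn n → ℝ≥0∞ := fun x => ‖∫ y, waveKern χ (i + d) (x - y) * b y‖ₑ with hF
  have hKc := h.continuous_waveKern (i + d)
  have hFm : Measurable F := (measurable_conv hKc.measurable hbm).enorm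
  set S : Set (Rn n) := {x | |‖x - c‖ - 1| ≤ 2 * r} with hS
  have hSm : MeasurableSet S := measurableSet_le
    (((continuous_id.sub continuous_const).norm.sub continuous_const).abs.measurable)
    measurable_const
  have hAm : MeasurableSet {w : Rn n | r ≤ |‖w‖ - 1|} :=
    measurableSet_le measurable_const (continuous_norm.sub continuous_const).abs.measurable
  have hnear : ∫⁻ x in S, F x ≤ (C2 * D.toNNReal + 1) * (β * V * atomGain n i d) := by
    refine ENNReal.le_mul_of_sq_le _ ?_
    calc (∫⁻ x in S, F x) ^ 2 ≤ volume S * ∫⁻ x, F x ^ 2 := setLIntegral_sq_le hFm hSm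
      _ ≤ ENNReal.ofReal (polarConst n * ((1 + 2 * r) ^ (n - 1) * (2 * (2 * r)))) *
          (C2 * (β * (β * V))) := by
          refine mul_le_mul' (volume_shell_le hn1 c (by positivity)) ?_
          refine (hC2 (i + d) b β hbm hbi hb).trans ?_
          exact mul_le_mul_right (mul_le_mul_right hL1 _) _
      _ ≤ ENNReal.ofReal (D * ((((2 : ℝ) ^ i)⁻¹) ^ n *
          (((2 : ℝ) ^ (i + d)) ^ (n - 1) * (2 ^ d)⁻¹))) * (C2 * (β * (β * V))) :=
          mul_le_mul_left (ENNReal.ofReal_le_ofReal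
            (atom_near_aux hn i d (polarConst_nonneg n))) _
      _ = _ := by
          have hD0 : 0 ≤ D := by have := polarConst_nonneg n; positivity
          rw [ENNReal.ofReal_mul (p := D) hD0,
            ENNReal.ofReal_mul (p := (((2 : ℝ) ^ i)⁻¹) ^ n) (by positivity), ← hV, ← atomGain_sq,
            show ENNReal.ofReal D = (D.toNNReal : ℝ≥0∞) from rfl]
          ring
  have hfar : ∫⁻ x in Sᶜ, F x ≤ (C3 + 1) * (β * V * atomGain n i d) := by
    refine ENNReal.le_mul_of_sq_le _ ?_
    have h1 : ∫⁻ x in Sᶜ, F x ≤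
        (∫⁻ w in {w : Rn n | r ≤ |‖w‖ - 1|}, ‖waveKern χ (i + d) w‖ₑ) * ∫⁻ x, ‖b x‖ₑ := by
      refine lintegral_enorm_conv_on_le hKc hbm hSm.compl hAm fun x hx y hy => ?_
      have hx' : 2 * r < |‖x - c‖ - 1| := not_le.1 hx
      have hy' := hsupp y hy
      have h2 : |(‖x - c‖ - 1) - (‖x - y‖ - 1)| ≤ ‖y - c‖ := by
        have := abs_norm_sub_norm_le (x - c) (x - y)
        rw [show x - c - (x - y) = y - c by abel] at this
        rwa [sub_sub_sub_cancel_right]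
      have h3 := abs_sub_abs_le_abs_sub (‖x - c‖ - 1) (‖x - y‖ - 1)
      change r ≤ |‖x - y‖ - 1|
      linarith
    calc (∫⁻ x in Sᶜ, F x) ^ 2 ≤
        ((∫⁻ w in {w : Rn n | r ≤ |‖w‖ - 1|}, ‖waveKern χ (i + d) w‖ₑ) * (β * V)) ^ 2 := by
          gcongr
          exact h1.trans (mul_le_mul_right hL1 _)
      _ ≤ (C3 * ENNReal.ofReal (((2 : ℝ) ^ (i + d)) ^ (n - 1) / ((2 : ℝ) ^ (i + d) * r))) *
          (β * V) ^ 2 := by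
          rw [mul_pow]
          exact mul_le_mul_left (hC3 (i + d) r hr0) _
      _ ≤ (C3 * atomGain n i d ^ 2) * (β * V) ^ 2 := by
          refine mul_le_mul_left (mul_le_mul_right ?_ _) _
          rw [atomGain_sq]
          refine ENNReal.ofReal_le_ofReal ?_
          rw [div_eq_mul_inv]
          refine mul_le_mul_of_nonneg_left ?_ (by positivity)
          refine inv_anti₀ (by positivity) ?_
          have : (2 : ℝ) ^ (i + d) * r = 2 ^ d * n := by
            rw [hr, pow_add]
            field_simp
          rw [this]
          exact le_mul_of_one_le_right (by positivity) (by exact_mod_cast hn1)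
      _ = _ := by ring
  calc ∫⁻ x, F x = (∫⁻ x in S, F x) + ∫⁻ x in Sᶜ, F x := (lintegral_add_compl _ hSm).symm
    _ ≤ _ := add_le_add hnear hfar
    _ = _ := by
        push_cast
        ring

/-- The index of the dyadic cell of side `2^{-i}` containing `x`. -/
def cellIdx {n : ℕ} (i : ℕ) (x : Rn n) : Fin n → ℤ := fun l => ⌊(2 : ℝ) ^ i * x l⌋

/-- The lower corner of a dyadic cell. -/
def cellPt {n : ℕ} (i : ℕ) (z : Fin n → ℤ) : Rn n := WithLp.toLp 2 fun l => ((2 : ℝ) ^ i)⁻¹ * z l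

lemma cellIdx_cellPt {n : ℕ} (i : ℕ) (z : Fin n → ℤ) : cellIdx i (cellPt i z) = z := by
  ext l
  simp [cellIdx, cellPt]

lemma measurable_cellIdx {n : ℕ} (i : ℕ) : Measurable (cellIdx (n := n) i) := by
  refine measurable_pi_lambda _ fun l => ?_
  have hc : Continuous fun x : Rn n => (2 : ℝ) ^ i * x l := by fun_prop
  exact Int.measurable_floor.comp hc.measurable

lemma cellIdx_add {n : ℕ} (i d : ℕ) {x y : Rn n} (h : cellIdx (i + d) x = cellIdx (i + d) y) :
    cellIdx i x = cellIdx i y := by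
  have key : ∀ (t : ℝ) (z : ℤ), z ≤ ⌊(2 : ℝ) ^ i * t⌋ ↔ 2 ^ d * z ≤ ⌊(2 : ℝ) ^ (i + d) * t⌋ := by
    intro t z
    rw [Int.le_floor, Int.le_floor, show (2 : ℝ) ^ (i + d) * t = 2 ^ d * (2 ^ i * t) by ring]
    push_cast
    rw [mul_le_mul_iff_right₀ (by positivity)]
  ext l
  have hl := congrFun h l
  unfold cellIdx at hl ⊢
  refine le_antisymm ?_ ?_
  · rw [key, ← hl, ← key]
  · rw [key, hl, ← key]

lemma norm_sub_le_of_cellIdx_eq {n : ℕ} (i : ℕ) {x y : Rn n} (h : cellIdx i x = cellIdx i y) :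
    ‖x - y‖ ≤ n * ((2 : ℝ) ^ i)⁻¹ := by
  have hi : (0 : ℝ) < 2 ^ i := by positivity
  have hl : ∀ l, (x l - y l) ^ 2 ≤ (((2 : ℝ) ^ i)⁻¹) ^ 2 := by
    intro l
    have h1 := Int.abs_sub_lt_one_of_floor_eq_floor (congrFun h l)
    rw [← mul_sub, abs_mul, abs_of_pos hi] at h1
    rw [← sq_abs (x l - y l)]
    gcongr
    rw [← one_div, le_div_iff₀ hi, mul_comm]
    exact h1.le
  rw [EuclideanSpace.norm_eq]
  refine Real.sqrt_le_iff.2 ⟨by positivity, ?_⟩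
  calc ∑ l, ‖(x - y) l‖ ^ 2 ≤ ∑ _l : Fin n, (((2 : ℝ) ^ i)⁻¹) ^ 2 := by
        refine Finset.sum_le_sum fun l _ => ?_
        rw [Real.norm_eq_abs, sq_abs]
        exact hl l
    _ = n * (((2 : ℝ) ^ i)⁻¹) ^ 2 := by simp
    _ ≤ (n * n : ℝ) * (((2 : ℝ) ^ i)⁻¹) ^ 2 := by
        gcongr
        exact_mod_cast Nat.le_mul_self n
    _ = _ := by ring

lemma measurableSet_cell {n : ℕ} (i : ℕ) (z : Fin n → ℤ) :
    MeasurableSet (cellIdx (n := n) i ⁻¹' {z}) := measurable_cellIdx i (measurableSet_singleton z)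

lemma volume_cell {n : ℕ} (i : ℕ) (z : Fin n → ℤ) :
    volume (cellIdx (n := n) i ⁻¹' {z}) = ENNReal.ofReal ((((2 : ℝ) ^ i)⁻¹) ^ n) := by
  have hi : (0 : ℝ) < 2 ^ i := by positivity
  set B : Set (Fin n → ℝ) :=
    Set.pi Set.univ fun l => Set.Ico (((2 : ℝ) ^ i)⁻¹ * z l) (((2 : ℝ) ^ i)⁻¹ * (z l + 1)) with hB
  have he : cellIdx (n := n) i ⁻¹' {z} = (@WithLp.ofLp 2 (Fin n → ℝ)) ⁻¹' B := by
    ext x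
    simp only [Set.mem_preimage, Set.mem_singleton_iff, hB, Set.mem_pi, Set.mem_univ, true_imp_iff,
      Set.mem_Ico, funext_iff, cellIdx, Int.floor_eq_iff]
    refine forall_congr' fun l => and_congr ?_ ?_
    · rw [inv_mul_le_iff₀ hi]
    · rw [lt_inv_mul_iff₀ hi]
  have hBm : MeasurableSet B := MeasurableSet.univ_pi fun l => measurableSet_Ico
  rw [he, (PiLp.volume_preserving_ofLp (Fin n)).measure_preimage hBm.nullMeasurableSet, hB,
    Real.volume_pi_Ico]
  have : ∀ l, ((2 : ℝ) ^ i)⁻¹ * (z l + 1) - ((2 : ℝ) ^ i)⁻¹ * z l = ((2 : ℝ) ^ i)⁻¹ :=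
    fun l => by ring
  simp only [this, Finset.prod_const, Finset.card_univ, Fintype.card_fin]
  rw [ENNReal.ofReal_pow (by positivity)]

lemma iUnion_cell {n : ℕ} (i : ℕ) : ⋃ z, cellIdx (n := n) i ⁻¹' {z} = Set.univ := by
  ext x
  simp

lemma pairwise_disjoint_cell {n : ℕ} (i : ℕ) :
    Pairwise (Function.onFun Disjoint fun z => cellIdx (n := n) i ⁻¹' {z}) :=
  fun _ _ h => Disjoint.preimage _ (Set.disjoint_singleton.2 h)

/-- A function that is constant on dyadic cells. -/
def CellConst {n : ℕ} {β : Type*} (i : ℕ) (D : Rn n → β) : Prop :=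
  ∀ x y, cellIdx i x = cellIdx i y → D x = D y

lemma CellConst.measurable {n i : ℕ} {D : Rn n → ℝ≥0∞} (h : CellConst i D) : Measurable D := by
  have : D = (fun z => D (cellPt i z)) ∘ cellIdx i := by
    ext x
    exact h _ _ (cellIdx_cellPt i _).symm
  rw [this]
  exact Measurable.of_discrete.comp (measurable_cellIdx i)

lemma CellConst.tsum_eq {n i : ℕ} {D : Rn n → ℝ≥0∞} (h : CellConst i D) :
    ∑' z, D (cellPt i z) * ENNReal.ofReal ((((2 : ℝ) ^ i)⁻¹) ^ n) = ∫⁻ x, D x := by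
  rw [← setLIntegral_univ, ← iUnion_cell i,
    lintegral_iUnion (measurableSet_cell i) (pairwise_disjoint_cell i)]
  refine tsum_congr fun z => ?_
  rw [← volume_cell i z, ← setLIntegral_const]
  refine setLIntegral_congr_fun (measurableSet_cell i z) fun x hx => ?_
  exact h _ _ ((cellIdx_cellPt i z).trans hx.symm)

lemma CellConst.of_le {n i k : ℕ} {β : Type*} {D : Rn n → β} (h : CellConst i D) (hik : i ≤ k) :
    CellConst k D := by
  obtain ⟨d, rfl⟩ := Nat.exists_eq_add_of_le hik
  exact fun x y hxy => h x y (cellIdx_add i d hxy)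

/-- The supremum of `U` over the dyadic cell of side `2^{-i}` containing `x`. -/
def cellSup {n : ℕ} (i : ℕ) (U : Rn n → ℝ≥0∞) (x : Rn n) : ℝ≥0∞ :=
  ⨆ y, ⨆ _ : cellIdx i y = cellIdx i x, U y

lemma cellConst_cellSup {n : ℕ} (i : ℕ) (U : Rn n → ℝ≥0∞) : CellConst i (cellSup i U) := by
  intro x y h
  unfold cellSup
  rw [h]

lemma le_cellSup {n : ℕ} (i : ℕ) (U : Rn n → ℝ≥0∞) (x : Rn n) : U x ≤ cellSup i U x :=
  le_iSup₂_of_le x rfl le_rfl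

lemma cellSup_le {n : ℕ} (i : ℕ) {U : Rn n → ℝ≥0∞} {B : ℝ≥0∞} (h : ∀ x, U x ≤ B) (x : Rn n) :
    cellSup i U x ≤ B := iSup₂_le fun y _ => h y

lemma cellSup_le_peetre {n : ℕ} (i P : ℕ) (U : Rn n → ℝ≥0∞) (x : Rn n) :
    cellSup i U x ≤ ENNReal.ofReal ((1 + n) ^ P) * peetre i P U x := by
  refine iSup₂_le fun y hy => ?_
  have hi : (0 : ℝ) < 2 ^ i := by positivity
  have h1 : ‖(2 : ℝ) ^ i • (x - y)‖ ≤ n := by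
    rw [norm_smul, Real.norm_of_nonneg hi.le]
    calc _ ≤ (2 : ℝ) ^ i * (n * ((2 : ℝ) ^ i)⁻¹) := by
          gcongr
          exact norm_sub_le_of_cellIdx_eq i hy.symm
      _ = n := by field_simp
  have h2 : 1 ≤ ENNReal.ofReal ((1 + n) ^ P) * pkE i P (x - y) := by
    unfold pkE
    rw [← ENNReal.ofReal_mul (by positivity), ENNReal.one_le_ofReal, ← div_eq_mul_inv,
      one_le_div (by positivity)]
    gcongr
  calc U y = U y * 1 := (mul_one _).symm
    _ ≤ U y * (ENNReal.ofReal ((1 + n) ^ P) * pkE i P (x - y)) := mul_le_mul_right h2 _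
    _ = ENNReal.ofReal ((1 + n) ^ P) * (U y * pkE i P (x - y)) := by ring
    _ ≤ _ := mul_le_mul_right (le_iSup (fun y => U y * pkE i P (x - y)) y) _

lemma Tst0.exists_cellConst_le {n : ℕ} (hn : 2 ≤ n) {χ : Rn n → ℂ} (h : Tst0 χ) :
    ∃ C : ℝ≥0, ∀ (i d : ℕ) (D : Rn n → ℝ≥0∞) (b : Rn n → ℂ) (B : ℝ), CellConst i D →
      (∀ x, D x ≠ ∞) → Measurable b → (∀ x, ‖b x‖ ≤ B) → (∀ x, ‖b x‖ₑ ≤ D x) →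
      ∫⁻ x, ‖∫ y, waveKern χ (i + d) (x - y) * b y‖ₑ ≤ C * ((∫⁻ x, D x) * atomGain n i d) := by
  obtain ⟨C, hC⟩ := h.exists_atom_le hn
  refine ⟨C, fun i d D b B hD hDt hbm hB hbD => ?_⟩
  have hK := h.integrable_waveKern (i + d)
  have hKc := h.continuous_waveKern (i + d)
  set Q : (Fin n → ℤ) → Set (Rn n) := fun z => cellIdx i ⁻¹' {z} with hQ
  have hQm : ∀ z, MeasurableSet (Q z) := measurableSet_cell i
  have hDQ : ∀ z, ∀ x ∈ Q z, D x = D (cellPt i z) := fun z x hx =>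
    hD _ _ (Eq.trans hx (cellIdx_cellPt i z).symm)
  have hpt : ∀ x, ‖∫ y, waveKern χ (i + d) (x - y) * b y‖ₑ ≤
      ∑' z, ‖∫ y, waveKern χ (i + d) (x - y) * (Q z).indicator b y‖ₑ := by
    intro x
    have h_int : Integrable (fun y => waveKern χ (i + d) (x - y) * b y) :=
      integrable_conv_mul hK x hbm.aestronglyMeasurable hB
    have hs := hasSum_integral_iUnion (f := fun y => waveKern χ (i + d) (x - y) * b y)
      (μ := volume) hQm (pairwise_disjoint_cell i) h_int.integrableOn
    rw [hQ, iUnion_cell, setIntegral_univ] at hs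
    rw [← hs.tsum_eq]
    refine enorm_tsum_le_tsum_enorm.trans (le_of_eq ?_)
    refine tsum_congr fun z => ?_
    rw [← integral_indicator (hQm z)]
    congr 2
    ext y
    by_cases hy : y ∈ Q z
    · rw [Set.indicator_of_mem hy, Set.indicator_of_mem hy]
    · rw [Set.indicator_of_notMem hy, Set.indicator_of_notMem hy, mul_zero]
  have hcell : ∀ z, ∫⁻ x, ‖∫ y, waveKern χ (i + d) (x - y) * (Q z).indicator b y‖ₑ ≤
      C * (D (cellPt i z) * ENNReal.ofReal ((((2 : ℝ) ^ i)⁻¹) ^ n) * atomGain n i d) := by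
    intro z
    have hle : ∀ x, ‖(Q z).indicator b x‖ₑ ≤ (Q z).indicator (fun _ => D (cellPt i z)) x := by
      intro x
      by_cases hx : x ∈ Q z
      · rw [Set.indicator_of_mem hx, Set.indicator_of_mem hx, ← hDQ z x hx]
        exact hbD x
      · rw [Set.indicator_of_notMem hx, enorm_zero]
        exact zero_le
    refine hC i d (cellPt i z) _ _ (hDt _) (hbm.indicator (hQm z)) (fun x => ?_) (fun x hx => ?_) ?_
    · exact (hle x).trans (Set.indicator_le_self' (fun _ _ => zero_le) x)
    · have hx' : x ∈ Q z := Set.mem_of_indicator_ne_zero hx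
      exact norm_sub_le_of_cellIdx_eq i (Eq.trans hx' (cellIdx_cellPt i z).symm)
    · refine (lintegral_mono hle).trans_eq ?_
      rw [lintegral_indicator (hQm z), setLIntegral_const, volume_cell]
  have hm : ∀ z, Measurable
      fun x => ‖∫ y, waveKern χ (i + d) (x - y) * (Q z).indicator b y‖ₑ := fun z =>
    (measurable_conv hKc.measurable (hbm.indicator (hQm z))).enorm
  calc _ ≤ ∫⁻ x, ∑' z, ‖∫ y, waveKern χ (i + d) (x - y) * (Q z).indicator b y‖ₑ :=
        lintegral_mono hpt
    _ = ∑' z, ∫⁻ x, ‖∫ y, waveKern χ (i + d) (x - y) * (Q z).indicator b y‖ₑ :=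
        lintegral_tsum fun z => (hm z).aemeasurable
    _ ≤ ∑' z, C * (D (cellPt i z) * ENNReal.ofReal ((((2 : ℝ) ^ i)⁻¹) ^ n) * atomGain n i d) :=
        ENNReal.tsum_le_tsum hcell
    _ = _ := by rw [ENNReal.tsum_mul_left, ENNReal.tsum_mul_right, hD.tsum_eq]

/-- The running maximum of the first `i` functions of a sequence. -/
def runMax {n : ℕ} (G : ℕ → Rn n → ℝ≥0∞) (i : ℕ) (x : Rn n) : ℝ≥0∞ :=
  (Finset.range i).sup fun k => G k x

lemma runMax_mono {n : ℕ} (G : ℕ → Rn n → ℝ≥0∞) (x : Rn n) : Monotone fun i => runMax G i x :=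
  fun _ _ h => Finset.sup_mono (Finset.range_mono h)

lemma le_runMax {n : ℕ} (G : ℕ → Rn n → ℝ≥0∞) (k : ℕ) (x : Rn n) : G k x ≤ runMax G (k + 1) x :=
  Finset.le_sup (f := fun k => G k x) (Finset.self_mem_range_succ k)

lemma runMax_le_iSup {n : ℕ} (G : ℕ → Rn n → ℝ≥0∞) (k : ℕ) (x : Rn n) :
    runMax G k x ≤ ⨆ k, G k x := Finset.sup_le fun i _ => le_iSup (fun k => G k x) i

lemma runMax_ne_top {n : ℕ} {G : ℕ → Rn n → ℝ≥0∞} (hG : ∀ k x, G k x ≠ ∞) (k : ℕ) (x : Rn n) :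
    runMax G k x ≠ ∞ := by
  rw [← lt_top_iff_ne_top]
  exact (Finset.sup_lt_iff ENNReal.zero_lt_top).2 fun i _ => (hG i x).lt_top

lemma sum_runMax_sub {n : ℕ} (G : ℕ → Rn n → ℝ≥0∞) (x : Rn n) (N : ℕ) :
    ∑ i ∈ Finset.range N, (runMax G (i + 1) x - runMax G i x) = runMax G N x := by
  induction N with
  | zero => simp [runMax]
  | succ N ih =>
    rw [Finset.sum_range_succ, ih]
    exact add_tsub_cancel_of_le (runMax_mono G x N.le_succ)

lemma tsum_runMax_sub_le {n : ℕ} (G : ℕ → Rn n → ℝ≥0∞) (x : Rn n) :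
    ∑' i, (runMax G (i + 1) x - runMax G i x) ≤ ⨆ k, G k x := by
  rw [ENNReal.tsum_eq_iSup_nat]
  refine iSup_le fun N => ?_
  rw [sum_runMax_sub]
  exact runMax_le_iSup G N x

lemma CellConst.runMax {n : ℕ} {G : ℕ → Rn n → ℝ≥0∞} (hG : ∀ k, CellConst k (G k)) (i k : ℕ)
    (h : i ≤ k + 1) : CellConst k (_root_.runMax G i) := by
  intro x y hxy
  refine Finset.sup_congr rfl fun l hl => ?_
  exact (hG l).of_le (by have := Finset.mem_range.1 hl; omega) x y hxy

lemma ENNReal.tsum_sum_range_succ (f : ℕ → ℕ → ℝ≥0∞) :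
    ∑' k, ∑ i ∈ Finset.range (k + 1), f i (k - i) = ∑' i, ∑' d, f i d := by
  rw [← ENNReal.tsum_prod, ← Finset.HasAntidiagonal.sigmaAntidiagonalEquivProd.tsum_eq,
    ENNReal.tsum_sigma']
  refine tsum_congr fun k => ?_
  rw [← Finset.Nat.sum_antidiagonal_eq_sum_range_succ f k, tsum_fintype, ← Finset.sum_coe_sort]
  rfl

/-- The `L^1` estimate for sums of half-wave pieces by a cellwise maximal function. -/
lemma Tst0.exists_tsum_waveKern_le {n : ℕ} (hn : 2 ≤ n) {χ : Rn n → ℂ} (h : Tst0 χ) :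
    ∃ C : ℝ≥0, ∀ (g : ℕ → Rn n → ℂ) (B : ℕ → ℝ), (∀ k, Measurable (g k)) →
      (∀ k x, ‖g k x‖ ≤ B k) →
      ∑' k : ℕ, ENNReal.ofReal (((Real.sqrt ((2 : ℝ) ^ k)) ^ (n - 1))⁻¹) *
        ∫⁻ x, ‖∫ y, waveKern χ k (x - y) * g k y‖ₑ ≤
      C * ∫⁻ x, ⨆ k, cellSup k (fun y => ‖g k y‖ₑ) x := by
  obtain ⟨C, hC⟩ := h.exists_cellConst_le hn
  set θ : ℝ≥0∞ := ENNReal.ofReal ((Real.sqrt 2)⁻¹) with hθ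
  have hθ1 : θ < 1 := by
    rw [hθ, ENNReal.ofReal_lt_one]
    exact inv_lt_one_of_one_lt₀ (by rw [Real.lt_sqrt] <;> norm_num)
  have hS : ∑' d : ℕ, θ ^ d ≠ ∞ := by
    rw [ENNReal.tsum_geometric]
    exact ENNReal.inv_ne_top.2 (tsub_pos_of_lt hθ1).ne'
  refine ⟨C * (∑' d : ℕ, θ ^ d).toNNReal, fun g B hg hB => ?_⟩
  rw [ENNReal.coe_mul, ENNReal.coe_toNNReal hS]
  set G : ℕ → Rn n → ℝ≥0∞ := fun k => cellSup k (fun y => ‖g k y‖ₑ) with hGd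
  have hGc : ∀ k, CellConst k (G k) := fun k => cellConst_cellSup k _
  have hgG : ∀ k x, ‖g k x‖ₑ ≤ G k x := fun k x => le_cellSup k (fun y => ‖g k y‖ₑ) x
  have hGt : ∀ k x, G k x ≠ ∞ := fun k x => by
    refine ((cellSup_le k (B := ENNReal.ofReal (B k)) (fun y => ?_) x).trans_lt
      ENNReal.ofReal_lt_top).ne
    rw [← ofReal_norm]
    exact ENNReal.ofReal_le_ofReal (hB k y)
  set D : ℕ → Rn n → ℝ≥0∞ := fun i x => runMax G (i + 1) x - runMax G i x with hDd
  have hDc : ∀ i, CellConst i (D i) := fun i x y hxy => by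
    simp only [hDd]
    rw [CellConst.runMax hGc (i + 1) i le_rfl x y hxy,
      CellConst.runMax hGc i i (Nat.le_succ i) x y hxy]
  have hDt : ∀ i x, D i x ≠ ∞ := fun i x =>
    (tsub_le_self.trans_lt (runMax_ne_top hGt (i + 1) x).lt_top).ne
  set b : ℕ → ℕ → Rn n → ℂ := fun k i x =>
    g k x * (((D i x / runMax G (k + 1) x).toReal : ℝ) : ℂ) with hb
  have hFm : ∀ k, Measurable (runMax G (k + 1)) := fun k =>
    (CellConst.runMax hGc (k + 1) k le_rfl).measurable
  have hbm : ∀ k i, Measurable (b k i) := fun k i =>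
    (hg k).mul (Complex.measurable_ofReal.comp ((hDc i).measurable.div (hFm k)).ennreal_toReal)
  have hwt : ∀ k i x, i ≤ k → D i x / runMax G (k + 1) x ≤ 1 := fun k i x hik => by
    refine ENNReal.div_le_of_le_mul ?_
    rw [one_mul]
    exact tsub_le_self.trans (runMax_mono G x (by omega))
  have hbB : ∀ k i, i ≤ k → ∀ x, ‖b k i x‖ ≤ B k := fun k i hik x => by
    have h1 : (D i x / runMax G (k + 1) x).toReal ≤ 1 :=
      ENNReal.toReal_le_of_le_ofReal zero_le_one (by simpa using hwt k i x hik)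
    simp only [hb]
    rw [norm_mul, Complex.norm_real, Real.norm_of_nonneg ENNReal.toReal_nonneg]
    exact (mul_le_of_le_one_right (norm_nonneg _) h1).trans (hB k x)
  have hbD : ∀ k i, i ≤ k → ∀ x, ‖b k i x‖ₑ ≤ D i x := fun k i hik x => by
    have ht : D i x / runMax G (k + 1) x ≠ ∞ := ((hwt k i x hik).trans_lt ENNReal.one_lt_top).ne
    simp only [hb]
    rw [enorm_mul, ← ofReal_norm (((_ : ℝ) : ℂ)), Complex.norm_real,
      Real.norm_of_nonneg ENNReal.toReal_nonneg, ENNReal.ofReal_toReal ht]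
    exact (mul_le_mul_left ((hgG k x).trans (le_runMax G k x)) _).trans ENNReal.mul_div_le
  have hsum : ∀ k x, ∑ i ∈ Finset.range (k + 1), b k i x = g k x := fun k x => by
    simp only [hb]
    rw [← Finset.mul_sum]
    rcases eq_or_ne (runMax G (k + 1) x) 0 with h0 | h0
    · have : ‖g k x‖ₑ = 0 := le_antisymm ((hgG k x).trans ((le_runMax G k x).trans h0.le)) zero_le
      rw [enorm_eq_zero.1 this, zero_mul]
    · have h1 : ∑ i ∈ Finset.range (k + 1), D i x / runMax G (k + 1) x = 1 := by
        simp_rw [div_eq_mul_inv]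
        rw [← Finset.sum_mul, hDd, sum_runMax_sub]
        exact ENNReal.mul_inv_cancel h0 (runMax_ne_top hGt _ x)
      rw [← Complex.ofReal_sum, ← ENNReal.toReal_sum, h1]
      · simp
      · intro i hi
        exact ((hwt k i x (Nat.lt_succ_iff.1 (Finset.mem_range.1 hi))).trans_lt
          ENNReal.one_lt_top).ne
  have hstep : ∀ k, ∫⁻ x, ‖∫ y, waveKern χ k (x - y) * g k y‖ₑ ≤
      ∑ i ∈ Finset.range (k + 1), C * ((∫⁻ x, D i x) * atomGain n i (k - i)) := by
    intro k
    have hKc := h.continuous_waveKern k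
    have hpt : ∀ x, ‖∫ y, waveKern χ k (x - y) * g k y‖ₑ ≤
        ∑ i ∈ Finset.range (k + 1), ‖∫ y, waveKern χ k (x - y) * b k i y‖ₑ := by
      intro x
      refine le_trans (le_of_eq ?_) (enorm_sum_le _ _)
      rw [← integral_finsetSum]
      · simp_rw [← Finset.mul_sum, hsum]
      · intro i hi
        exact integrable_conv_mul (h.integrable_waveKern k) x (hbm k i).aestronglyMeasurable
          (hbB k i (Nat.lt_succ_iff.1 (Finset.mem_range.1 hi)))
    refine (lintegral_mono hpt).trans ?_
    rw [lintegral_finsetSum _ fun i _ => (measurable_conv hKc.measurable (hbm k i)).enorm]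
    refine Finset.sum_le_sum fun i hi => ?_
    have hik : i ≤ k := Nat.lt_succ_iff.1 (Finset.mem_range.1 hi)
    have := hC i (k - i) (D i) (b k i) (B k) (hDc i) (hDt i) (hbm k i) (hbB k i hik) (hbD k i hik)
    rwa [Nat.add_sub_cancel' hik] at this
  have hgain : ∀ i k, i ≤ k →
      ENNReal.ofReal (((Real.sqrt ((2 : ℝ) ^ k)) ^ (n - 1))⁻¹) * atomGain n i (k - i) =
        θ ^ (k - i) := by
    intro i k hik
    unfold atomGain
    rw [Nat.add_sub_cancel' hik, ← ENNReal.ofReal_mul (by positivity),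
      inv_mul_cancel_left₀ (by positivity), ENNReal.ofReal_pow (by positivity)]
  calc _ ≤ ∑' k : ℕ, ∑ i ∈ Finset.range (k + 1), C * ((∫⁻ x, D i x) * θ ^ (k - i)) := by
        refine ENNReal.tsum_le_tsum fun k => (mul_le_mul_right (hstep k) _).trans_eq ?_
        rw [Finset.mul_sum]
        refine Finset.sum_congr rfl fun i hi => ?_
        rw [← hgain i k (Nat.lt_succ_iff.1 (Finset.mem_range.1 hi))]
        ring
    _ = ∑' i, ∑' d, C * ((∫⁻ x, D i x) * θ ^ d) :=
        ENNReal.tsum_sum_range_succ fun i d => C * ((∫⁻ x, D i x) * θ ^ d)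
    _ = C * (∑' d : ℕ, θ ^ d) * ∫⁻ x, ∑' i, D i x := by
        rw [lintegral_tsum fun i => (hDc i).measurable.aemeasurable]
        simp_rw [ENNReal.tsum_mul_left]
        rw [ENNReal.tsum_mul_right]
        ring
    _ ≤ _ := mul_le_mul_right (lintegral_mono fun x => tsum_runMax_sub_le G x) _

lemma le_lqSum {q : ℝ≥0∞} (hq : 1 ≤ q) (u : ℕ → ℝ≥0∞) (k : ℕ) : u k ≤ lqSum q u := by
  rcases eq_or_ne q ∞ with rfl | h
  · rw [lqSum_top]
    exact le_iSup u k
  · have hr : 0 < q.toReal := zero_lt_one.trans_le (one_le_toReal hq h)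
    rw [lqSum_of_ne_top h, one_div, ENNReal.le_rpow_inv_iff hr]
    exact ENNReal.le_tsum k

lemma lqSum_top_le {q : ℝ≥0∞} (hq : 1 ≤ q) (u : ℕ → ℝ≥0∞) : lqSum ∞ u ≤ lqSum q u := by
  rw [lqSum_top]
  exact iSup_le (le_lqSum hq u)

lemma lqSum_le_tsum {q : ℝ≥0∞} (hq : 1 ≤ q) (u : ℕ → ℝ≥0∞) : lqSum q u ≤ ∑' k, u k := by
  rcases eq_or_ne q ∞ with rfl | h
  · rw [lqSum_top]
    exact iSup_le fun k => ENNReal.le_tsum k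
  · have hr1 := one_le_toReal hq h
    have hr : 0 < q.toReal := zero_lt_one.trans_le hr1
    rw [lqSum_of_ne_top h, one_div, ENNReal.rpow_inv_le_iff hr]
    have hsplit : ∀ a : ℝ≥0∞, a ^ q.toReal = a * a ^ (q.toReal - 1) := fun a => by
      conv_lhs => rw [← add_sub_cancel 1 q.toReal]
      rw [ENNReal.rpow_add_of_nonneg _ _ zero_le_one (by linarith), ENNReal.rpow_one]
    rw [hsplit (∑' k, u k), ← ENNReal.tsum_mul_right]
    refine ENNReal.tsum_le_tsum fun k => ?_
    rw [hsplit]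
    exact mul_le_mul_right (ENNReal.rpow_le_rpow (ENNReal.le_tsum k) (by linarith)) _

lemma tsum_pow_dist_le {ρ : ℝ≥0∞} (hρ : ρ ≤ 1) (k : ℕ) :
    ∑' j, ρ ^ ((j - k) + (k - j)) ≤ 2 * ∑' d, ρ ^ d := by
  have e := (ENNReal.summable (f := fun i => ρ ^ ((i + k - k) + (k - (i + k))))).sum_add_tsum_nat_add'
    (f := fun j => ρ ^ ((j - k) + (k - j))) (k := k)
  rw [← e, two_mul]
  refine add_le_add ?_ ?_
  · rw [← Finset.sum_range_reflect]
    refine le_trans (Finset.sum_le_sum fun j hj => ?_) (ENNReal.sum_le_tsum (Finset.range k))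
    have := Finset.mem_range.1 hj
    exact pow_le_pow_right_of_le_one' hρ (by omega)
  · refine ENNReal.tsum_le_tsum fun d => le_of_eq ?_
    congr 1
    omega

lemma IsLPBase.continuous_wavePiece {n : ℕ} {ψ0 : Rn n → ℝ} (h : IsLPBase n ψ0)
    (f : SchwartzMap (Rn n) ℂ) (k : ℕ) : Continuous (wavePiece ψ0 f k) :=
  _root_.continuous_kern (integrable_wavePh_mul (h.integrable_lpf_symbol f k))

/-- The weighted pieces of the half-wave evolution. -/
def waveU {n : ℕ} (ψ0 : Rn n → ℝ) (r : ℝ) (f : Rn n → ℂ) (k : ℕ) (x : Rn n) : ℝ≥0∞ :=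
  ENNReal.ofReal ((2 : ℝ) ^ ((k : ℝ) * r)) * ‖wavePiece ψ0 f k x‖ₑ

lemma IsLPBase.measurable_waveU {n : ℕ} {ψ0 : Rn n → ℝ} (h : IsLPBase n ψ0) (r : ℝ)
    (f : SchwartzMap (Rn n) ℂ) (k : ℕ) : Measurable (waveU ψ0 r f k) :=
  (h.continuous_wavePiece f k).enorm.measurable.const_mul _

lemma IsLPBase.exists_lintegral_waveU_zero_le {n : ℕ} (hn : 1 ≤ n) {ψ0 : Rn n → ℝ}
    (h : IsLPBase n ψ0) (r s : ℝ) {q : ℝ≥0∞} (hq : 1 ≤ q) :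
    ∃ C : ℝ≥0, ∀ f : SchwartzMap (Rn n) ℂ,
      ∫⁻ x, waveU ψ0 r f 0 x ≤ C * ∫⁻ x, lqSum q fun k => lpU ψ0 s f k x := by
  obtain ⟨C, hC⟩ := h.exists_lintegral_wavePiece_zero_le hn
  refine ⟨C, fun f => ?_⟩
  have e1 : ∀ x, waveU ψ0 r f 0 x = ‖wavePiece ψ0 f 0 x‖ₑ := fun x => by simp [waveU]
  have e2 : ∀ x, lpU ψ0 s f 0 x = ‖lpf ψ0 f 0 x‖ₑ := fun x => by simp [lpU]
  simp_rw [e1]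
  refine (hC f).trans (mul_le_mul_right (lintegral_mono fun x => ?_) _)
  rw [← e2]
  exact le_lqSum hq (fun k => lpU ψ0 s f k x) 0

lemma IsLPBase.wavePiece_eq_waveKern {n : ℕ} {ψ0 : Rn n → ℝ} (h : IsLPBase n ψ0)
    (f : SchwartzMap (Rn n) ℂ) {k : ℕ} (hk : k ≠ 0) (x : Rn n) :
    wavePiece ψ0 f k x = ∫ y, waveKern (lpFat ψ0 1) k (x - y) * lpf ψ0 f k y := by
  have h1 := (h.tst0_fat one_ne_zero).integrable_waveKern k
  have e : lpFat ψ0 k = lpFat ψ0 1 := by rw [lpFat_min, min_eq_right (by omega)]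
  have := h.wavePiece_eq_conv f k (by rw [e]; exact h1) x
  rwa [e] at this

lemma IsLPBase.exists_tsum_waveU_le {n : ℕ} (hn : 2 ≤ n) {ψ0 : Rn n → ℝ}
    (h : IsLPBase n ψ0) (s : ℝ) {q : ℝ≥0∞} (hq : 1 ≤ q) :
    ∃ C : ℝ≥0, ∀ f : SchwartzMap (Rn n) ℂ,
      ∑' k, ∫⁻ x, waveU ψ0 (s - ((n : ℝ) - 1) / 2) f k x ≤
        C * ∫⁻ x, lqSum q fun k => lpU ψ0 s f k x := by
  obtain ⟨C0, hC0⟩ := h.exists_lintegral_waveU_zero_le (by omega : 1 ≤ n) (s - ((n : ℝ) - 1) / 2) s hq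
  obtain ⟨C1, hC1⟩ := (h.tst0_fat one_ne_zero).exists_tsum_waveKern_le hn
  obtain ⟨C2, hC2⟩ := h.exists_lintegral_peetre_le s (q := ∞) le_top
  set P := (n + 1) + (n + 1) with hP
  set M : ℝ≥0∞ := ENNReal.ofReal ((1 + n) ^ P) with hM
  refine ⟨C0 + C1 * (M.toNNReal * C2), fun f => ?_⟩
  set g : ℕ → Rn n → ℂ := fun k x => (((2 : ℝ) ^ ((k : ℝ) * s) : ℝ) : ℂ) * lpf ψ0 f k x with hg
  have hgU : ∀ k x, ‖g k x‖ₑ = lpU ψ0 s f k x := fun k x => by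
    simp only [hg]
    unfold lpU
    rw [enorm_mul, ← ofReal_norm (((_ : ℝ) : ℂ)), Complex.norm_real,
      Real.norm_of_nonneg (by positivity)]
  have hstep : ∀ k, k ≠ 0 → ∫⁻ x, waveU ψ0 (s - ((n : ℝ) - 1) / 2) f k x =
      ENNReal.ofReal (((Real.sqrt ((2 : ℝ) ^ k)) ^ (n - 1))⁻¹) *
        ∫⁻ x, ‖∫ y, waveKern (lpFat ψ0 1) k (x - y) * g k y‖ₑ := by
    intro k hk
    rw [← lintegral_const_mul' _ _ ENNReal.ofReal_ne_top]
    refine lintegral_congr fun x => ?_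
    have e1 : ∫ y, waveKern (lpFat ψ0 1) k (x - y) * g k y =
        (((2 : ℝ) ^ ((k : ℝ) * s) : ℝ) : ℂ) * wavePiece ψ0 f k x := by
      rw [h.wavePiece_eq_waveKern f hk, ← integral_const_mul]
      congr 1 with y
      simp only [hg]
      ring
    have e2 : (2 : ℝ) ^ ((k : ℝ) * (s - ((n : ℝ) - 1) / 2)) =
        ((Real.sqrt ((2 : ℝ) ^ k)) ^ (n - 1))⁻¹ * (2 : ℝ) ^ ((k : ℝ) * s) := by
      rw [Real.sqrt_eq_rpow, ← Real.rpow_natCast 2 k, ← Real.rpow_mul (by norm_num),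
        ← Real.rpow_natCast _ (n - 1), ← Real.rpow_mul (by norm_num), ← Real.rpow_neg (by norm_num),
        ← Real.rpow_add (by norm_num), Nat.cast_sub (by omega)]
      congr 1
      push_cast
      ring
    unfold waveU
    rw [e1, enorm_mul, ← ofReal_norm (((_ : ℝ) : ℂ)), Complex.norm_real,
      Real.norm_of_nonneg (by positivity), e2, ENNReal.ofReal_mul (by positivity), mul_assoc]
  have hcell : ∫⁻ x, ⨆ k, cellSup k (fun y => ‖g k y‖ₑ) x ≤
      M * (C2 * ∫⁻ x, lqSum q fun k => lpU ψ0 s f k x) := by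
    calc _ ≤ ∫⁻ x, M * lqSum ∞ fun k => peetre k P (lpU ψ0 s f k) x := by
          refine lintegral_mono fun x => ?_
          rw [lqSum_top, ENNReal.mul_iSup]
          refine iSup_mono fun k => ?_
          simp_rw [hgU]
          exact cellSup_le_peetre k P _ x
      _ = M * ∫⁻ x, lqSum ∞ fun k => peetre k P (lpU ψ0 s f k) x :=
          lintegral_const_mul' _ _ ENNReal.ofReal_ne_top
      _ ≤ M * (C2 * ∫⁻ x, lqSum q fun k => lpU ψ0 s f k x) := by
          refine mul_le_mul_right ((hC2 f).trans (mul_le_mul_right ?_ _)) _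
          exact lintegral_mono fun x => lqSum_top_le hq _
  have hbd : ∀ k x, ‖g k x‖ ≤ (2 : ℝ) ^ ((k : ℝ) * s) *
      ∫ ξ, ‖dil k (lpBase ψ0 k) ξ * ftransform n f ξ‖ := fun k x => by
    simp only [hg]
    rw [norm_mul, Complex.norm_real, Real.norm_of_nonneg (by positivity)]
    gcongr
    exact norm_kern_le _ _
  have hmain := hC1 g _ (fun k => ((h.continuous_lpf f k).measurable.const_mul _)) hbd
  rw [tsum_eq_zero_add' ENNReal.summable]
  push_cast
  rw [ENNReal.coe_toNNReal ENNReal.ofReal_ne_top, add_mul]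
  refine add_le_add (hC0 f) ?_
  calc _ = ∑' k : ℕ, ENNReal.ofReal (((Real.sqrt ((2 : ℝ) ^ (k + 1))) ^ (n - 1))⁻¹) *
        ∫⁻ x, ‖∫ y, waveKern (lpFat ψ0 1) (k + 1) (x - y) * g (k + 1) y‖ₑ :=
        tsum_congr fun k => hstep (k + 1) k.succ_ne_zero
    _ ≤ ∑' k : ℕ, ENNReal.ofReal (((Real.sqrt ((2 : ℝ) ^ k)) ^ (n - 1))⁻¹) *
        ∫⁻ x, ‖∫ y, waveKern (lpFat ψ0 1) k (x - y) * g k y‖ₑ :=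
        ENNReal.tsum_comp_le_tsum_of_injective (add_left_injective 1) fun k : ℕ =>
          ENNReal.ofReal (((Real.sqrt ((2 : ℝ) ^ k)) ^ (n - 1))⁻¹) *
            ∫⁻ x, ‖∫ y, waveKern (lpFat ψ0 1) k (x - y) * g k y‖ₑ
    _ ≤ C1 * (M * (C2 * ∫⁻ x, lqSum q fun k => lpU ψ0 s f k x)) :=
        hmain.trans (mul_le_mul_right hcell _)
    _ = _ := by ring

lemma tlNorm_one_eq_lintegral {n : ℕ} (ψ0 : Rn n → ℝ) (s : ℝ) (q : ℝ≥0∞) (g : Rn n → ℂ) :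
    tlNorm n ψ0 s 1 q g = ∫⁻ x, lqSum q fun j =>
      ENNReal.ofReal ((2 : ℝ) ^ ((j : ℝ) * s)) * ‖smoothOp n (lpPiece n ψ0 j) g x‖ₑ := by
  unfold tlNorm
  simp only [ENNReal.one_ne_top, if_false, ENNReal.toReal_one, ENNReal.rpow_one, div_one]
  rfl

lemma tsum_two_inv_pow_ne_top : ∑' d : ℕ, ((2 : ℝ≥0∞)⁻¹) ^ d ≠ ∞ := by
  rw [ENNReal.tsum_geometric]
  exact ENNReal.inv_ne_top.2 (tsub_pos_of_lt ENNReal.one_half_lt_one).ne'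

lemma SymbolClass.exists_tlNorm_fio_le_of_two_le {n : ℕ} (hn : 2 ≤ n) {m : ℝ}
    {a : Rn n → Rn n → ℂ} (ha : SymbolClass n m a) {ψ0 : Rn n → ℝ} (hψ : IsLPBase n ψ0) (s : ℝ)
    {q : ℝ≥0∞} (hq : 1 ≤ q) :
    ∃ C : ℝ≥0, ∀ f : SchwartzMap (Rn n) ℂ,
      tlNorm n ψ0 (s - m - ((n : ℝ) - 1) / 2) 1 q (fio n a (fun x ξ => ⟪x, ξ⟫_ℝ + ‖ξ‖) f) ≤
        C * tlNorm n ψ0 s 1 q f := by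
  obtain ⟨C1, hC1⟩ := ha.enorm_fio_piece_le hψ (s - m - ((n : ℝ) - 1) / 2) (n + 1)
  obtain ⟨C2, hC2⟩ := hψ.exists_tsum_waveU_le hn s hq
  set W : ℝ≥0∞ := 2 * ∑' d : ℕ, ((2 : ℝ≥0∞)⁻¹) ^ d with hW
  have hWt : W ≠ ∞ := ENNReal.mul_ne_top ENNReal.ofNat_ne_top tsum_two_inv_pow_ne_top
  refine ⟨C1 * (W.toNNReal * ((wtMass n).toNNReal * C2)), fun f => ?_⟩
  push_cast
  rw [ENNReal.coe_toNNReal hWt, ENNReal.coe_toNNReal (wtMass_ne_top n), hψ.tlNorm_one_eq,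
    tlNorm_one_eq_lintegral]
  set r : ℝ := s - ((n : ℝ) - 1) / 2 with hr
  have er : s - m - ((n : ℝ) - 1) / 2 + m = r := by ring
  have hm : ∀ k, Measurable (wavg k (n + 1) (waveU ψ0 r f k)) := fun k =>
    measurable_wavg k (n + 1) (hψ.measurable_waveU r f k)
  calc _ ≤ ∫⁻ x, ∑' j : ℕ, C1 * ∑' k, ((2 : ℝ≥0∞)⁻¹) ^ ((j - k) + (k - j)) *
        wavg k (n + 1) (waveU ψ0 r f k) x := by
        refine lintegral_mono fun x => (lqSum_le_tsum hq _).trans ?_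
        refine ENNReal.tsum_le_tsum fun j => ?_
        have := hC1 f j x
        rw [er] at this
        exact this
    _ ≤ ∫⁻ x, C1 * (W * ∑' k, wavg k (n + 1) (waveU ψ0 r f k) x) := by
        refine lintegral_mono fun x => ?_
        rw [ENNReal.tsum_mul_left]
        refine mul_le_mul_right ?_ _
        rw [ENNReal.tsum_comm, ← ENNReal.tsum_mul_left]
        refine ENNReal.tsum_le_tsum fun k => ?_
        rw [ENNReal.tsum_mul_right]
        exact mul_le_mul_left (tsum_pow_dist_le (ENNReal.inv_le_one.2 one_le_two) k) _
    _ = C1 * (W * ∑' k, wtMass n * ∫⁻ x, waveU ψ0 r f k x) := by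
        rw [lintegral_const_mul' _ _ ENNReal.coe_ne_top, lintegral_const_mul' _ _ hWt,
          lintegral_tsum fun k => (hm k).aemeasurable]
        simp_rw [lintegral_wavg _ (hψ.measurable_waveU r f _)]
    _ ≤ C1 * (W * (wtMass n * (C2 * ∫⁻ x, lqSum q fun k => lpU ψ0 s f k x))) := by
        rw [ENNReal.tsum_mul_left]
        exact mul_le_mul_right (mul_le_mul_right (mul_le_mul_right (hC2 f) _) _) _
    _ = _ := by ring

lemma lqSum_max_le {q : ℝ≥0∞} (hq : 1 ≤ q) (u v : ℕ → ℝ≥0∞) :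
    (lqSum q fun k => max (u k) (v k)) ≤ lqSum q u + lqSum q v := by
  rcases eq_or_ne q ∞ with rfl | h
  · rw [lqSum_top]
    exact iSup_le fun k => max_le ((le_lqSum hq u k).trans le_self_add)
      ((le_lqSum hq v k).trans le_add_self)
  · have hr1 := one_le_toReal hq h
    have hr : 0 < q.toReal := zero_lt_one.trans_le hr1
    rw [lqSum_of_ne_top h, lqSum_of_ne_top h, lqSum_of_ne_top h]
    refine le_trans (ENNReal.rpow_le_rpow ?_ (by positivity)) (ENNReal.rpow_add_le_add_rpow _ _
      (by positivity) (by rw [one_div]; exact inv_le_one_of_one_le₀ hr1))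
    rw [← ENNReal.tsum_add]
    refine ENNReal.tsum_le_tsum fun k => ?_
    rcases max_choice (u k) (v k) with e | e <;> rw [e]
    · exact le_self_add
    · exact le_add_self

lemma lqSum_add_le {q : ℝ≥0∞} (hq : 1 ≤ q) (u v : ℕ → ℝ≥0∞) :
    (lqSum q fun k => u k + v k) ≤ 2 * (lqSum q u + lqSum q v) := by
  refine le_trans (lqSum_mono fun k => ?_) ((lqSum_const_mul hq 2 _).le.trans
    (mul_le_mul_right (lqSum_max_le hq u v) _))
  rw [two_mul]
  exact add_le_add (le_max_left _ _) (le_max_right _ _)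

lemma lqSum_iSup_pow_dist_le {q : ℝ≥0∞} (hq : 1 ≤ q) {ρ : ℝ≥0∞} (hρ : ρ ≤ 1) (u : ℕ → ℝ≥0∞) :
    (lqSum q fun j => ⨆ k, ρ ^ ((j - k) + (k - j)) * u k) ≤
      (1 + 2 * ∑' d, ρ ^ d) * lqSum q u := by
  have hpow : ∀ d : ℕ, ρ ^ d ≤ 1 := fun d => pow_le_one' hρ d
  rcases eq_or_ne q ∞ with rfl | h
  · rw [lqSum_top]
    refine (iSup_le fun j => iSup_le fun k => ?_).trans
      (le_mul_of_one_le_left (by positivity) le_self_add)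
    exact (mul_le_of_le_one_left (by positivity) (hpow _)).trans (le_lqSum hq u k)
  · have hr1 := one_le_toReal hq h
    have hr : 0 < q.toReal := zero_lt_one.trans_le hr1
    rw [lqSum_of_ne_top h, lqSum_of_ne_top h]
    have key : ∑' j, (⨆ k, ρ ^ ((j - k) + (k - j)) * u k) ^ q.toReal ≤
        (1 + 2 * ∑' d, ρ ^ d) * ∑' k, u k ^ q.toReal := by
      calc _ ≤ ∑' j, ∑' k, ρ ^ ((j - k) + (k - j)) * u k ^ q.toReal := by
            refine ENNReal.tsum_le_tsum fun j => ?_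
            rw [← ENNReal.le_rpow_inv_iff hr]
            refine iSup_le fun k => ?_
            rw [ENNReal.le_rpow_inv_iff hr, ENNReal.mul_rpow_of_nonneg _ _ hr.le]
            refine le_trans (mul_le_mul_left ?_ _)
              (ENNReal.le_tsum (f := fun k => ρ ^ ((j - k) + (k - j)) * u k ^ q.toReal) k)
            exact ENNReal.rpow_le_self_of_le_one (hpow _) hr1
        _ = ∑' k, (∑' j, ρ ^ ((j - k) + (k - j))) * u k ^ q.toReal := by
            rw [ENNReal.tsum_comm]
            simp_rw [ENNReal.tsum_mul_right]
        _ ≤ ∑' k, (1 + 2 * ∑' d, ρ ^ d) * u k ^ q.toReal :=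
            ENNReal.tsum_le_tsum fun k =>
              mul_le_mul_left ((tsum_pow_dist_le hρ k).trans le_add_self) _
        _ = _ := ENNReal.tsum_mul_left
    refine (ENNReal.rpow_le_rpow key (by positivity)).trans ?_
    rw [ENNReal.mul_rpow_of_nonneg _ _ (by positivity)]
    refine mul_le_mul_left ?_ _
    refine (ENNReal.rpow_le_rpow_of_exponent_le le_self_add ?_).trans_eq (ENNReal.rpow_one _)
    rw [one_div]
    exact inv_le_one_of_one_le₀ hr1

lemma exists_lqSum_tsum_two_inv_pow_dist_le {q : ℝ≥0∞} (hq : 1 ≤ q) :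
    ∃ C : ℝ≥0, ∀ u : ℕ → ℝ≥0∞,
      (lqSum q fun j => ∑' k, ((2 : ℝ≥0∞)⁻¹) ^ ((j - k) + (k - j)) * u k) ≤ C * lqSum q u := by
  set w : ℝ≥0∞ := ENNReal.ofReal (3 / 4) with hw
  have hw1 : w < 1 := by rw [hw, ENNReal.ofReal_lt_one]; norm_num
  have hw2 : (2 : ℝ≥0∞)⁻¹ ≤ w * w := by
    rw [hw, ← ENNReal.ofReal_mul (by norm_num), ← ENNReal.ofReal_ofNat 2,
      ← ENNReal.ofReal_inv_of_pos two_pos]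
    exact ENNReal.ofReal_le_ofReal (by norm_num)
  set W : ℝ≥0∞ := ∑' d : ℕ, w ^ d with hW
  have hWt : W ≠ ∞ := by
    rw [hW, ENNReal.tsum_geometric]
    exact ENNReal.inv_ne_top.2 (tsub_pos_of_lt hw1).ne'
  refine ⟨2 * W.toNNReal * (1 + 2 * W.toNNReal), fun u => ?_⟩
  push_cast
  rw [ENNReal.coe_toNNReal hWt, mul_assoc (2 * W)]
  refine le_trans (lqSum_mono fun j => ?_) ((lqSum_const_mul hq (2 * W) _).le.trans
    (mul_le_mul_right (lqSum_iSup_pow_dist_le hq hw1.le u) _))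
  rw [hW]
  calc _ ≤ ∑' k, w ^ ((k - j) + (j - k)) * ⨆ k, w ^ ((j - k) + (k - j)) * u k := by
        refine ENNReal.tsum_le_tsum fun k => ?_
        refine (mul_le_mul_left (pow_le_pow_left' hw2 _) _).trans ?_
        rw [mul_pow, mul_assoc, add_comm (k - j)]
        exact mul_le_mul_right (le_iSup (fun k => w ^ ((j - k) + (k - j)) * u k) k) _
    _ ≤ _ := by
        rw [ENNReal.tsum_mul_right]
        exact mul_le_mul_left (tsum_pow_dist_le hw1.le j) _

lemma peetre_comp_add {n : ℕ} (k P : ℕ) (U : Rn n → ℝ≥0∞) (e x : Rn n) :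
    peetre k P (fun y => U (y + e)) x = peetre k P U (x + e) := by
  unfold peetre
  rw [← (Equiv.addRight e).iSup_comp (g := fun y => U y * pkE k P (x + e - y))]
  simp only [Equiv.coe_addRight, add_sub_add_right_eq_sub]

lemma peetre_peetre_le {n : ℕ} (k P : ℕ) (U : Rn n → ℝ≥0∞) (x : Rn n) :
    peetre k P (peetre k P U) x ≤ peetre k P U x := by
  refine iSup_le fun y => ?_
  rw [peetre, ENNReal.iSup_mul]
  refine iSup_mono fun z => ?_
  rw [mul_assoc]
  refine mul_le_mul_right ((pkE_mul_le k P _ _).trans_eq ?_) _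
  congr 1
  abel

lemma wavg_le_peetre {n : ℕ} (k P : ℕ) (U : Rn n → ℝ≥0∞) (x : Rn n) :
    wavg k (P + (n + 1)) U x ≤ wtMass n * peetre k P U x := by
  calc _ ≤ ∫⁻ y, wtE k (n + 1) (x - y) * peetre k P U x := by
        refine lintegral_mono fun y => ?_
        rw [wtE_eq, pkE_add, wtE_eq]
        calc _ = ENNReal.ofReal (((2 : ℝ) ^ k) ^ n) * pkE k (n + 1) (x - y) *
              (U y * pkE k P (x - y)) := by ring
          _ ≤ _ := mul_le_mul_right (le_iSup (fun y => U y * pkE k P (x - y)) y) _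
    _ = _ := by
        have hm : Measurable fun y => wtE k (n + 1) (x - y) :=
          (measurable_wtE k (n + 1)).comp (measurable_id.const_sub x)
        rw [lintegral_mul_const _ hm, lintegral_wtE_sub_left]

lemma peetre_mono {n : ℕ} (k P : ℕ) {U V : Rn n → ℝ≥0∞} (h : ∀ x, U x ≤ V x) (x : Rn n) :
    peetre k P U x ≤ peetre k P V x :=
  iSup_mono fun y => mul_le_mul_left (h y) _

lemma peetre_const_mul {n : ℕ} (k P : ℕ) (c : ℝ≥0∞) (U : Rn n → ℝ≥0∞) (x : Rn n) :
    peetre k P (fun y => c * U y) x = c * peetre k P U x := by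
  unfold peetre
  rw [ENNReal.mul_iSup]
  simp only [mul_assoc]

lemma peetre_add_le {n : ℕ} (k P : ℕ) (U V : Rn n → ℝ≥0∞) (x : Rn n) :
    peetre k P (fun y => U y + V y) x ≤ peetre k P U x + peetre k P V x := by
  refine iSup_le fun y => ?_
  rw [add_mul]
  exact add_le_add (le_iSup (fun y => U y * pkE k P (x - y)) y)
    (le_iSup (fun y => V y * pkE k P (x - y)) y)

lemma measurable_peetre {n : ℕ} (k P : ℕ) {U : Rn n → ℝ≥0∞} (hU : ∀ x, U x ≠ ∞) :
    Measurable (peetre k P U) := by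
  have : LowerSemicontinuous (peetre k P U) := by
    refine lowerSemicontinuous_iSup fun y => Continuous.lowerSemicontinuous ?_
    refine (ENNReal.continuous_const_mul (hU y)).comp ?_
    unfold pkE
    refine ENNReal.continuous_ofReal.comp (Continuous.inv₀ (by fun_prop) fun x => ?_)
    positivity
  exact this.measurable

lemma kern_exp_mul {n : ℕ} (e : Rn n) (u : Rn n → ℂ) (x : Rn n) :
    kern n (fun ξ => Complex.exp (Complex.I * ((⟪e, ξ⟫_ℝ : ℝ) : ℂ)) * u ξ) x =
      kern n u (x + e) := by
  unfold kern
  congr 2 with ξ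
  rw [inner_add_left, ← mul_assoc, ← Complex.exp_add]
  push_cast
  rw [mul_add]

lemma integrable_exp_inner_mul {n : ℕ} (e : Rn n) {u : Rn n → ℂ} (hu : Tst u) :
    Integrable fun ξ => Complex.exp (Complex.I * ((⟪e, ξ⟫_ℝ : ℝ) : ℂ)) * u ξ :=
  integrable_exp_mul hu.integrable e

/-- In dimension one the half-wave phase splits into two linear phases. -/
lemma wavePh_mul_eq_of_dim_one (χ : Rn 1 → ℂ) (k : ℕ) (ξ : Rn 1) :
    wavePh ξ * dil k χ ξ =
      Complex.exp (Complex.I * ((⟪EuclideanSpace.single 0 1, ξ⟫_ℝ : ℝ) : ℂ)) *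
          dil k (fun ξ => (2⁻¹ : ℂ) * (χ ξ + cdir 0 χ ξ)) ξ +
        Complex.exp (Complex.I * ((⟪-EuclideanSpace.single 0 1, ξ⟫_ℝ : ℝ) : ℂ)) *
          dil k (fun ξ => (2⁻¹ : ℂ) * (χ ξ + (-1 : ℂ) * cdir 0 χ ξ)) ξ := by
  have hn : ‖ξ‖ = |ξ 0| := by
    rw [EuclideanSpace.norm_eq]
    simp [Real.sqrt_sq_eq_abs]
  have hin : ⟪(EuclideanSpace.single 0 1 : Rn 1), ξ⟫_ℝ = ξ 0 := by
    simp [EuclideanSpace.inner_single_left]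
  have hk : ((2 : ℝ) ^ k)⁻¹ ≠ 0 := by positivity
  have hc : cdir 0 χ (((2 : ℝ) ^ k)⁻¹ • ξ) =
      ((ξ 0 / |ξ 0| : ℝ) : ℂ) * χ (((2 : ℝ) ^ k)⁻¹ • ξ) := by
    unfold cdir
    rw [norm_smul, Real.norm_of_nonneg (by positivity), hn, PiLp.smul_apply, smul_eq_mul,
      mul_div_mul_left _ _ hk]
  unfold wavePh dil
  dsimp only
  rw [hc, inner_neg_left, hin, hn]
  rcases lt_trichotomy (ξ 0) 0 with h | h | h
  · rw [abs_of_neg h, div_neg, div_self h.ne]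
    push_cast
    ring
  · rw [h]
    simp
    ring
  · rw [abs_of_pos h, div_self h.ne']
    push_cast
    ring

lemma Tst0.exists_waveKern_le_of_dim_one {χ : Rn 1 → ℂ} (h : Tst0 χ) (N : ℕ) :
    ∃ C : ℝ≥0, ∀ k z, ‖waveKern χ k z‖ₑ ≤
      C * (wtE k N (z + EuclideanSpace.single 0 1) + wtE k N (z + -EuclideanSpace.single 0 1)) := by
  have hp : Tst (fun ξ => (2⁻¹ : ℂ) * (χ ξ + _root_.cdir 0 χ ξ)) := (h.1.add (h.cdir 0).1).const_mul _
  have hm : Tst (fun ξ => (2⁻¹ : ℂ) * (χ ξ + (-1 : ℂ) * _root_.cdir 0 χ ξ)) :=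
    (h.1.add ((h.cdir 0).1.const_mul _)).const_mul _
  obtain ⟨C1, hC1⟩ := hp.exists_enorm_kern_dil_le N
  obtain ⟨C2, hC2⟩ := hm.exists_enorm_kern_dil_le N
  refine ⟨C1 + C2, fun k z => ?_⟩
  unfold waveKern
  simp_rw [wavePh_mul_eq_of_dim_one]
  rw [kern_add (integrable_exp_inner_mul _ (hp.dil k)) (integrable_exp_inner_mul _ (hm.dil k)),
    kern_exp_mul, kern_exp_mul, mul_add]
  refine (enorm_add_le _ _).trans (add_le_add ((hC1 k _).trans ?_) ((hC2 k _).trans ?_)) <;>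
    refine mul_le_mul_left ?_ _ <;> push_cast
  · exact le_self_add
  · exact le_add_self

lemma wavg_comp_add {n : ℕ} (k N : ℕ) (U : Rn n → ℝ≥0∞) (e x : Rn n) :
    ∫⁻ y, wtE k N (x - y + e) * U y = wavg k N U (x + e) := by
  unfold wavg
  refine lintegral_congr fun y => ?_
  rw [sub_add_eq_add_sub]

lemma IsLPBase.exists_waveU_le_of_dim_one {ψ0 : Rn 1 → ℝ} (h : IsLPBase 1 ψ0) (s : ℝ) (P : ℕ) :
    ∃ C : ℝ≥0, ∀ (f : SchwartzMap (Rn 1) ℂ) (k : ℕ), k ≠ 0 → ∀ x, waveU ψ0 s f k x ≤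
      C * (peetre k P (lpU ψ0 s f k) (x + EuclideanSpace.single 0 1) +
        peetre k P (lpU ψ0 s f k) (x + -EuclideanSpace.single 0 1)) := by
  obtain ⟨C, hC⟩ := (h.tst0_fat one_ne_zero).exists_waveKern_le_of_dim_one (P + (1 + 1))
  refine ⟨C * (wtMass 1).toNNReal, fun f k hk x => ?_⟩
  push_cast
  rw [ENNReal.coe_toNNReal (wtMass_ne_top 1), mul_assoc, mul_add (wtMass 1)]
  have hV : Measurable fun y => ‖lpf ψ0 f k y‖ₑ := (h.continuous_lpf f k).enorm.measurable
  have h1 : ‖wavePiece ψ0 f k x‖ₑ ≤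
      C * (wavg k (P + (1 + 1)) (fun y => ‖lpf ψ0 f k y‖ₑ) (x + EuclideanSpace.single 0 1) +
        wavg k (P + (1 + 1)) (fun y => ‖lpf ψ0 f k y‖ₑ) (x + -EuclideanSpace.single 0 1)) := by
    rw [h.wavePiece_eq_waveKern f hk, ← wavg_comp_add, ← wavg_comp_add, ← lintegral_add_left,
      ← lintegral_const_mul' _ _ ENNReal.coe_ne_top]
    · refine (enorm_integral_le_lintegral_enorm _).trans (lintegral_mono fun y => ?_)
      rw [enorm_mul, ← add_mul, ← mul_assoc]
      exact mul_le_mul_left (hC k _) _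
    · exact ((measurable_wtE k _).comp ((measurable_id.const_sub x).add_const _)).mul hV
  unfold waveU
  refine (mul_le_mul_right h1 _).trans ?_
  rw [mul_left_comm, mul_add, ← wavg_const_mul _ _ ENNReal.ofReal_ne_top,
    ← wavg_const_mul _ _ ENNReal.ofReal_ne_top]
  exact mul_le_mul_right (add_le_add (wavg_le_peetre k P _ _) (wavg_le_peetre k P _ _)) _

lemma SymbolClass.exists_tlNorm_fio_le_of_dim_one {m : ℝ} {a : Rn 1 → Rn 1 → ℂ}
    (ha : SymbolClass 1 m a) {ψ0 : Rn 1 → ℝ} (hψ : IsLPBase 1 ψ0) (s : ℝ)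
    {q : ℝ≥0∞} (hq : 1 ≤ q) :
    ∃ C : ℝ≥0, ∀ f : SchwartzMap (Rn 1) ℂ,
      tlNorm 1 ψ0 (s - m) 1 q (fio 1 a (fun x ξ => ⟪x, ξ⟫_ℝ + ‖ξ‖) f) ≤
        C * tlNorm 1 ψ0 s 1 q f := by
  set P : ℕ := (1 + 1) + (1 + 1) with hP
  obtain ⟨C1, hC1⟩ := ha.enorm_fio_piece_le hψ (s - m) (P + (1 + 1))
  obtain ⟨C2, hC2⟩ := exists_lqSum_tsum_two_inv_pow_dist_le hq
  obtain ⟨C3, hC3⟩ := hψ.exists_lintegral_waveU_zero_le le_rfl s s hq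
  obtain ⟨C4, hC4⟩ := hψ.exists_waveU_le_of_dim_one s P
  obtain ⟨C5, hC5⟩ := hψ.exists_lintegral_peetre_le s hq
  refine ⟨C1 * (C2 * (2 * ((wtMass 1).toNNReal * C3 +
    (wtMass 1).toNNReal * C4 * (2 * (C5 + C5))))), fun f => ?_⟩
  push_cast
  rw [ENNReal.coe_toNNReal (wtMass_ne_top 1), hψ.tlNorm_one_eq, tlNorm_one_eq_lintegral]
  set e : Rn 1 := EuclideanSpace.single 0 1 with he
  set F : Rn 1 → ℝ≥0∞ := fun x => lqSum q fun k => peetre k P (lpU ψ0 s f k) x with hF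
  have hU : ∀ k x, lpU ψ0 s f k x ≠ ∞ := fun k x =>
    ENNReal.mul_ne_top ENNReal.ofReal_ne_top enorm_ne_top
  have hFm : Measurable F := measurable_lqSum q fun k => measurable_peetre k P (hU k)
  have hFe : Measurable fun x => F (x + e) := hFm.comp (measurable_add_const e)
  have hw0 : Measurable (wavg 0 (1 + 1) (waveU ψ0 s f 0)) :=
    measurable_wavg 0 (1 + 1) (hψ.measurable_waveU s f 0)
  have hpt : ∀ (k : ℕ) (x : Rn 1), wavg k (P + (1 + 1)) (waveU ψ0 s f k) x ≤
      (if k = 0 then wavg 0 (1 + 1) (waveU ψ0 s f 0) x else 0) +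
        wtMass 1 * C4 * (peetre k P (lpU ψ0 s f k) (x + e) + peetre k P (lpU ψ0 s f k) (x + -e)) := by
    intro k x
    rcases eq_or_ne k 0 with rfl | hk
    · rw [if_pos rfl]
      refine le_trans ?_ le_self_add
      exact lintegral_mono fun y => mul_le_mul_left (wtE_anti 0 (by omega) _) _
    · rw [if_neg hk, zero_add]
      refine (wavg_le_peetre k P _ x).trans ?_
      rw [mul_assoc]
      refine mul_le_mul_right ((peetre_mono k P (hC4 f k hk) x).trans ?_) _
      rw [peetre_const_mul]
      refine mul_le_mul_right ((peetre_add_le k P _ _ x).trans ?_) _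
      rw [peetre_comp_add k P (peetre k P (lpU ψ0 s f k)),
        peetre_comp_add k P (peetre k P (lpU ψ0 s f k))]
      exact add_le_add (peetre_peetre_le k P _ _) (peetre_peetre_le k P _ _)
  have hlq : ∀ x, (lqSum q fun k => wavg k (P + (1 + 1)) (waveU ψ0 s f k) x) ≤
      2 * (wavg 0 (1 + 1) (waveU ψ0 s f 0) x + wtMass 1 * C4 * (2 * (F (x + e) + F (x + -e)))) := by
    intro x
    refine (lqSum_mono fun k => hpt k x).trans ((lqSum_add_le hq _ _).trans
      (mul_le_mul_right (add_le_add ?_ ?_) _))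
    · refine (lqSum_le_tsum hq _).trans_eq ?_
      rw [tsum_ite_eq]
    · rw [lqSum_const_mul hq]
      exact mul_le_mul_right (lqSum_add_le hq _ _) _
  have hFint : ∫⁻ x, F x ≤ C5 * ∫⁻ x, lqSum q fun k => lpU ψ0 s f k x := hC5 f
  calc _ ≤ ∫⁻ x, C1 * (C2 * (2 * (wavg 0 (1 + 1) (waveU ψ0 s f 0) x +
        wtMass 1 * C4 * (2 * (F (x + e) + F (x + -e)))))) := by
        refine lintegral_mono fun x => ?_
        have h1 := fun j => hC1 f j x
        rw [sub_add_cancel] at h1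
        refine (lqSum_mono h1).trans ((lqSum_const_mul hq _ _).le.trans (mul_le_mul_right ?_ _))
        exact (hC2 _).trans (mul_le_mul_right (hlq x) _)
    _ = C1 * (C2 * (2 * (wtMass 1 * (∫⁻ x, waveU ψ0 s f 0 x) +
        wtMass 1 * C4 * (2 * ((∫⁻ x, F x) + ∫⁻ x, F x))))) := by
        rw [lintegral_const_mul' _ _ ENNReal.coe_ne_top, lintegral_const_mul' _ _ ENNReal.coe_ne_top,
          lintegral_const_mul' _ _ ENNReal.ofNat_ne_top, lintegral_add_left hw0,
          lintegral_wavg 0 (hψ.measurable_waveU s f 0),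
          lintegral_const_mul' _ _ (ENNReal.mul_ne_top (wtMass_ne_top 1) ENNReal.coe_ne_top),
          lintegral_const_mul' _ _ ENNReal.ofNat_ne_top,
          lintegral_add_left hFe, lintegral_add_right_eq_self,
          lintegral_add_right_eq_self]
    _ ≤ C1 * (C2 * (2 * (wtMass 1 * (C3 * ∫⁻ x, lqSum q fun k => lpU ψ0 s f k x) +
        wtMass 1 * C4 * (2 * ((C5 * ∫⁻ x, lqSum q fun k => lpU ψ0 s f k x) +
          C5 * ∫⁻ x, lqSum q fun k => lpU ψ0 s f k x))))) := by
        refine mul_le_mul_right (mul_le_mul_right (mul_le_mul_right (add_le_add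
          (mul_le_mul_right (hC3 f) _) (mul_le_mul_right (mul_le_mul_right
            (add_le_add hFint hFint) _) _)) _) _) _
    _ = _ := by ring

/-- For the phase `φ(x,ξ) = x·ξ + |ξ|` and an amplitude `a ∈ S^m`, the
operator `T_a^φ` maps `F^s_{1,q}` into `F^{s-m-(n-1)/2}_{1,q}` for all `1 ≤ q ≤ ∞`. -/
theorem triebel_lizorkin_boundedness_wave_phase_p_one
    (n : ℕ) (hn : 1 ≤ n) (s m : ℝ) (q : ℝ≥0∞) (hq : 1 ≤ q)
    (ψ0 : Rn n → ℝ) (hψ0 : IsLPBase n ψ0)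
    (a : Rn n → Rn n → ℂ) (ha : SymbolClass n m a) :
    ∃ C : ℝ≥0, ∀ f : SchwartzMap (Rn n) ℂ,
      tlNorm n ψ0 (s - m - ((n : ℝ) - 1) / 2) 1 q
          (fio n a (fun x ξ => ⟪x, ξ⟫_ℝ + ‖ξ‖) ⇑f) ≤
        (C : ℝ≥0∞) * tlNorm n ψ0 s 1 q ⇑f := by
  rcases hn.eq_or_lt with rfl | h2
  · have e : s - m - (((1 : ℕ) : ℝ) - 1) / 2 = s - m := by simp
    rw [e]
    exact ha.exists_tlNorm_fio_le_of_dim_one hψ0 s hq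
  · exact ha.exists_tlNorm_fio_le_of_two_le h2 hψ0 s hq
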